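/- (Second-order achievability with feedback.) For every ε ∈ (0, 1/2) there exist a constant K > 0 and an integer n₀ such that for all n ≥ n₀, log M*_f(n, ε) ≥ nC − √(nV)·Q^{−1}(2ε) − K·n^{1/3}·log n, where V = η²V₁ + (1−η)²V₂. -/

import Mathlib

open Finset

noncomputable section

variable {𝒳 𝒴 : Type*} [Fintype 𝒳] [Fintype 𝒴]

/-- `P` is a probability distribution on the finite alphabet `𝒳`. -/
def IsDist (P : 𝒳 → ℝ) : Prop := (∀ x, 0 ≤ P x) ∧ ∑ x, P x = 1

/-- The output distribution `PW` induced by input distribution `P` and channel `W`. -/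
def outDist (P : 𝒳 → ℝ) (W : 𝒳 → 𝒴 → ℝ) (y : 𝒴) : ℝ := ∑ x, P x * W x y

/-- The mutual information `I(P, W)` (natural logarithm). -/
def mutInfo (P : 𝒳 → ℝ) (W : 𝒳 → 𝒴 → ℝ) : ℝ :=
  ∑ x, ∑ y, P x * W x y * Real.log (W x y / outDist P W y)

/-- Relative entropy (KL divergence) between two pmfs on a finite alphabet. -/
def relEnt (p q : 𝒴 → ℝ) : ℝ := ∑ y, p y * Real.log (p y / q y)

/-- Directional derivative `∇I_k(v)` of the mutual information at `P*` along `v`. -/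
def gradI (Pstar : 𝒳 → ℝ) (W : 𝒳 → 𝒴 → ℝ) (v : 𝒳 → ℝ) : ℝ :=
  ∑ x, v x * relEnt (W x) (outDist Pstar W)


/-- Per-symbol information density `i_{P,W}(x;y)`. -/
def infoDens (P : 𝒳 → ℝ) (W : 𝒳 → 𝒴 → ℝ) (x : 𝒳) (y : 𝒴) : ℝ :=
  Real.log (W x y / outDist P W y)

/-- Causality of a feedback encoder: the input at time `i` depends on the message and
on the channel outputs at times `< i` only. -/
def Causal (n M : ℕ) (f : Fin M → (Fin n → 𝒴) → (Fin n → 𝒴) → Fin n → 𝒳) : Prop :=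
  ∀ (j : Fin M) (y1 y1' y2 y2' : Fin n → 𝒴) (i : Fin n),
    (∀ t, t < i → y1 t = y1' t) → (∀ t, t < i → y2 t = y2' t) →
      f j y1 y2 i = f j y1' y2' i

/-- The joint law `ℙ(j, y₁ⁿ, y₂ⁿ)` induced by an FLF code:
`(1/M) ∏ᵢ W₁(y₁ᵢ | fᵢ(j, y₁^{i-1}, y₂^{i-1})) W₂(y₂ᵢ | fᵢ(j, y₁^{i-1}, y₂^{i-1}))`. -/
def codeLaw (W1 W2 : 𝒳 → 𝒴 → ℝ) (n M : ℕ)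
    (f : Fin M → (Fin n → 𝒴) → (Fin n → 𝒴) → Fin n → 𝒳)
    (j : Fin M) (y1 y2 : Fin n → 𝒴) : ℝ :=
  (1 / M) * ∏ i, (W1 (f j y1 y2 i) (y1 i) * W2 (f j y1 y2 i) (y2 i))

/-- Error probability `ℙ[g(Y₁ⁿ) ≠ J]` at decoder 1. -/
def errProb1 (W1 W2 : 𝒳 → 𝒴 → ℝ) (n M : ℕ)
    (f : Fin M → (Fin n → 𝒴) → (Fin n → 𝒴) → Fin n → 𝒳)
    (g : (Fin n → 𝒴) → Fin M) : ℝ :=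
  ∑ j, ∑ y1 : Fin n → 𝒴, ∑ y2 : Fin n → 𝒴,
    if g y1 = j then 0 else codeLaw W1 W2 n M f j y1 y2

/-- Error probability `ℙ[g(Y₂ⁿ) ≠ J]` at decoder 2. -/
def errProb2 (W1 W2 : 𝒳 → 𝒴 → ℝ) (n M : ℕ)
    (f : Fin M → (Fin n → 𝒴) → (Fin n → 𝒴) → Fin n → 𝒳)
    (g : (Fin n → 𝒴) → Fin M) : ℝ :=
  ∑ j, ∑ y1 : Fin n → 𝒴, ∑ y2 : Fin n → 𝒴,
    if g y2 = j then 0 else codeLaw W1 W2 n M f j y1 y2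

/-- Per-symbol conditional variance `Var_{Y ∼ W(·|x)}(i_{P,W}(x;Y))`. -/
def symbVar (P : 𝒳 → ℝ) (W : 𝒳 → 𝒴 → ℝ) (x : 𝒳) : ℝ :=
  ∑ y, W x y * (infoDens P W x y - ∑ y', W x y' * infoDens P W x y') ^ 2

/-- Conditional information variance `V(P) = Σₓ P(x) Var_{Y∼W(·|x)}(i_{P,W}(x;Y))`. -/
def condInfoVar (P : 𝒳 → ℝ) (W : 𝒳 → 𝒴 → ℝ) : ℝ := ∑ x, P x * symbVar P W x

/-- Existence of an `(n, M, ε)` fixed-length feedback code. -/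
def FLFExists (W1 W2 : 𝒳 → 𝒴 → ℝ) (n M : ℕ) (ε : ℝ) : Prop :=
  ∃ f : Fin M → (Fin n → 𝒴) → (Fin n → 𝒴) → Fin n → 𝒳,
    Causal n M f ∧
      ∃ g1 g2 : (Fin n → 𝒴) → Fin M,
        errProb1 W1 W2 n M f g1 ≤ ε ∧ errProb2 W1 W2 n M f g2 ≤ ε

/-- `M*_f(n, ε)`: the maximum code size of `(n, M, ε)`-FLF codes. -/
noncomputable def MstarF (W1 W2 : 𝒳 → 𝒴 → ℝ) (n : ℕ) (ε : ℝ) : ℕ :=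
  sSup {M | FLFExists W1 W2 n M ε}

/-- The Gaussian tail function `Q(t)`. -/
noncomputable def Qfun (t : ℝ) : ℝ :=
  ∫ u in Set.Ioi t, Real.exp (-u ^ 2 / 2) / Real.sqrt (2 * Real.pi)

/-- The inverse `Q⁻¹` of the Gaussian tail function (on `(0,1)`). -/
noncomputable def Qinv : ℝ → ℝ := Function.invFun Qfun

section ProductWeights
open scoped Classical

variable {ι Ω : Type*} [Fintype ι] [DecidableEq ι] [Fintype Ω]

lemma sum_prod_weights (p : ι → Ω → ℝ) :
    ∑ c : ι → Ω, ∏ i, p i (c i) = ∏ i, ∑ ω, p i ω := by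
  rw [Finset.prod_univ_sum, Fintype.piFinset_univ]

/-- Resampling one coordinate does not change an expectation under a product law. -/
lemma sum_prod_weights_resample (p : ι → Ω → ℝ) (hp : ∀ i, ∑ ω, p i ω = 1)
    (F : (ι → Ω) → ℝ) (j : ι) :
    ∑ c : ι → Ω, (∏ i, p i (c i)) * F c
      = ∑ c : ι → Ω, (∏ i, p i (c i)) * ∑ ω, p j ω * F (Function.update c j ω) := by
  have h1 : ∑ c : ι → Ω, (∏ i, p i (c i)) * F c
      = ∑ z : (ι → Ω) × Ω, p j z.2 * ((∏ i, p i (z.1 i)) * F z.1) := by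
    rw [Fintype.sum_prod_type]
    refine Finset.sum_congr rfl fun c _ => ?_
    simp only
    rw [← Finset.sum_mul, hp, one_mul]
  have h2 : ∑ c : ι → Ω, (∏ i, p i (c i)) * ∑ ω, p j ω * F (Function.update c j ω)
      = ∑ z : (ι → Ω) × Ω,
          (∏ i, p i (z.1 i)) * (p j z.2 * F (Function.update z.1 j z.2)) := by
    rw [Fintype.sum_prod_type]
    refine Finset.sum_congr rfl fun c _ => ?_
    rw [Finset.mul_sum]
  rw [h1, h2]
  let e : (ι → Ω) × Ω → (ι → Ω) × Ω := fun z => (Function.update z.1 j z.2, z.1 j)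
  have he : Function.Involutive e := by
    rintro ⟨c, ω⟩
    simp [e]
  refine Finset.sum_bij' (fun z _ => e z) (fun z _ => e z) (by simp) (by simp)
    (fun z _ => he z) (fun z _ => he z) ?_
  rintro ⟨c, ω⟩ -
  simp only [e, Function.update_idem, Function.update_eq_self]
  rw [← Finset.mul_prod_erase univ _ (mem_univ j),
    ← Finset.mul_prod_erase univ (fun i => p i (Function.update c j ω i)) (mem_univ j)]
  have : ∏ i ∈ univ.erase j, p i (Function.update c j ω i) = ∏ i ∈ univ.erase j, p i (c i) := by
    refine Finset.prod_congr rfl fun i hi => ?_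
    rw [Function.update_of_ne (Finset.ne_of_mem_erase hi)]
  rw [this, Function.update_self]
  ring

lemma sum_prod_weights_marginal (p : ι → Ω → ℝ) (hp : ∀ i, ∑ ω, p i ω = 1)
    (g : Ω → ℝ) (j : ι) :
    ∑ c : ι → Ω, (∏ i, p i (c i)) * g (c j) = ∑ ω, p j ω * g ω := by
  rw [sum_prod_weights_resample p hp (fun c => g (c j)) j]
  simp only [Function.update_self]
  rw [← Finset.sum_mul, sum_prod_weights]
  simp [hp]

lemma sum_prod_weights_marginal₂ (p : ι → Ω → ℝ) (hp : ∀ i, ∑ ω, p i ω = 1)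
    (g : Ω → Ω → ℝ) {j k : ι} (hjk : j ≠ k) :
    ∑ c : ι → Ω, (∏ i, p i (c i)) * g (c j) (c k)
      = ∑ ω, p j ω * ∑ υ, p k υ * g ω υ := by
  rw [sum_prod_weights_resample p hp (fun c => g (c j) (c k)) k]
  simp only [Function.update_self, Function.update_of_ne hjk]
  exact sum_prod_weights_marginal p hp (fun ω => ∑ υ, p k υ * g ω υ) j

/-- Chernoff bound for sums of independent identically distributed centred bounded variables. -/
lemma chernoff_iid (p ξ : Ω → ℝ) (hp : ∀ ω, 0 ≤ p ω) (hp1 : ∑ ω, p ω = 1)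
    (hmean : ∑ ω, p ω * ξ ω = 0) {B : ℝ} (hB : ∀ ω, |ξ ω| ≤ B) {l : ℝ} (hl : 0 ≤ l)
    (hlB : l * B ≤ 1) (a : ℝ) :
    ∑ c : ι → Ω, (∏ i, p (c i)) * (if a ≤ ∑ i, ξ (c i) then 1 else 0)
      ≤ Real.exp (-(l * a) + Fintype.card ι * (l * B) ^ 2) := by
  have hmgf : ∑ ω, p ω * Real.exp (l * ξ ω) ≤ Real.exp ((l * B) ^ 2) := by
    have hpt : ∀ ω, Real.exp (l * ξ ω) ≤ 1 + l * ξ ω + (l * B) ^ 2 := by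
      intro ω
      have h1 : |l * ξ ω| ≤ l * B := by
        rw [abs_mul, abs_of_nonneg hl]
        exact mul_le_mul_of_nonneg_left (hB ω) hl
      have h2 := Real.abs_exp_sub_one_sub_id_le (h1.trans hlB)
      have h3 : (l * ξ ω) ^ 2 ≤ (l * B) ^ 2 := sq_le_sq.2 (h1.trans (le_abs_self _))
      linarith [(abs_le.1 h2).2]
    calc ∑ ω, p ω * Real.exp (l * ξ ω)
        ≤ ∑ ω, p ω * (1 + l * ξ ω + (l * B) ^ 2) :=
          Finset.sum_le_sum fun ω _ => mul_le_mul_of_nonneg_left (hpt ω) (hp ω)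
      _ = (∑ ω, p ω) * (1 + (l * B) ^ 2) + l * ∑ ω, p ω * ξ ω := by
          rw [Finset.sum_mul, Finset.mul_sum, ← Finset.sum_add_distrib]
          exact Finset.sum_congr rfl fun ω _ => by ring
      _ ≤ Real.exp ((l * B) ^ 2) := by
          rw [hp1, hmean]
          linarith [Real.add_one_le_exp ((l * B) ^ 2)]
  calc ∑ c : ι → Ω, (∏ i, p (c i)) * (if a ≤ ∑ i, ξ (c i) then 1 else 0)
      ≤ ∑ c : ι → Ω, (∏ i, p (c i)) * Real.exp (l * (∑ i, ξ (c i)) - l * a) := by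
        refine Finset.sum_le_sum fun c _ =>
          mul_le_mul_of_nonneg_left ?_ (Finset.prod_nonneg fun i _ => hp _)
        split_ifs with h
        · exact Real.one_le_exp (by nlinarith)
        · exact (Real.exp_pos _).le
    _ = Real.exp (-(l * a)) * ∑ c : ι → Ω, ∏ i, (p (c i) * Real.exp (l * ξ (c i))) := by
        rw [Finset.mul_sum]
        refine Finset.sum_congr rfl fun c _ => ?_
        rw [Finset.prod_mul_distrib, ← Real.exp_sum, ← Finset.mul_sum, sub_eq_add_neg,
          Real.exp_add]
        ring
    _ = Real.exp (-(l * a)) * (∑ ω, p ω * Real.exp (l * ξ ω)) ^ Fintype.card ι := by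
        rw [sum_prod_weights (fun _ ω => p ω * Real.exp (l * ξ ω))]
        simp
    _ ≤ Real.exp (-(l * a)) * Real.exp ((l * B) ^ 2) ^ Fintype.card ι := by
        refine mul_le_mul_of_nonneg_left (pow_le_pow_left₀ ?_ hmgf _) (Real.exp_pos _).le
        exact Finset.sum_nonneg fun ω _ => mul_nonneg (hp ω) (Real.exp_pos _).le
    _ = _ := by rw [← Real.exp_nat_mul, ← Real.exp_add]

end ProductWeights

section GaussianTail

/-- The standard Gaussian density. -/
def gaussDens (u : ℝ) : ℝ := Real.exp (-u ^ 2 / 2) / Real.sqrt (2 * Real.pi)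

lemma two_le_sqrt_two_pi : 2 ≤ Real.sqrt (2 * Real.pi) := by
  apply Real.le_sqrt_of_sq_le
  nlinarith [Real.pi_gt_three]

lemma gaussDens_eq_pdf (u : ℝ) : gaussDens u = ProbabilityTheory.gaussianPDFReal 0 1 u := by
  simp only [gaussDens, ProbabilityTheory.gaussianPDFReal, NNReal.coe_one, mul_one, sub_zero]
  rw [div_eq_inv_mul]

lemma gaussDens_pos (u : ℝ) : 0 < gaussDens u :=
  div_pos (Real.exp_pos _) (by linarith [two_le_sqrt_two_pi])

lemma integrable_gaussDens : MeasureTheory.Integrable gaussDens := by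
  have := ProbabilityTheory.integrable_gaussianPDFReal 0 1
  rwa [← funext gaussDens_eq_pdf] at this

lemma integral_gaussDens : ∫ u, gaussDens u = 1 := by
  have := ProbabilityTheory.integral_gaussianPDFReal_eq_one 0 (v := 1) one_ne_zero
  rwa [← funext gaussDens_eq_pdf] at this

lemma continuous_gaussDens : Continuous gaussDens := by
  unfold gaussDens; fun_prop

lemma Qfun_eq (t : ℝ) : Qfun t = ∫ u in Set.Ioi t, gaussDens u := rfl

lemma Qfun_nonneg (t : ℝ) : 0 ≤ Qfun t :=
  MeasureTheory.integral_nonneg fun u => (gaussDens_pos u).le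

lemma Qfun_neg (t : ℝ) : Qfun (-t) = 1 - Qfun t := by
  have h1 : Qfun (-t) = ∫ u in Set.Iic t, gaussDens u := by
    rw [Qfun_eq, ← integral_comp_neg_Iic]
    simp [gaussDens]
  have h2 := MeasureTheory.setIntegral_union (Set.Iic_disjoint_Ioi (le_refl t))
    measurableSet_Ioi integrable_gaussDens.integrableOn integrable_gaussDens.integrableOn
  rw [Set.Iic_union_Ioi, MeasureTheory.setIntegral_univ, integral_gaussDens] at h2
  rw [h1, Qfun_eq]
  linarith

lemma Qfun_le_one (t : ℝ) : Qfun t ≤ 1 := by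
  have := Qfun_nonneg (-t)
  rw [Qfun_neg] at this
  linarith

lemma Qfun_sub (a b : ℝ) : Qfun b - Qfun a = -∫ u in a..b, gaussDens u := by
  have := intervalIntegral.integral_Iic_sub_Iic (a := a) (b := b) (f := gaussDens)
    (μ := MeasureTheory.volume)
    integrable_gaussDens.integrableOn integrable_gaussDens.integrableOn
  have h : ∀ t, ∫ u in Set.Iic t, gaussDens u = 1 - Qfun t := by
    intro t
    rw [← Qfun_neg, Qfun_eq, ← integral_comp_neg_Iic]
    simp [gaussDens]
  rw [← this, h, h]
  ring

lemma hasDerivAt_Qfun (t : ℝ) : HasDerivAt Qfun (-gaussDens t) t := by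
  have h : Qfun = fun t => Qfun 0 - ∫ u in (0 : ℝ)..t, gaussDens u := by
    funext t
    have := Qfun_sub 0 t
    linarith
  rw [h]
  exact (intervalIntegral.integral_hasDerivAt_right
    (continuous_gaussDens.intervalIntegrable _ _)
    (continuous_gaussDens.stronglyMeasurableAtFilter _ _)
    continuous_gaussDens.continuousAt).const_sub _

lemma Qfun_antitone : Antitone Qfun :=
  antitone_of_deriv_nonpos (fun t => (hasDerivAt_Qfun t).differentiableAt) fun t => by
    rw [(hasDerivAt_Qfun t).deriv]
    linarith [gaussDens_pos t]

lemma Qfun_le_exp (t : ℝ) : Qfun t ≤ Real.exp (-t) := by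
  rw [Qfun_eq, ← integral_exp_neg_Ioi]
  refine MeasureTheory.setIntegral_mono integrable_gaussDens.integrableOn
    (integrableOn_exp_neg_Ioi t) fun u => ?_
  unfold gaussDens
  rw [div_le_iff₀ (by linarith [two_le_sqrt_two_pi])]
  have h1 : Real.exp (-u ^ 2 / 2) ≤ Real.exp (-u) * Real.exp (1 / 2) := by
    rw [← Real.exp_add, Real.exp_le_exp]
    nlinarith [sq_nonneg (u - 1)]
  have h2 : Real.exp (1 / 2) ≤ 2 := by
    have : Real.exp (1 / 2) ^ 2 ≤ 2 ^ 2 := by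
      rw [← Real.exp_nat_mul]
      norm_num
      linarith [Real.exp_one_lt_d9]
    exact (abs_le_of_sq_le_sq' this (by norm_num)).2
  refine h1.trans (mul_le_mul_of_nonneg_left (h2.trans two_le_sqrt_two_pi) (Real.exp_pos _).le)

lemma exists_Qfun_eq {p : ℝ} (h0 : 0 < p) (h1 : p < 1) : ∃ t, Qfun t = p := by
  have hc : Continuous Qfun :=
    continuous_iff_continuousAt.2 fun t => (hasDerivAt_Qfun t).continuousAt
  refine mem_range_of_exists_le_of_exists_ge hc ⟨-Real.log p, ?_⟩ ⟨Real.log (1 - p), ?_⟩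
  · refine (Qfun_le_exp _).trans ?_
    rw [neg_neg, Real.exp_log h0]
  · have h := Qfun_neg (-Real.log (1 - p))
    have h' := Qfun_le_exp (-Real.log (1 - p))
    rw [neg_neg, Real.exp_log (by linarith)] at h'
    rw [neg_neg] at h
    linarith

lemma Qfun_Qinv {p : ℝ} (h0 : 0 < p) (h1 : p < 1) : Qfun (Qinv p) = p :=
  Function.invFun_eq (exists_Qfun_eq h0 h1)

lemma abs_sub_le_of_hasDerivAt {f f' : ℝ → ℝ} {a b C : ℝ}
    (hf : ∀ x ∈ Set.uIcc a b, HasDerivAt f (f' x) x)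
    (hC : ∀ x ∈ Set.uIcc a b, |f' x| ≤ C) : |f b - f a| ≤ C * |b - a| :=
  (convex_uIcc a b).norm_image_sub_le_of_norm_hasDerivWithin_le
    (fun x hx => (hf x hx).hasDerivWithinAt) hC Set.left_mem_uIcc Set.right_mem_uIcc

lemma abs_sub_le_of_mem_uIcc {a b x : ℝ} (hx : x ∈ Set.uIcc a b) : |x - a| ≤ |b - a| := by
  have := Set.abs_sub_left_of_mem_uIcc hx
  simpa [abs_sub_comm] using this

lemma taylor_two_bound {f f' f'' : ℝ → ℝ} {a b C : ℝ}
    (hf : ∀ x ∈ Set.uIcc a b, HasDerivAt f (f' x) x)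
    (hf' : ∀ x ∈ Set.uIcc a b, HasDerivAt f' (f'' x) x)
    (hC : ∀ x ∈ Set.uIcc a b, |f'' x| ≤ C) :
    |f b - f a - f' a * (b - a)| ≤ C * |b - a| ^ 2 := by
  have h1 : ∀ x ∈ Set.uIcc a b, |f' x - f' a| ≤ C * |b - a| := by
    intro x hx
    have hsub := Set.uIcc_subset_uIcc_left hx
    have hC0 : 0 ≤ C := (abs_nonneg _).trans (hC x hx)
    exact (abs_sub_le_of_hasDerivAt (fun z hz => hf' z (hsub hz))
      (fun z hz => hC z (hsub hz))).trans
        (mul_le_mul_of_nonneg_left (abs_sub_le_of_mem_uIcc hx) hC0)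
  have h2 := abs_sub_le_of_hasDerivAt (f := fun x => f x - f' a * (x - a))
    (f' := fun x => f' x - f' a) (a := a) (b := b)
    (fun x hx => by
      have := (hf x hx).sub (((hasDerivAt_id x).sub_const a).const_mul (f' a))
      exact this.congr_deriv (by simp)) h1
  have e : f b - f' a * (b - a) - (f a - f' a * (a - a)) = f b - f a - f' a * (b - a) := by ring
  simp only [e] at h2
  linarith [h2, (by ring : C * |b - a| * |b - a| = C * |b - a| ^ 2)]

lemma taylor_three_bound {f f' f'' f''' : ℝ → ℝ} {a b C : ℝ}
    (hf : ∀ x, HasDerivAt f (f' x) x) (hf' : ∀ x, HasDerivAt f' (f'' x) x)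
    (hf'' : ∀ x, HasDerivAt f'' (f''' x) x) (hC : ∀ x, |f''' x| ≤ C) :
    |f b - f a - f' a * (b - a) - f'' a * (b - a) ^ 2 / 2| ≤ C * |b - a| ^ 3 := by
  have hC0 : 0 ≤ C := (abs_nonneg _).trans (hC a)
  have h1 : ∀ x ∈ Set.uIcc a b, |f' x - f' a - f'' a * (x - a)| ≤ C * |b - a| ^ 2 := by
    intro x hx
    exact (taylor_two_bound (fun z _ => hf' z) (fun z _ => hf'' z) (fun z _ => hC z)).trans
      (mul_le_mul_of_nonneg_left
        (pow_le_pow_left₀ (abs_nonneg _) (abs_sub_le_of_mem_uIcc hx) 2) hC0)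
  have h2 := abs_sub_le_of_hasDerivAt
    (f := fun x => f x - f' a * (x - a) - f'' a * (x - a) ^ 2 / 2)
    (f' := fun x => f' x - f' a - f'' a * (x - a)) (a := a) (b := b)
    (fun x _ => by
      have := ((hf x).sub (((hasDerivAt_id x).sub_const a).const_mul (f' a))).sub
        (((((hasDerivAt_id x).sub_const a).pow 2).const_mul (f'' a)).div_const 2)
      refine this.congr_deriv ?_
      simp; ring) h1
  have e : f b - f' a * (b - a) - f'' a * (b - a) ^ 2 / 2
      - (f a - f' a * (a - a) - f'' a * (a - a) ^ 2 / 2)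
      = f b - f a - f' a * (b - a) - f'' a * (b - a) ^ 2 / 2 := by ring
  simp only [e] at h2
  linarith [h2, (by ring : C * |b - a| ^ 2 * |b - a| = C * |b - a| ^ 3)]

lemma hasDerivAt_gaussDens (y : ℝ) : HasDerivAt gaussDens (-(y * gaussDens y)) y := by
  have h : HasDerivAt (fun u : ℝ => -u ^ 2 / 2) (-y) y := by
    have := (((hasDerivAt_id y).pow 2).neg).div_const 2
    refine this.congr_deriv ?_
    simp
    ring
  have h2 := (h.exp).div_const (Real.sqrt (2 * Real.pi))
  refine h2.congr_deriv ?_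
  unfold gaussDens
  ring

lemma gaussDens_mul_le {y c : ℝ} (hc : c ≤ 8 + 4 * y ^ 2 + y ^ 4) :
    c * gaussDens y ≤ 4 := by
  have h1 : 1 + y ^ 2 / 2 + (y ^ 2 / 2) ^ 2 / 2 ≤ Real.exp (y ^ 2 / 2) :=
    Real.quadratic_le_exp_of_nonneg (by positivity)
  have h2 : c ≤ 8 * Real.exp (y ^ 2 / 2) := by nlinarith
  have h3 : c * Real.exp (-y ^ 2 / 2) ≤ 8 := by
    have := mul_le_mul_of_nonneg_right h2 (Real.exp_pos (-y ^ 2 / 2)).le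
    rwa [mul_assoc, ← Real.exp_add, show y ^ 2 / 2 + -y ^ 2 / 2 = 0 by ring, Real.exp_zero,
      mul_one] at this
  unfold gaussDens
  rw [← mul_div_assoc, div_le_iff₀ (by linarith [two_le_sqrt_two_pi])]
  linarith [two_le_sqrt_two_pi]

lemma abs_mul_gaussDens_le {y c : ℝ} (hc : 4 * |c| ≤ 8 + 4 * y ^ 2 + y ^ 4) :
    |c * gaussDens y| ≤ 1 := by
  rw [abs_mul, abs_of_pos (gaussDens_pos y)]
  linarith [gaussDens_mul_le hc]

lemma gaussDens_le_one (y : ℝ) : gaussDens y ≤ 1 := by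
  have := gaussDens_mul_le (y := y) (c := 8) (by nlinarith [sq_nonneg y, sq_nonneg (y ^ 2)])
  linarith

lemma Qfun_taylor (y s : ℝ) :
    |Qfun (y + s) - Qfun y + gaussDens y * s - y * gaussDens y * s ^ 2 / 2| ≤ |s| ^ 3 := by
  have h := taylor_three_bound (f := Qfun) (f' := fun y => -gaussDens y)
    (f'' := fun y => y * gaussDens y) (f''' := fun y => (1 - y ^ 2) * gaussDens y)
    (a := y) (b := y + s) (C := 1) hasDerivAt_Qfun
    (fun x => (hasDerivAt_gaussDens x).neg.congr_deriv (by simp))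
    (fun x => by
      have := (hasDerivAt_id x).mul (hasDerivAt_gaussDens x)
      refine this.congr_deriv ?_
      simp; ring)
    (fun x => abs_mul_gaussDens_le (by
      rcases abs_cases (1 - x ^ 2) with h | h <;> nlinarith [sq_nonneg x, sq_nonneg (x ^ 2)]))
  simpa [sub_eq_add_neg, add_assoc] using h

lemma abs_Qfun_sub_le (a b : ℝ) : |Qfun b - Qfun a| ≤ |b - a| := by
  have := abs_sub_le_of_hasDerivAt (a := a) (b := b) (C := 1) (fun x _ => hasDerivAt_Qfun x)
    (fun x _ => by rw [abs_neg, abs_of_pos (gaussDens_pos x)]; exact gaussDens_le_one x)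
  linarith

/-- On a bounded interval, the Gaussian tail decreases at least linearly. -/
lemma exists_Qfun_add_le (z : ℝ) :
    ∃ c > 0, ∀ d, 0 ≤ d → d ≤ 1 → Qfun (z + d) ≤ Qfun z - c * d := by
  obtain ⟨x, -, hx⟩ := isCompact_Icc.exists_isMinOn (Set.nonempty_Icc.2 (by linarith : z ≤ z + 1))
    continuous_gaussDens.continuousOn
  refine ⟨gaussDens x, gaussDens_pos x, fun d hd0 hd1 => ?_⟩
  have h := Qfun_sub z (z + d)
  have h2 : ∫ u in z..(z + d), gaussDens x ≤ ∫ u in z..(z + d), gaussDens u := by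
    refine intervalIntegral.integral_mono_on (by linarith) (by simp)
      (continuous_gaussDens.intervalIntegrable _ _) fun u hu => ?_
    exact hx ⟨hu.1, by linarith [hu.2]⟩
  rw [intervalIntegral.integral_const] at h2
  simp only [add_sub_cancel_left, smul_eq_mul] at h2
  linarith

lemma Qfun_heat (a : ℝ) {t V : ℝ} (ht : 0 < t) (hV : 0 ≤ V) :
    |Qfun (a / Real.sqrt (t + V)) - Qfun (a / Real.sqrt t)
      - a / Real.sqrt t * gaussDens (a / Real.sqrt t) / (2 * t) * V| ≤ V ^ 2 / t ^ 2 := by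
  have hy : ∀ x, 0 < x →
      HasDerivAt (fun x => a / Real.sqrt x) (-(a / Real.sqrt x / (2 * x))) x := by
    intro x hx
    have h1 := (Real.hasDerivAt_sqrt hx.ne').inv (Real.sqrt_pos.2 hx).ne' |>.const_mul a
    have hs := Real.sq_sqrt hx.le
    have hs0 := (Real.sqrt_pos.2 hx).ne'
    refine h1.congr_deriv ?_
    rw [hs]
    field_simp
  have hmem : ∀ x ∈ Set.uIcc t (t + V), t ≤ x := by
    intro x hx
    rw [Set.uIcc_of_le (by linarith)] at hx
    exact hx.1
  have h := taylor_two_bound (a := t) (b := t + V) (C := 1 / t ^ 2)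
    (f := fun x => Qfun (a / Real.sqrt x))
    (f' := fun x => a / Real.sqrt x * gaussDens (a / Real.sqrt x) / (2 * x))
    (f'' := fun x => (a / Real.sqrt x * ((a / Real.sqrt x) ^ 2 - 3) / 4)
      * gaussDens (a / Real.sqrt x) / x ^ 2)
    (fun x hx => by
      have hx0 : 0 < x := ht.trans_le (hmem x hx)
      have := (hasDerivAt_Qfun (a / Real.sqrt x)).comp x (hy x hx0)
      refine this.congr_deriv ?_
      ring)
    (fun x hx => by
      have hx0 : 0 < x := ht.trans_le (hmem x hx)
      have h1 := (hasDerivAt_gaussDens (a / Real.sqrt x)).comp x (hy x hx0)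
      have h2 := ((hy x hx0).mul h1).div ((hasDerivAt_id x).const_mul 2) (by simp; exact hx0.ne')
      refine h2.congr_deriv ?_
      simp only [Function.comp, Pi.mul_apply, id]
      have hs0 := (Real.sqrt_pos.2 hx0).ne'
      generalize a / Real.sqrt x = y
      field_simp
      ring)
    (fun x hx => by
      have htx := hmem x hx
      rw [abs_div, abs_of_pos (show 0 < x ^ 2 by have := ht.trans_le htx; positivity)]
      have h1 : |(a / Real.sqrt x * ((a / Real.sqrt x) ^ 2 - 3) / 4)
          * gaussDens (a / Real.sqrt x)| ≤ 1 := by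
        refine abs_mul_gaussDens_le ?_
        generalize a / Real.sqrt x = y
        rw [abs_div, abs_of_pos (by norm_num : (0 : ℝ) < 4), abs_mul]
        have h3 : |y ^ 2 - 3| ≤ y ^ 2 + 3 := by
          rw [abs_le]; constructor <;> nlinarith [sq_nonneg y]
        have h4 : 0 ≤ |y| := abs_nonneg y
        have h5 : |y| ^ 2 = y ^ 2 := sq_abs y
        have h6 : y ^ 4 = |y| ^ 4 := by
          rw [show y ^ 4 = (y ^ 2) ^ 2 by ring, ← h5]
          ring
        rw [h6, ← h5]
        rw [← h5] at h3
        have h7 := mul_le_mul_of_nonneg_left h3 h4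
        nlinarith [sq_nonneg (|y| - 1), sq_nonneg (|y| ^ 2 - |y|), mul_nonneg h4 (sq_nonneg (|y| - 1))]
      exact div_le_div₀ zero_le_one h1 (by positivity)
        (pow_le_pow_left₀ ht.le htx 2))
  simp only [add_sub_cancel_left, sq_abs] at h
  calc _ ≤ 1 / t ^ 2 * V ^ 2 := h
    _ = _ := by ring

end GaussianTail

section Lindeberg
open scoped Classical

variable {α : Type*} [Fintype α]

lemma Qfun_lindeberg_swap (p ξ : α → ℝ) (hp : ∀ a, 0 ≤ p a) (hp1 : ∑ a, p a = 1)
    (hmean : ∑ a, p a * ξ a = 0) {B V : ℝ} (hB : ∀ a, |ξ a| ≤ B)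
    (hV : ∑ a, p a * ξ a ^ 2 = V) {t : ℝ} (ht : 1 ≤ t) (x : ℝ) :
    |∑ a, p a * Qfun ((x + ξ a) / Real.sqrt t) - Qfun (x / Real.sqrt (t + V))|
      ≤ (B + B ^ 2) * (V / Real.sqrt t ^ 3) := by
  have ht0 : 0 < t := by linarith
  have hs0 : 0 < Real.sqrt t := Real.sqrt_pos.2 ht0
  have hs1 : 1 ≤ Real.sqrt t := Real.one_le_sqrt.2 ht
  have hss : Real.sqrt t ^ 2 = t := Real.sq_sqrt ht0.le
  have hV0 : 0 ≤ V := hV ▸ Finset.sum_nonneg fun a _ => mul_nonneg (hp a) (sq_nonneg _)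
  have hVB : V ≤ B ^ 2 := by
    rw [← hV, ← one_mul (B ^ 2), ← hp1, Finset.sum_mul]
    exact Finset.sum_le_sum fun a _ => mul_le_mul_of_nonneg_left
      (sq_le_sq.2 ((hB a).trans (le_abs_self B))) (hp a)
  set y := x / Real.sqrt t with hy
  set s := Real.sqrt t with hs
  have h1 : ∀ a, |Qfun ((x + ξ a) / s) - Qfun y + gaussDens y * (ξ a / s)
      - y * gaussDens y * (ξ a / s) ^ 2 / 2| ≤ B * ξ a ^ 2 / s ^ 3 := by
    intro a
    have h := Qfun_taylor y (ξ a / s)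
    rw [hy, ← add_div, ← hy] at h
    refine h.trans ?_
    rw [abs_div, abs_of_pos hs0, div_pow]
    gcongr
    calc |ξ a| ^ 3 = |ξ a| * ξ a ^ 2 := by rw [← sq_abs (ξ a)]; ring
      _ ≤ B * ξ a ^ 2 := mul_le_mul_of_nonneg_right (hB a) (sq_nonneg _)
  have h2 : |∑ a, p a * Qfun ((x + ξ a) / s) - Qfun y - y * gaussDens y * V / (2 * t)|
      ≤ B * V / s ^ 3 := by
    have e : ∑ a, p a * Qfun ((x + ξ a) / s) - Qfun y - y * gaussDens y * V / (2 * t)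
        = ∑ a, p a * (Qfun ((x + ξ a) / s) - Qfun y + gaussDens y * (ξ a / s)
          - y * gaussDens y * (ξ a / s) ^ 2 / 2) := by
      have e1 : ∀ a, p a * (Qfun ((x + ξ a) / s) - Qfun y + gaussDens y * (ξ a / s)
          - y * gaussDens y * (ξ a / s) ^ 2 / 2)
          = p a * Qfun ((x + ξ a) / s) - p a * Qfun y + gaussDens y / s * (p a * ξ a)
            - y * gaussDens y / (2 * t) * (p a * ξ a ^ 2) := by
        intro a
        rw [← hss]
        field_simp
      simp only [e1, Finset.sum_add_distrib, Finset.sum_sub_distrib, ← Finset.mul_sum,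
        ← Finset.sum_mul, hp1, hmean, hV]
      ring
    rw [e]
    refine (Finset.abs_sum_le_sum_abs _ _).trans ?_
    rw [← hV, Finset.mul_sum, Finset.sum_div]
    refine Finset.sum_le_sum fun a _ => ?_
    rw [abs_mul, abs_of_nonneg (hp a)]
    calc p a * _ ≤ p a * (B * ξ a ^ 2 / s ^ 3) := mul_le_mul_of_nonneg_left (h1 a) (hp a)
      _ = _ := by ring
  have h3 := Qfun_heat x ht0 hV0
  rw [← hs, ← hy] at h3
  have h4 : V ^ 2 / t ^ 2 ≤ B ^ 2 * V / s ^ 3 := by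
    rw [← hss]
    apply div_le_div₀ (mul_nonneg (sq_nonneg _) hV0) (by nlinarith) (by positivity)
    nlinarith [pow_pos hs0 3]
  have e : ∑ a, p a * Qfun ((x + ξ a) / s) - Qfun (x / Real.sqrt (t + V))
      = (∑ a, p a * Qfun ((x + ξ a) / s) - Qfun y - y * gaussDens y * V / (2 * t))
        - (Qfun (x / Real.sqrt (t + V)) - Qfun y - y * gaussDens y / (2 * t) * V) := by ring
  rw [e]
  refine (abs_sub _ _).trans ((add_le_add h2 (h3.trans h4)).trans (le_of_eq ?_))
  ring

lemma div_sqrt_cube_le {B V t : ℝ} (hB : 0 ≤ B) (hV : 0 ≤ V) (hVB : V ≤ B ^ 2) (ht : 1 ≤ t) :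
    V / Real.sqrt t ^ 3
      ≤ (1 + B) * (2 + B) * (1 / Real.sqrt t - 1 / Real.sqrt (t + V)) := by
  have ht0 : 0 < t := by linarith
  have hs0 : 0 < Real.sqrt t := Real.sqrt_pos.2 ht0
  have hss : Real.sqrt t ^ 2 = t := Real.sq_sqrt ht0.le
  have hr0 : 0 < Real.sqrt (t + V) := Real.sqrt_pos.2 (by linarith)
  have hrr : Real.sqrt (t + V) ^ 2 = t + V := Real.sq_sqrt (by linarith)
  have hr : Real.sqrt (t + V) ≤ (1 + B) * Real.sqrt t := by
    apply Real.sqrt_le_iff.2 ⟨by positivity, ?_⟩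
    rw [mul_pow, hss]
    nlinarith
  set s := Real.sqrt t
  set r := Real.sqrt (t + V)
  have hVe : V = (r - s) * (r + s) := by nlinarith
  have hsr : s ≤ r := Real.sqrt_le_sqrt (by linarith)
  have e : 1 / s - 1 / r = (r - s) / (s * r) := by field_simp
  rw [e, hVe, ← mul_div_assoc, div_le_div_iff₀ (by positivity) (by positivity)]
  have h1 : (r + s) * r ≤ ((2 + B) * s) * ((1 + B) * s) := by
    apply mul_le_mul _ hr hr0.le (by positivity)
    linarith
  have h2 := mul_le_mul_of_nonneg_left h1 (mul_nonneg (sub_nonneg.2 hsr) hs0.le)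
  nlinarith

/-- Smoothed central limit theorem for bounded i.i.d. variables, by Lindeberg's replacement
method along the heat flow. -/
lemma Qfun_lindeberg (p ξ : α → ℝ) (hp : ∀ a, 0 ≤ p a) (hp1 : ∑ a, p a = 1)
    (hmean : ∑ a, p a * ξ a = 0) {B V : ℝ} (hB0 : 0 ≤ B) (hB : ∀ a, |ξ a| ≤ B)
    (hV : ∑ a, p a * ξ a ^ 2 = V) {t : ℝ} (ht : 1 ≤ t) (n : ℕ) (x : ℝ) :
    |∑ c : Fin n → α, (∏ i, p (c i)) * Qfun ((x + ∑ i, ξ (c i)) / Real.sqrt t)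
        - Qfun (x / Real.sqrt (t + n * V))|
      ≤ (B + B ^ 2) * ((1 + B) * (2 + B))
        * (1 / Real.sqrt t - 1 / Real.sqrt (t + n * V)) := by
  have hV0 : 0 ≤ V := hV ▸ Finset.sum_nonneg fun a _ => mul_nonneg (hp a) (sq_nonneg _)
  have hVB : V ≤ B ^ 2 := by
    rw [← hV, ← one_mul (B ^ 2), ← hp1, Finset.sum_mul]
    exact Finset.sum_le_sum fun a _ => mul_le_mul_of_nonneg_left
      (sq_le_sq.2 ((hB a).trans (le_abs_self B))) (hp a)
  induction n generalizing x with
  | zero => simp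
  | succ n ih =>
    have e1 : ∑ c : Fin (n + 1) → α,
          (∏ i, p (c i)) * Qfun ((x + ∑ i, ξ (c i)) / Real.sqrt t)
        = ∑ a, p a * ∑ c : Fin n → α,
          (∏ i, p (c i)) * Qfun ((x + ξ a + ∑ i, ξ (c i)) / Real.sqrt t) := by
      rw [← (Fin.consEquiv fun _ => α).sum_comp, Fintype.sum_prod_type]
      refine Finset.sum_congr rfl fun a _ => ?_
      rw [Finset.mul_sum]
      refine Finset.sum_congr rfl fun c _ => ?_
      simp [Fin.consEquiv, Fin.prod_univ_succ, Fin.sum_univ_succ, mul_assoc, add_assoc]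
    set K := (B + B ^ 2) * ((1 + B) * (2 + B)) with hK
    set t' := t + n * V with ht'
    have ht1 : 1 ≤ t' := by
      have : 0 ≤ (n : ℝ) * V := by positivity
      linarith
    have e2 : t + ((n + 1 : ℕ) : ℝ) * V = t' + V := by push_cast; ring
    rw [e1, e2]
    have h1 : |∑ a, p a * ∑ c : Fin n → α,
          (∏ i, p (c i)) * Qfun ((x + ξ a + ∑ i, ξ (c i)) / Real.sqrt t)
        - ∑ a, p a * Qfun ((x + ξ a) / Real.sqrt t')|
        ≤ K * (1 / Real.sqrt t - 1 / Real.sqrt t') := by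
      rw [← Finset.sum_sub_distrib]
      refine (Finset.abs_sum_le_sum_abs _ _).trans ?_
      rw [← one_mul (K * (1 / Real.sqrt t - 1 / Real.sqrt t')),
        show (1 : ℝ) * (K * (1 / Real.sqrt t - 1 / Real.sqrt t'))
          = (∑ a, p a) * (K * (1 / Real.sqrt t - 1 / Real.sqrt t')) by rw [hp1], Finset.sum_mul]
      refine Finset.sum_le_sum fun a _ => ?_
      rw [← mul_sub, abs_mul, abs_of_nonneg (hp a)]
      exact mul_le_mul_of_nonneg_left (ih (x + ξ a)) (hp a)
    have h2 := Qfun_lindeberg_swap p ξ hp hp1 hmean hB hV ht1 x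
    have h3 := mul_le_mul_of_nonneg_left (div_sqrt_cube_le hB0 hV0 hVB ht1)
      (by positivity : 0 ≤ B + B ^ 2)
    rw [← mul_assoc, ← hK] at h3
    have h4 := abs_add_le (∑ a, p a * ∑ c : Fin n → α,
          (∏ i, p (c i)) * Qfun ((x + ξ a + ∑ i, ξ (c i)) / Real.sqrt t)
        - ∑ a, p a * Qfun ((x + ξ a) / Real.sqrt t'))
        (∑ a, p a * Qfun ((x + ξ a) / Real.sqrt t') - Qfun (x / Real.sqrt (t' + V)))
    rw [sub_add_sub_cancel] at h4
    linarith

/-- Two-sided Gaussian approximation, up to a shift of the threshold, of the distribution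
function of a sum of bounded i.i.d. variables. -/
lemma clt_iid (p ξ : α → ℝ) (hp : ∀ a, 0 ≤ p a) (hp1 : ∑ a, p a = 1)
    (hmean : ∑ a, p a * ξ a = 0) {B V : ℝ} (hB0 : 0 ≤ B) (hB : ∀ a, |ξ a| ≤ B)
    (hV : ∑ a, p a * ξ a ^ 2 = V) {d : ℝ} (hd : 1 ≤ d) (n : ℕ) (q w : ℝ) :
    ∑ c : Fin n → α, (∏ i, p (c i)) * (if ∑ i, ξ (c i) < q then 1 else 0)
        ≤ Qfun (-(q + d * w) / Real.sqrt (d ^ 2 + n * V))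
          + ((B + B ^ 2) * ((1 + B) * (2 + B)) / d + Real.exp (-w)) ∧
    Qfun (-(q - d * w) / Real.sqrt (d ^ 2 + n * V))
          - ((B + B ^ 2) * ((1 + B) * (2 + B)) / d + Real.exp (-w))
      ≤ ∑ c : Fin n → α, (∏ i, p (c i)) * (if ∑ i, ξ (c i) < q then 1 else 0) := by
  have hd0 : 0 < d := by linarith
  have hdd : Real.sqrt (d ^ 2) = d := Real.sqrt_sq hd0.le
  have hmass : ∑ c : Fin n → α, ∏ i, p (c i) = 1 := by
    rw [sum_prod_weights (fun _ => p)]; simp [hp1]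
  have hw := Qfun_le_exp w
  set K := (B + B ^ 2) * ((1 + B) * (2 + B)) with hK
  have hK0 : 0 ≤ K := by positivity
  have hlin : ∀ x, |∑ c : Fin n → α, (∏ i, p (c i)) * Qfun ((x + ∑ i, ξ (c i)) / d)
        - Qfun (x / Real.sqrt (d ^ 2 + n * V))| ≤ K / d := by
    intro x
    have h := Qfun_lindeberg p ξ hp hp1 hmean hB0 hB hV (t := d ^ 2) (by nlinarith) n x
    rw [hdd, ← hK] at h
    refine h.trans ?_
    rw [div_eq_mul_one_div K d]
    refine mul_le_mul_of_nonneg_left ?_ hK0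
    have : 0 ≤ 1 / Real.sqrt (d ^ 2 + n * V) := by positivity
    linarith
  constructor
  · have h1 : ∑ c : Fin n → α, (∏ i, p (c i)) * (if ∑ i, ξ (c i) < q then (1 : ℝ) else 0)
        ≤ ∑ c : Fin n → α, (∏ i, p (c i))
          * (Qfun ((-(q + d * w) + ∑ i, ξ (c i)) / d) + Real.exp (-w)) := by
      refine Finset.sum_le_sum fun c _ =>
        mul_le_mul_of_nonneg_left ?_ (Finset.prod_nonneg fun i _ => hp _)
      split_ifs with h
      · have h2 : Qfun (-w) ≤ Qfun ((-(q + d * w) + ∑ i, ξ (c i)) / d) := by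
          apply Qfun_antitone
          rw [div_le_iff₀ hd0]
          linarith
        rw [Qfun_neg] at h2
        linarith
      · exact add_nonneg (Qfun_nonneg _) (Real.exp_pos _).le
    have h2 := (abs_le.1 (hlin (-(q + d * w)))).2
    simp only [mul_add (∏ i, p _), Finset.sum_add_distrib, ← Finset.sum_mul, hmass] at h1
    linarith
  · have h1 : ∑ c : Fin n → α, (∏ i, p (c i)) * Qfun ((-(q - d * w) + ∑ i, ξ (c i)) / d)
        ≤ ∑ c : Fin n → α, (∏ i, p (c i))
          * ((if ∑ i, ξ (c i) < q then (1 : ℝ) else 0) + Real.exp (-w)) := by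
      refine Finset.sum_le_sum fun c _ =>
        mul_le_mul_of_nonneg_left ?_ (Finset.prod_nonneg fun i _ => hp _)
      split_ifs with h
      · linarith [Qfun_le_one ((-(q - d * w) + ∑ i, ξ (c i)) / d), Real.exp_pos (-w)]
      · rw [zero_add]
        refine (Qfun_antitone ?_).trans hw
        rw [le_div_iff₀ hd0]
        linarith [not_lt.1 h]
    have h2 := (abs_le.1 (hlin (-(q - d * w)))).1
    simp only [mul_add (∏ i, p _), Finset.sum_add_distrib, ← Finset.sum_mul, hmass] at h1
    linarith

end Lindeberg

section RandomCoding
open scoped Classical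

variable {Ω Z A : Type*} [Fintype Ω] [Fintype Z]

/-- Probability that the correct codeword `ω` fails the acceptance test. -/
def missProb (L : Ω → Z → ℝ) (acc : Ω → A → Prop) (π : Z → A) (ω : Ω) : ℝ :=
  ∑ z, L ω z * (if acc ω (π z) then 0 else 1)

/-- Probability that the codeword `ω'` passes the acceptance test when `ω` is sent. -/
def confProb (L : Ω → Z → ℝ) (acc : Ω → A → Prop) (π : Z → A) (ω ω' : Ω) : ℝ :=
  ∑ z, L ω z * (if acc ω' (π z) then 1 else 0)

lemma exists_decoder (L : Ω → Z → ℝ) (hL : ∀ ω z, 0 ≤ L ω z) (acc : Ω → A → Prop) (π : Z → A)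
    {M : ℕ} (hM : 0 < M) (c : Fin M → Ω) :
    ∃ g : A → Fin M, ∑ j, ∑ z, (if g (π z) = j then 0 else 1 / (M : ℝ) * L (c j) z)
      ≤ 1 / (M : ℝ) * ∑ j, missProb L acc π (c j)
        + 1 / (M : ℝ) * ∑ j, ∑ k, (if k = j then 0 else confProb L acc π (c j) (c k)) := by
  have : Nonempty (Fin M) := ⟨⟨0, hM⟩⟩
  have hsel : ∀ y, ∃ k, (∃ j, acc (c j) y) → acc (c k) y := by
    intro y
    by_cases h : ∃ j, acc (c j) y
    · exact ⟨h.choose, fun _ => h.choose_spec⟩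
    · exact ⟨Classical.arbitrary _, fun h' => absurd h' h⟩
  choose g hg using hsel
  refine ⟨g, ?_⟩
  rw [← mul_add, ← Finset.sum_add_distrib, Finset.mul_sum]
  refine Finset.sum_le_sum fun j _ => ?_
  have e : missProb L acc π (c j) + ∑ k, (if k = j then 0 else confProb L acc π (c j) (c k))
      = ∑ z, L (c j) z * ((if acc (c j) (π z) then 0 else 1)
        + ∑ k, (if k = j then 0 else if acc (c k) (π z) then 1 else 0)) := by
    simp only [missProb, confProb, mul_add, Finset.sum_add_distrib, Finset.mul_sum]
    congr 1
    rw [Finset.sum_comm]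
    refine Finset.sum_congr rfl fun k _ => ?_
    split_ifs <;> simp
  rw [e, Finset.mul_sum]
  refine Finset.sum_le_sum fun z _ => ?_
  have hnn : ∀ k, (0 : ℝ) ≤ (if k = j then 0 else if acc (c k) (π z) then 1 else 0) := by
    intro k; split_ifs <;> norm_num
  have hM1 : (0 : ℝ) ≤ 1 / (M : ℝ) := by positivity
  by_cases hj : acc (c j) (π z)
  · have hacc := hg (π z) ⟨j, hj⟩
    split_ifs with hc
    · exact mul_nonneg hM1 (mul_nonneg (hL _ _)
        (add_nonneg le_rfl (Finset.sum_nonneg fun k _ => hnn k)))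
    · refine mul_le_mul_of_nonneg_left ?_ hM1
      rw [zero_add]
      refine le_mul_of_one_le_right (hL _ _) ?_
      have h := Finset.single_le_sum (fun k _ => hnn k) (mem_univ (g (π z)))
      rwa [if_neg hc, if_pos hacc] at h
  · have hle : (if g (π z) = j then 0 else 1 / (M : ℝ) * L (c j) z) ≤ 1 / (M : ℝ) * L (c j) z := by
      split_ifs
      · exact mul_nonneg hM1 (hL _ _)
      · exact le_rfl
    refine hle.trans (mul_le_mul_of_nonneg_left ?_ hM1)
    rw [if_neg hj]
    refine le_mul_of_one_le_right (hL _ _) ?_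
    linarith [Finset.sum_nonneg fun k (_ : k ∈ univ) => hnn k]

lemma sum_codebook_conf_le (p : Ω → ℝ) (hp : ∀ ω, 0 ≤ p ω) (hp1 : ∑ ω, p ω = 1)
    (L : Ω → Z → ℝ) (hL : ∀ ω z, 0 ≤ L ω z) (hL1 : ∀ ω, ∑ z, L ω z = 1)
    (acc : Ω → A → Prop) (π : Z → A) {q : ℝ} (hq0 : 0 ≤ q)
    (hq : ∀ y, ∑ ω, p ω * (if acc ω y then 1 else 0) ≤ q) {M : ℕ} (hM : 0 < M) :
    ∑ c : Fin M → Ω, (∏ i, p (c i)) *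
      (1 / (M : ℝ) * ∑ j, ∑ k, (if k = j then 0 else confProb L acc π (c j) (c k))) ≤ M * q := by
  have hMr : (0 : ℝ) < M := by exact_mod_cast hM
  have hpair : ∀ j k : Fin M, ∑ c : Fin M → Ω, (∏ i, p (c i)) *
      (if k = j then 0 else confProb L acc π (c j) (c k)) ≤ q := by
    intro j k
    split_ifs with h
    · simpa using hq0
    · rw [sum_prod_weights_marginal₂ (fun _ => p) (fun _ => hp1) (confProb L acc π)
        (Ne.symm h)]
      rw [← one_mul q, ← hp1, Finset.sum_mul]
      refine Finset.sum_le_sum fun ω _ => mul_le_mul_of_nonneg_left ?_ (hp ω)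
      simp only [confProb, Finset.mul_sum]
      rw [Finset.sum_comm]
      calc ∑ z, ∑ ω', p ω' * (L ω z * (if acc ω' (π z) then 1 else 0))
          = ∑ z, L ω z * ∑ ω', p ω' * (if acc ω' (π z) then 1 else 0) := by
            refine Finset.sum_congr rfl fun z _ => ?_
            rw [Finset.mul_sum]
            exact Finset.sum_congr rfl fun ω' _ => by ring
        _ ≤ ∑ z, L ω z * q :=
            Finset.sum_le_sum fun z _ => mul_le_mul_of_nonneg_left (hq _) (hL _ _)
        _ = q := by rw [← Finset.sum_mul, hL1, one_mul]
  calc ∑ c : Fin M → Ω, (∏ i, p (c i)) *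
        (1 / (M : ℝ) * ∑ j, ∑ k, (if k = j then 0 else confProb L acc π (c j) (c k)))
      = 1 / (M : ℝ) * ∑ j, ∑ k, ∑ c : Fin M → Ω, (∏ i, p (c i)) *
          (if k = j then 0 else confProb L acc π (c j) (c k)) := by
        simp only [Finset.mul_sum]
        rw [Finset.sum_comm]
        refine Finset.sum_congr rfl fun j _ => ?_
        rw [Finset.sum_comm]
        refine Finset.sum_congr rfl fun k _ => Finset.sum_congr rfl fun c _ => by ring
    _ ≤ 1 / (M : ℝ) * ∑ _j : Fin M, ∑ _k : Fin M, q := by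
        gcongr with j _ k _
        exact hpair j k
    _ = M * q := by
        simp only [Finset.sum_const, Finset.card_univ, Fintype.card_fin, nsmul_eq_mul]
        field_simp

lemma sum_codebook_sq_le (p : Ω → ℝ) (hp : ∀ ω, 0 ≤ p ω) (hp1 : ∑ ω, p ω = 1)
    (h : Ω → ℝ) (h0 : ∀ ω, 0 ≤ h ω) (h1 : ∀ ω, h ω ≤ 1) {M : ℕ} (hM : 0 < M) :
    ∑ c : Fin M → Ω, (∏ i, p (c i)) *
      (1 / (M : ℝ) * ∑ j, h (c j) - ∑ ω, p ω * h ω) ^ 2 ≤ 1 / (M : ℝ) := by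
  have hMr : (0 : ℝ) < M := by exact_mod_cast hM
  set μ := ∑ ω, p ω * h ω with hμ
  have hμ0 : 0 ≤ μ := Finset.sum_nonneg fun ω _ => mul_nonneg (hp ω) (h0 ω)
  have hμ1 : μ ≤ 1 := by
    rw [← hp1]
    exact Finset.sum_le_sum fun ω _ => mul_le_of_le_one_right (hp ω) (h1 ω)
  have hcent : ∑ ω, p ω * (h ω - μ) = 0 := by
    simp only [mul_sub, Finset.sum_sub_distrib, ← Finset.sum_mul, hp1]
    rw [← hμ]; ring
  have hpair : ∀ j k : Fin M, ∑ c : Fin M → Ω, (∏ i, p (c i)) * ((h (c j) - μ) * (h (c k) - μ))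
      ≤ if j = k then 1 else 0 := by
    intro j k
    split_ifs with hjk
    · subst hjk
      rw [sum_prod_weights_marginal (fun _ => p) (fun _ => hp1)
        (fun ω => (h ω - μ) * (h ω - μ)) j, ← hp1]
      refine Finset.sum_le_sum fun ω _ => mul_le_of_le_one_right (hp ω) ?_
      nlinarith [h0 ω, h1 ω]
    · rw [sum_prod_weights_marginal₂ (fun _ => p) (fun _ => hp1)
        (fun ω ω' => (h ω - μ) * (h ω' - μ)) hjk]
      have : ∀ ω, ∑ ω', p ω' * ((h ω - μ) * (h ω' - μ)) = 0 := by
        intro ω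
        rw [← mul_zero (h ω - μ), ← hcent, Finset.mul_sum]
        exact Finset.sum_congr rfl fun ω' _ => by ring
      simp [this]
  calc ∑ c : Fin M → Ω, (∏ i, p (c i)) * (1 / (M : ℝ) * ∑ j, h (c j) - μ) ^ 2
      = (1 / (M : ℝ)) ^ 2 * ∑ j, ∑ k, ∑ c : Fin M → Ω,
          (∏ i, p (c i)) * ((h (c j) - μ) * (h (c k) - μ)) := by
        have e : ∀ c : Fin M → Ω, 1 / (M : ℝ) * ∑ j, h (c j) - μ
            = 1 / (M : ℝ) * ∑ j, (h (c j) - μ) := by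
          intro c
          simp only [Finset.sum_sub_distrib, Finset.sum_const, Finset.card_univ,
            Fintype.card_fin, nsmul_eq_mul]
          field_simp
        simp only [e, mul_pow, sq (∑ j, (h (_) - μ)), Finset.sum_mul_sum]
        simp only [Finset.mul_sum]
        rw [Finset.sum_comm]
        refine Finset.sum_congr rfl fun j _ => ?_
        rw [Finset.sum_comm]
        refine Finset.sum_congr rfl fun k _ => Finset.sum_congr rfl fun c _ => by ring
    _ ≤ (1 / (M : ℝ)) ^ 2 * ∑ j : Fin M, ∑ k : Fin M, (if j = k then 1 else 0) := by
        gcongr with j _ k _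
        exact hpair j k
    _ = 1 / M := by
        simp
        field_simp

lemma exists_le_of_weighted_sum_le {Γ : Type*} [Fintype Γ] (w F : Γ → ℝ) (hw : ∀ c, 0 ≤ w c)
    (hw1 : ∑ c, w c = 1) {a : ℝ} (h : ∑ c, w c * F c ≤ a) : ∃ c, F c ≤ a := by
  by_contra! hcon
  have hlt : ∑ c, w c * a < ∑ c, w c * F c := by
    have hpos : ∃ c ∈ univ, 0 < w c := by
      by_contra! hz
      have := Finset.sum_nonpos (f := w) hz
      linarith
    obtain ⟨c, hc, hwc⟩ := hpos
    exact Finset.sum_lt_sum (fun c _ => mul_le_mul_of_nonneg_left (hcon c).le (hw c))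
      ⟨c, hc, mul_lt_mul_of_pos_left (hcon c) hwc⟩
  rw [← Finset.sum_mul, hw1, one_mul] at hlt
  linarith

/-- Random coding with two simultaneous acceptance tests: some codebook has both average error
probabilities close to the mean probability of missing the correct codeword. -/
lemma exists_codebook (p : Ω → ℝ) (hp : ∀ ω, 0 ≤ p ω) (hp1 : ∑ ω, p ω = 1)
    (L : Ω → Z → ℝ) (hL : ∀ ω z, 0 ≤ L ω z) (hL1 : ∀ ω, ∑ z, L ω z = 1)
    (acc₁ acc₂ : Ω → A → Prop) (π₁ π₂ : Z → A) {q : ℝ} (hq0 : 0 ≤ q)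
    (hq₁ : ∀ y, ∑ ω, p ω * (if acc₁ ω y then 1 else 0) ≤ q)
    (hq₂ : ∀ y, ∑ ω, p ω * (if acc₂ ω y then 1 else 0) ≤ q) {M : ℕ} (hM : 0 < M)
    {ζ : ℝ} (hζ : 2 * (M * q) + 2 / M ≤ ζ) :
    ∃ c : Fin M → Ω, ∃ g₁ g₂ : A → Fin M,
      ∑ j, ∑ z, (if g₁ (π₁ z) = j then 0 else 1 / (M : ℝ) * L (c j) z)
        ≤ ∑ ω, p ω * missProb L acc₁ π₁ ω + (Real.sqrt ζ + ζ) ∧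
      ∑ j, ∑ z, (if g₂ (π₂ z) = j then 0 else 1 / (M : ℝ) * L (c j) z)
        ≤ ∑ ω, p ω * missProb L acc₂ π₂ ω + (Real.sqrt ζ + ζ) := by
  have hmiss : ∀ (acc : Ω → A → Prop) (π : Z → A) ω,
      0 ≤ missProb L acc π ω ∧ missProb L acc π ω ≤ 1 := by
    intro acc π ω
    constructor
    · exact Finset.sum_nonneg fun z _ => mul_nonneg (hL _ _) (by split_ifs <;> norm_num)
    · rw [← hL1 ω]
      exact Finset.sum_le_sum fun z _ =>
        mul_le_of_le_one_right (hL _ _) (by split_ifs <;> norm_num)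
  let conf : (Ω → A → Prop) → (Z → A) → (Fin M → Ω) → ℝ := fun acc π c =>
    1 / (M : ℝ) * ∑ j, ∑ k, (if k = j then 0 else confProb L acc π (c j) (c k))
  let dev : (Ω → A → Prop) → (Z → A) → (Fin M → Ω) → ℝ := fun acc π c =>
    1 / (M : ℝ) * ∑ j, missProb L acc π (c j) - ∑ ω, p ω * missProb L acc π ω
  have hconf0 : ∀ acc π c, 0 ≤ conf acc π c := by
    intro acc π c
    refine mul_nonneg (by positivity) (Finset.sum_nonneg fun j _ => Finset.sum_nonneg fun k _ => ?_)
    split_ifs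
    · exact le_rfl
    · exact Finset.sum_nonneg fun z _ => mul_nonneg (hL _ _) (by split_ifs <;> norm_num)
  obtain ⟨c, hc⟩ := exists_le_of_weighted_sum_le (fun c : Fin M → Ω => ∏ i, p (c i))
    (fun c => conf acc₁ π₁ c + conf acc₂ π₂ c + (dev acc₁ π₁ c ^ 2 + dev acc₂ π₂ c ^ 2))
    (fun c => Finset.prod_nonneg fun i _ => hp _)
    (by rw [sum_prod_weights (fun _ => p)]; simp [hp1]) (a := ζ) (by
      simp only [mul_add, Finset.sum_add_distrib]
      have a1 := sum_codebook_conf_le p hp hp1 L hL hL1 acc₁ π₁ hq0 hq₁ hM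
      have a2 := sum_codebook_conf_le p hp hp1 L hL hL1 acc₂ π₂ hq0 hq₂ hM
      have b1 := sum_codebook_sq_le p hp hp1 (missProb L acc₁ π₁) (fun ω => (hmiss _ _ ω).1)
        (fun ω => (hmiss _ _ ω).2) hM
      have b2 := sum_codebook_sq_le p hp hp1 (missProb L acc₂ π₂) (fun ω => (hmiss _ _ ω).1)
        (fun ω => (hmiss _ _ ω).2) hM
      have e : 2 / (M : ℝ) = 1 / M + 1 / M := by ring
      simp only [conf, dev]
      linarith)
  obtain ⟨g₁, hg₁⟩ := exists_decoder L hL acc₁ π₁ hM c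
  obtain ⟨g₂, hg₂⟩ := exists_decoder L hL acc₂ π₂ hM c
  have c1 := hconf0 acc₁ π₁ c
  have c2 := hconf0 acc₂ π₂ c
  have s1 := sq_nonneg (dev acc₁ π₁ c)
  have s2 := sq_nonneg (dev acc₂ π₂ c)
  have d1 : dev acc₁ π₁ c ≤ Real.sqrt ζ := Real.le_sqrt_of_sq_le (by linarith)
  have d2 : dev acc₂ π₂ c ≤ Real.sqrt ζ := Real.le_sqrt_of_sq_le (by linarith)
  have hc1 : conf acc₁ π₁ c ≤ ζ := by linarith
  have hc2 : conf acc₂ π₂ c ≤ ζ := by linarith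
  simp only [conf, dev] at d1 d2 hc1 hc2
  exact ⟨c, g₁, g₂, by linarith, by linarith⟩

end RandomCoding

section TwoPhase

/-- Joint law of one channel input drawn from `P` and both channel outputs. -/
def jointLaw (W1 W2 : 𝒳 → 𝒴 → ℝ) (P : 𝒳 → ℝ) (t : 𝒳 × 𝒴 × 𝒴) : ℝ :=
  P t.1 * (W1 t.1 t.2.1 * W2 t.1 t.2.2)

/-- The likelihood ratio `W(y|x) / (PW)(y)`. -/
def likRatio (P : 𝒳 → ℝ) (W : 𝒳 → 𝒴 → ℝ) (x : 𝒳) (y : 𝒴) : ℝ := W x y / outDist P W y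

section Basic

variable {W1 W2 W : 𝒳 → 𝒴 → ℝ} {P : 𝒳 → ℝ}

lemma outDist_nonneg (hW : ∀ x y, 0 ≤ W x y) (hP : ∀ x, 0 ≤ P x) (y : 𝒴) :
    0 ≤ outDist P W y :=
  Finset.sum_nonneg fun x _ => mul_nonneg (hP x) (hW x y)

lemma outDist_pos (hW : ∀ x y, 0 ≤ W x y) (hP : ∀ x, 0 < P x) {x : 𝒳} {y : 𝒴} (h : 0 < W x y) :
    0 < outDist P W y :=
  (mul_pos (hP x) h).trans_le
    (Finset.single_le_sum (f := fun x => P x * W x y)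
      (fun x _ => mul_nonneg (hP x).le (hW x y)) (mem_univ x))

lemma likRatio_nonneg (hW : ∀ x y, 0 ≤ W x y) (hP : ∀ x, 0 ≤ P x) (x : 𝒳) (y : 𝒴) :
    0 ≤ likRatio P W x y :=
  div_nonneg (hW x y) (outDist_nonneg hW hP y)

lemma sum_mul_likRatio_le_one (y : 𝒴) : ∑ x, P x * likRatio P W x y ≤ 1 := by
  have : ∑ x, P x * likRatio P W x y = outDist P W y / outDist P W y := by
    simp only [likRatio, ← mul_div_assoc, ← Finset.sum_div]
    rfl
  rw [this]
  exact div_self_le_one _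

lemma jointLaw_nonneg (hW1 : ∀ x y, 0 ≤ W1 x y) (hW2 : ∀ x y, 0 ≤ W2 x y)
    (hP : ∀ x, 0 ≤ P x) (t : 𝒳 × 𝒴 × 𝒴) : 0 ≤ jointLaw W1 W2 P t :=
  mul_nonneg (hP _) (mul_nonneg (hW1 _ _) (hW2 _ _))

lemma sum_jointLaw_mul (f : 𝒳 × 𝒴 × 𝒴 → ℝ) :
    ∑ t, jointLaw W1 W2 P t * f t
      = ∑ x, P x * ∑ y : 𝒴 × 𝒴, W1 x y.1 * W2 x y.2 * f (x, y) := by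
  rw [Fintype.sum_prod_type]
  refine Finset.sum_congr rfl fun x _ => ?_
  rw [Finset.mul_sum]
  refine Finset.sum_congr rfl fun y _ => ?_
  simp only [jointLaw]; ring

lemma sum_fst_marginal (hs : ∀ x, ∑ y, W2 x y = 1) (x : 𝒳) (g : 𝒴 → ℝ) :
    ∑ y : 𝒴 × 𝒴, W1 x y.1 * W2 x y.2 * g y.1 = ∑ y, W1 x y * g y := by
  rw [Fintype.sum_prod_type]
  refine Finset.sum_congr rfl fun y _ => ?_
  simp only
  rw [← Finset.sum_mul, ← Finset.mul_sum, hs, mul_one]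

lemma sum_snd_marginal (hs : ∀ x, ∑ y, W1 x y = 1) (x : 𝒳) (g : 𝒴 → ℝ) :
    ∑ y : 𝒴 × 𝒴, W1 x y.1 * W2 x y.2 * g y.2 = ∑ y, W2 x y * g y := by
  rw [Fintype.sum_prod_type, Finset.sum_comm]
  refine Finset.sum_congr rfl fun y _ => ?_
  simp only
  rw [← Finset.sum_mul, ← Finset.sum_mul, hs, one_mul]

lemma sum_jointLaw (h1 : ∀ x, ∑ y, W1 x y = 1) (h2 : ∀ x, ∑ y, W2 x y = 1) (hP : ∑ x, P x = 1) :
    ∑ t, jointLaw W1 W2 P t = 1 := by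
  have := sum_jointLaw_mul (W1 := W1) (W2 := W2) (P := P) fun _ => 1
  simp only [mul_one] at this
  rw [this, ← hP]
  refine Finset.sum_congr rfl fun x _ => ?_
  have h := sum_fst_marginal (W1 := W1) h2 x fun _ => 1
  simp only [mul_one] at h
  rw [h, h1, mul_one]

end Basic

variable {S : Type*} [Fintype S] [DecidableEq S] {n m : ℕ}

/-- Law of a random codeword: a first block, and for every mode a second block. -/
def wordWeight (P : 𝒳 → ℝ) (Q : S → 𝒳 → ℝ) (ω : (Fin n → 𝒳) × (S → Fin m → 𝒳)) : ℝ :=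
  (∏ i, P (ω.1 i)) * ∏ s, ∏ i, Q s (ω.2 s i)

/-- Send the first block, then the second block of the mode selected from the feedback. -/
def modeEncoder (σ : (Fin n → 𝒳 × 𝒴 × 𝒴) → S) (ω : (Fin n → 𝒳) × (S → Fin m → 𝒳))
    (y1 y2 : Fin (n + m) → 𝒴) : Fin (n + m) → 𝒳 :=
  Fin.append ω.1 (ω.2 (σ fun i => (ω.1 i, y1 (Fin.castAdd m i), y2 (Fin.castAdd m i))))

/-- Law of the channel outputs given the codeword. -/
def modeLaw (W1 W2 : 𝒳 → 𝒴 → ℝ) (σ : (Fin n → 𝒳 × 𝒴 × 𝒴) → S)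
    (ω : (Fin n → 𝒳) × (S → Fin m → 𝒳)) (z : (Fin (n + m) → 𝒴) × (Fin (n + m) → 𝒴)) : ℝ :=
  ∏ i, (W1 (modeEncoder σ ω z.1 z.2 i) (z.1 i) * W2 (modeEncoder σ ω z.1 z.2 i) (z.2 i))

/-- Threshold test on the likelihood ratio, over all modes. -/
def modeAccept (P : 𝒳 → ℝ) (Q : S → 𝒳 → ℝ) (W : 𝒳 → 𝒴 → ℝ) (γ : ℝ)
    (ω : (Fin n → 𝒳) × (S → Fin m → 𝒳)) (y : Fin (n + m) → 𝒴) : Prop :=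
  ∃ s, Real.exp γ ≤ (∏ i, likRatio P W (ω.1 i) (y (Fin.castAdd m i)))
    * ∏ i, likRatio (Q s) W (ω.2 s i) (y (Fin.natAdd n i))

lemma causal_modeEncoder {M : ℕ} (σ : (Fin n → 𝒳 × 𝒴 × 𝒴) → S)
    (c : Fin M → (Fin n → 𝒳) × (S → Fin m → 𝒳)) :
    Causal (n + m) M fun j => modeEncoder σ (c j) := by
  intro j y1 y1' y2 y2' i h1 h2
  refine Fin.addCases (fun i _ _ => ?_) (fun i h1 h2 => ?_) i h1 h2
  · simp [modeEncoder]
  · have hlt : ∀ k : Fin n, Fin.castAdd m k < Fin.natAdd n i := fun k => by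
      rw [Fin.lt_def]; simp; omega
    simp only [modeEncoder, Fin.append_right, h1 _ (hlt _), h2 _ (hlt _)]

lemma sum_modeLaw_mul (W1 W2 : 𝒳 → 𝒴 → ℝ) (σ : (Fin n → 𝒳 × 𝒴 × 𝒴) → S)
    (ω : (Fin n → 𝒳) × (S → Fin m → 𝒳))
    (H : (Fin (n + m) → 𝒴) × (Fin (n + m) → 𝒴) → ℝ) :
    ∑ z, modeLaw W1 W2 σ ω z * H z
      = ∑ a : Fin n → 𝒴 × 𝒴, (∏ i, (W1 (ω.1 i) (a i).1 * W2 (ω.1 i) (a i).2)) *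
          ∑ b : Fin m → 𝒴 × 𝒴,
            (∏ i, (W1 (ω.2 (σ fun i => (ω.1 i, a i)) i) (b i).1
              * W2 (ω.2 (σ fun i => (ω.1 i, a i)) i) (b i).2)) *
            H (fun i => (Fin.append a b i).1, fun i => (Fin.append a b i).2) := by
  let e : (Fin n → 𝒴 × 𝒴) × (Fin m → 𝒴 × 𝒴) ≃ (Fin (n + m) → 𝒴) × (Fin (n + m) → 𝒴) :=
    (Fin.appendEquiv n m).trans (Equiv.arrowProdEquivProdArrow _ _ _)
  rw [← e.sum_comp, Fintype.sum_prod_type]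
  refine Finset.sum_congr rfl fun a _ => ?_
  rw [Finset.mul_sum]
  refine Finset.sum_congr rfl fun b _ => ?_
  have he : e (a, b) = (fun i => (Fin.append a b i).1, fun i => (Fin.append a b i).2) := rfl
  rw [he, ← mul_assoc]
  congr 1
  simp only [modeLaw, Fin.prod_univ_add, modeEncoder, Fin.append_left, Fin.append_right,
    Prod.mk.eta]

lemma modeLaw_nonneg {W1 W2 : 𝒳 → 𝒴 → ℝ} (hW1 : ∀ x y, 0 ≤ W1 x y) (hW2 : ∀ x y, 0 ≤ W2 x y)
    (σ : (Fin n → 𝒳 × 𝒴 × 𝒴) → S) (ω : (Fin n → 𝒳) × (S → Fin m → 𝒳)) (z) :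
    0 ≤ modeLaw W1 W2 σ ω z :=
  Finset.prod_nonneg fun _ _ => mul_nonneg (hW1 _ _) (hW2 _ _)

lemma sum_modeLaw {W1 W2 : 𝒳 → 𝒴 → ℝ} (h1 : ∀ x, ∑ y, W1 x y = 1) (h2 : ∀ x, ∑ y, W2 x y = 1)
    (σ : (Fin n → 𝒳 × 𝒴 × 𝒴) → S) (ω : (Fin n → 𝒳) × (S → Fin m → 𝒳)) :
    ∑ z, modeLaw W1 W2 σ ω z = 1 := by
  have h : ∀ x, ∑ y : 𝒴 × 𝒴, W1 x y.1 * W2 x y.2 = 1 := fun x => by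
    have := sum_fst_marginal (W1 := W1) h2 x fun _ => 1
    simpa [h1] using this
  have key := sum_modeLaw_mul W1 W2 σ ω fun _ => 1
  simp only [mul_one] at key
  rw [key]
  have hk : ∀ (k : ℕ) (x : Fin k → 𝒳),
      ∑ a : Fin k → 𝒴 × 𝒴, ∏ i, (W1 (x i) (a i).1 * W2 (x i) (a i).2) = 1 := by
    intro k x
    rw [sum_prod_weights fun i (y : 𝒴 × 𝒴) => W1 (x i) y.1 * W2 (x i) y.2]
    simp [h]
  simp only [hk, mul_one]

lemma wordWeight_nonneg {P : 𝒳 → ℝ} {Q : S → 𝒳 → ℝ} (hP : ∀ x, 0 ≤ P x)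
    (hQ : ∀ s x, 0 ≤ Q s x) (ω : (Fin n → 𝒳) × (S → Fin m → 𝒳)) : 0 ≤ wordWeight P Q ω :=
  mul_nonneg (Finset.prod_nonneg fun _ _ => hP _)
    (Finset.prod_nonneg fun _ _ => Finset.prod_nonneg fun _ _ => hQ _ _)

lemma sum_iid_eq_one {α : Type*} [Fintype α] {p : α → ℝ} (hp : ∑ a, p a = 1) (k : ℕ) :
    ∑ c : Fin k → α, ∏ i, p (c i) = 1 := by
  rw [sum_prod_weights fun _ => p]
  simp [hp]

lemma sum_wordWeight_mul (P : 𝒳 → ℝ) (Q : S → 𝒳 → ℝ)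
    (F : (Fin n → 𝒳) × (S → Fin m → 𝒳) → ℝ) :
    ∑ ω, wordWeight P Q ω * F ω = ∑ x : Fin n → 𝒳, (∏ i, P (x i)) *
      ∑ w : S → Fin m → 𝒳, (∏ s, ∏ i, Q s (w s i)) * F (x, w) := by
  rw [Fintype.sum_prod_type]
  refine Finset.sum_congr rfl fun x _ => ?_
  rw [Finset.mul_sum]
  exact Finset.sum_congr rfl fun w _ => by simp only [wordWeight]; ring

lemma sum_wordWeight {P : 𝒳 → ℝ} {Q : S → 𝒳 → ℝ} (hP : ∑ x, P x = 1)
    (hQ : ∀ s, ∑ x, Q s x = 1) :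
    ∑ ω : (Fin n → 𝒳) × (S → Fin m → 𝒳), wordWeight P Q ω = 1 := by
  have h := sum_wordWeight_mul (n := n) (m := m) P Q fun _ => 1
  simp only [mul_one] at h
  rw [h, sum_prod_weights fun s (c : Fin m → 𝒳) => ∏ i, Q s (c i)]
  simp [sum_iid_eq_one hP, sum_iid_eq_one (hQ _)]

open scoped Classical in
lemma sum_wordWeight_accept_le {P : 𝒳 → ℝ} {Q : S → 𝒳 → ℝ} {W : 𝒳 → 𝒴 → ℝ}
    (hW : ∀ x y, 0 ≤ W x y) (hP : ∀ x, 0 ≤ P x) (hQ : ∀ s x, 0 ≤ Q s x)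
    (hQ1 : ∀ s, ∑ x, Q s x = 1) (γ : ℝ) (y : Fin (n + m) → 𝒴) :
    ∑ ω : (Fin n → 𝒳) × (S → Fin m → 𝒳),
        wordWeight P Q ω * (if modeAccept P Q W γ ω y then 1 else 0)
      ≤ Fintype.card S * Real.exp (-γ) := by
  let R : S → (Fin n → 𝒳) × (S → Fin m → 𝒳) → ℝ := fun s ω =>
    (∏ i, likRatio P W (ω.1 i) (y (Fin.castAdd m i)))
      * ∏ i, likRatio (Q s) W (ω.2 s i) (y (Fin.natAdd n i))
  have hR : ∀ s ω, 0 ≤ R s ω := fun s ω => mul_nonneg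
    (Finset.prod_nonneg fun _ _ => likRatio_nonneg hW hP _ _)
    (Finset.prod_nonneg fun _ _ => likRatio_nonneg hW (hQ s) _ _)
  have hblock : ∀ {P' : 𝒳 → ℝ}, (∀ x, 0 ≤ P' x) → ∀ (k : ℕ) (b : Fin k → 𝒴),
      0 ≤ ∑ x : Fin k → 𝒳, (∏ i, P' (x i)) * ∏ i, likRatio P' W (x i) (b i) ∧
      ∑ x : Fin k → 𝒳, (∏ i, P' (x i)) * ∏ i, likRatio P' W (x i) (b i) ≤ 1 := by
    intro P' hP' k b
    simp only [← Finset.prod_mul_distrib]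
    rw [sum_prod_weights fun i x => P' x * likRatio P' W x (b i)]
    have h0 : ∀ i, 0 ≤ ∑ x, P' x * likRatio P' W x (b i) := fun i =>
      Finset.sum_nonneg fun x _ => mul_nonneg (hP' x) (likRatio_nonneg hW hP' _ _)
    exact ⟨Finset.prod_nonneg fun i _ => h0 i,
      Finset.prod_le_one (fun i _ => h0 i) fun i _ => sum_mul_likRatio_le_one _⟩
  have hmean : ∀ s, ∑ ω, wordWeight P Q ω * R s ω ≤ 1 := by
    intro s
    rw [sum_wordWeight_mul]
    have h2 := hblock (hQ s) m fun i => y (Fin.natAdd n i)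
    have h1 := hblock hP n fun i => y (Fin.castAdd m i)
    have hw : ∀ x : Fin n → 𝒳, ∑ w : S → Fin m → 𝒳, (∏ s, ∏ i, Q s (w s i)) * R s (x, w)
        = (∏ i, likRatio P W (x i) (y (Fin.castAdd m i))) *
          ∑ c : Fin m → 𝒳, (∏ i, Q s (c i)) * ∏ i, likRatio (Q s) W (c i) (y (Fin.natAdd n i)) := by
      intro x
      rw [← sum_prod_weights_marginal (fun s (c : Fin m → 𝒳) => ∏ i, Q s (c i))
        (fun s => sum_iid_eq_one (hQ1 s) m)
        (fun c => ∏ i, likRatio (Q s) W (c i) (y (Fin.natAdd n i))) s, Finset.mul_sum]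
      exact Finset.sum_congr rfl fun w _ => by simp only [R]; ring
    simp only [hw, ← mul_assoc, ← Finset.sum_mul]
    exact mul_le_one₀ h1.2 h2.1 h2.2
  calc _ ≤ ∑ ω, wordWeight P Q ω * ∑ s, Real.exp (-γ) * R s ω := by
        refine Finset.sum_le_sum fun ω _ =>
          mul_le_mul_of_nonneg_left ?_ (wordWeight_nonneg hP hQ ω)
        have hnn : ∀ s ∈ univ, 0 ≤ Real.exp (-γ) * R s ω := fun s _ =>
          mul_nonneg (Real.exp_pos _).le (hR s ω)
        split_ifs with h
        · obtain ⟨s, hs⟩ := h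
          refine le_trans ?_ (Finset.single_le_sum hnn (mem_univ s))
          calc (1 : ℝ) = Real.exp (-γ) * Real.exp γ := by rw [← Real.exp_add]; simp
            _ ≤ _ := mul_le_mul_of_nonneg_left hs (Real.exp_pos _).le
        · exact Finset.sum_nonneg hnn
    _ = ∑ s, Real.exp (-γ) * ∑ ω, wordWeight P Q ω * R s ω := by
        simp only [Finset.mul_sum]
        rw [Finset.sum_comm]
        exact Finset.sum_congr rfl fun s _ => Finset.sum_congr rfl fun ω _ => by ring
    _ ≤ ∑ _s : S, Real.exp (-γ) * 1 :=
        Finset.sum_le_sum fun s _ => mul_le_mul_of_nonneg_left (hmean s) (Real.exp_pos _).le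
    _ = _ := by simp

open scoped Classical in
lemma sum_missProb_le {W1 W2 W : 𝒳 → 𝒴 → ℝ} (hW1 : ∀ x y, 0 ≤ W1 x y) (hW2 : ∀ x y, 0 ≤ W2 x y)
    {P : 𝒳 → ℝ} {Q : S → 𝒳 → ℝ} (hP : ∀ x, 0 ≤ P x) (hQ : ∀ s x, 0 ≤ Q s x)
    (hQ1 : ∀ s, ∑ x, Q s x = 1) (sel : 𝒴 × 𝒴 → 𝒴) (σ : (Fin n → 𝒳 × 𝒴 × 𝒴) → S) (γ : ℝ) :
    ∑ ω : (Fin n → 𝒳) × (S → Fin m → 𝒳), wordWeight P Q ω *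
        missProb (modeLaw W1 W2 σ) (modeAccept P Q W γ)
          (fun z i => sel (z.1 i, z.2 i)) ω
      ≤ ∑ c : Fin n → 𝒳 × 𝒴 × 𝒴, (∏ i, jointLaw W1 W2 P (c i)) *
          ∑ e : Fin m → 𝒳 × 𝒴 × 𝒴, (∏ i, jointLaw W1 W2 (Q (σ c)) (e i)) *
            (if (∏ i, likRatio P W (c i).1 (sel (c i).2))
              * ∏ i, likRatio (Q (σ c)) W (e i).1 (sel (e i).2) < Real.exp γ then 1 else 0) := by
  let B : (Fin m → 𝒳) → (Fin m → 𝒴 × 𝒴) → ℝ := fun x b =>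
    ∏ i, (W1 (x i) (b i).1 * W2 (x i) (b i).2)
  let A : (Fin n → 𝒳) → (Fin n → 𝒴 × 𝒴) → ℝ := fun x b =>
    ∏ i, (W1 (x i) (b i).1 * W2 (x i) (b i).2)
  let G : (Fin n → 𝒳) → (Fin n → 𝒴 × 𝒴) → (Fin m → 𝒳) → ℝ := fun x a u =>
    ∑ b, B u b * (if (∏ i, likRatio P W (x i) (sel (a i)))
      * ∏ i, likRatio (Q (σ fun i => (x i, a i))) W (u i) (sel (b i)) < Real.exp γ then 1 else 0)
  have hA : ∀ x a, 0 ≤ A x a := fun x a =>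
    Finset.prod_nonneg fun _ _ => mul_nonneg (hW1 _ _) (hW2 _ _)
  have hB : ∀ x a, 0 ≤ B x a := fun x a =>
    Finset.prod_nonneg fun _ _ => mul_nonneg (hW1 _ _) (hW2 _ _)
  calc _ ≤ ∑ ω : (Fin n → 𝒳) × (S → Fin m → 𝒳), wordWeight P Q ω *
        ∑ a, A ω.1 a * G ω.1 a (ω.2 (σ fun i => (ω.1 i, a i))) := by
        refine Finset.sum_le_sum fun ω _ =>
          mul_le_mul_of_nonneg_left ?_ (wordWeight_nonneg hP hQ ω)
        rw [missProb, sum_modeLaw_mul]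
        refine Finset.sum_le_sum fun a _ => mul_le_mul_of_nonneg_left ?_ (hA _ _)
        refine Finset.sum_le_sum fun b _ => mul_le_mul_of_nonneg_left ?_ (hB _ _)
        by_cases hacc : modeAccept P Q W γ ω
            (fun i => sel ((Fin.append a b i).1, (Fin.append a b i).2))
        · rw [if_pos hacc]
          split_ifs <;> norm_num
        · rw [if_neg hacc, if_pos]
          by_contra hcon
          refine hacc ⟨σ fun i => (ω.1 i, a i), ?_⟩
          simpa using hcon
    _ = ∑ x : Fin n → 𝒳, (∏ i, P (x i)) * ∑ a, A x a *
          ∑ u : Fin m → 𝒳, (∏ i, Q (σ fun i => (x i, a i)) (u i)) * G x a u := by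
        rw [sum_wordWeight_mul]
        refine Finset.sum_congr rfl fun x _ => ?_
        congr 1
        simp only [Finset.mul_sum]
        rw [Finset.sum_comm]
        refine Finset.sum_congr rfl fun a _ => ?_
        have h := sum_prod_weights_marginal (fun s (c : Fin m → 𝒳) => ∏ i, Q s (c i))
          (fun s => sum_iid_eq_one (hQ1 s) m) (G x a) (σ fun i => (x i, a i))
        rw [← Finset.mul_sum, ← h, Finset.mul_sum]
        exact Finset.sum_congr rfl fun w _ => by ring
    _ = _ := by
        rw [← (Equiv.arrowProdEquivProdArrow (Fin n) (fun _ => 𝒳) (fun _ => 𝒴 × 𝒴)).symm.sum_comp,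
          Fintype.sum_prod_type]
        refine Finset.sum_congr rfl fun x _ => ?_
        rw [Finset.mul_sum]
        refine Finset.sum_congr rfl fun a _ => ?_
        rw [← (Equiv.arrowProdEquivProdArrow (Fin m) (fun _ => 𝒳) (fun _ => 𝒴 × 𝒴)).symm.sum_comp,
          Fintype.sum_prod_type]
        simp only [Equiv.arrowProdEquivProdArrow, Equiv.coe_fn_symm_mk, jointLaw,
          Finset.prod_mul_distrib]
        rw [← mul_assoc]
        congr 1
        · exact congrArg _ Finset.prod_mul_distrib
        refine Finset.sum_congr rfl fun u _ => ?_
        simp only [G, Finset.mul_sum]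
        refine Finset.sum_congr rfl fun b _ => ?_
        simp only [B, Finset.prod_mul_distrib]
        simp only [← mul_assoc]
        rfl

end TwoPhase

section TwoPhaseCode

variable {S : Type*} [Fintype S] [DecidableEq S] {n m : ℕ}

lemma prod_likRatio_eq_exp {W1 W2 W : 𝒳 → 𝒴 → ℝ} (hW : ∀ x y, 0 ≤ W x y) {P : 𝒳 → ℝ}
    (hP : ∀ x, 0 < P x) {sel : 𝒴 × 𝒴 → 𝒴}
    (hsel : ∀ x y, W1 x y.1 * W2 x y.2 ≠ 0 → 0 < W x (sel y)) {k : ℕ} {c : Fin k → 𝒳 × 𝒴 × 𝒴}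
    (hc : ∏ i, jointLaw W1 W2 P (c i) ≠ 0) :
    ∏ i, likRatio P W (c i).1 (sel (c i).2)
      = Real.exp (∑ i, infoDens P W (c i).1 (sel (c i).2)) := by
  rw [Real.exp_sum]
  refine Finset.prod_congr rfl fun i _ => ?_
  have hi : jointLaw W1 W2 P (c i) ≠ 0 := (Finset.prod_ne_zero_iff.1 hc) i (mem_univ i)
  have hpos := hsel _ _ (right_ne_zero_of_mul hi)
  rw [infoDens, Real.exp_log (div_pos hpos (outDist_pos hW hP hpos))]
  rfl

lemma sum_jointLaw_infoDens {W1 W2 W : 𝒳 → 𝒴 → ℝ} {sel : 𝒴 × 𝒴 → 𝒴}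
    (hmarg : ∀ x (g : 𝒴 → ℝ), ∑ y : 𝒴 × 𝒴, W1 x y.1 * W2 x y.2 * g (sel y) = ∑ y, W x y * g y)
    (P : 𝒳 → ℝ) :
    ∑ t, jointLaw W1 W2 P t * infoDens P W t.1 (sel t.2) = mutInfo P W := by
  rw [sum_jointLaw_mul fun t => infoDens P W t.1 (sel t.2)]
  refine Finset.sum_congr rfl fun x _ => ?_
  simp only [hmarg]
  rw [Finset.mul_sum]
  exact Finset.sum_congr rfl fun y _ => by simp only [infoDens]; ring

open scoped Classical in
lemma sum_missProb_le_bad {W1 W2 W : 𝒳 → 𝒴 → ℝ} (hW1 : ∀ x y, 0 ≤ W1 x y)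
    (hW2 : ∀ x y, 0 ≤ W2 x y) (hW : ∀ x y, 0 ≤ W x y)
    (hs1 : ∀ x, ∑ y, W1 x y = 1) (hs2 : ∀ x, ∑ y, W2 x y = 1)
    {P : 𝒳 → ℝ} {Q : S → 𝒳 → ℝ} (hP : ∀ x, 0 < P x) (hQ : ∀ s x, 0 < Q s x)
    (hP1 : ∑ x, P x = 1) (hQ1 : ∀ s, ∑ x, Q s x = 1) {sel : 𝒴 × 𝒴 → 𝒴}
    (hsel : ∀ x y, W1 x y.1 * W2 x y.2 ≠ 0 → 0 < W x (sel y))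
    (hmarg : ∀ x (g : 𝒴 → ℝ), ∑ y : 𝒴 × 𝒴, W1 x y.1 * W2 x y.2 * g (sel y) = ∑ y, W x y * g y)
    (σ : (Fin n → 𝒳 × 𝒴 × 𝒴) → S) (γ : ℝ) (bad : (Fin n → 𝒳 × 𝒴 × 𝒴) → Prop) {a B l : ℝ}
    (hgood : ∀ c, ¬ bad c → γ ≤ ∑ i, infoDens P W (c i).1 (sel (c i).2)
      + m * mutInfo (Q (σ c)) W - a)
    (hB : ∀ s x y, |mutInfo (Q s) W - infoDens (Q s) W x y| ≤ B) (hl : 0 ≤ l) (hlB : l * B ≤ 1) :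
    ∑ ω : (Fin n → 𝒳) × (S → Fin m → 𝒳), wordWeight P Q ω *
        missProb (modeLaw W1 W2 σ) (modeAccept P Q W γ)
          (fun z i => sel (z.1 i, z.2 i)) ω
      ≤ ∑ c : Fin n → 𝒳 × 𝒴 × 𝒴, (∏ i, jointLaw W1 W2 P (c i)) * (if bad c then 1 else 0)
        + Real.exp (-(l * a) + m * (l * B) ^ 2) := by
  refine (sum_missProb_le hW1 hW2 (fun x => (hP x).le) (fun s x => (hQ s x).le) hQ1 sel σ γ).trans ?_
  set δ := Real.exp (-(l * a) + m * (l * B) ^ 2) with hδ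
  have hnn : ∀ c : Fin n → 𝒳 × 𝒴 × 𝒴, 0 ≤ ∏ i, jointLaw W1 W2 P (c i) := fun c =>
    Finset.prod_nonneg fun _ _ => jointLaw_nonneg hW1 hW2 (fun x => (hP x).le) _
  have hnn2 : ∀ s (c : Fin m → 𝒳 × 𝒴 × 𝒴), 0 ≤ ∏ i, jointLaw W1 W2 (Q s) (c i) := fun s c =>
    Finset.prod_nonneg fun _ _ => jointLaw_nonneg hW1 hW2 (fun x => (hQ s x).le) _
  have hone : ∑ c : Fin n → 𝒳 × 𝒴 × 𝒴, ∏ i, jointLaw W1 W2 P (c i) = 1 :=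
    sum_iid_eq_one (sum_jointLaw hs1 hs2 hP1) n
  have hone2 : ∀ s, ∑ c : Fin m → 𝒳 × 𝒴 × 𝒴, ∏ i, jointLaw W1 W2 (Q s) (c i) = 1 := fun s =>
    sum_iid_eq_one (sum_jointLaw hs1 hs2 (hQ1 s)) m
  have e : ∑ c : Fin n → 𝒳 × 𝒴 × 𝒴, (∏ i, jointLaw W1 W2 P (c i)) * (if bad c then 1 else 0) + δ
      = ∑ c : Fin n → 𝒳 × 𝒴 × 𝒴, (∏ i, jointLaw W1 W2 P (c i))
        * ((if bad c then 1 else 0) + δ) := by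
    simp only [mul_add, Finset.sum_add_distrib, ← Finset.sum_mul, hone, one_mul]
  rw [e]
  refine Finset.sum_le_sum fun c _ => ?_
  by_cases hc : ∏ i, jointLaw W1 W2 P (c i) = 0
  · rw [hc, zero_mul, zero_mul]
  refine mul_le_mul_of_nonneg_left ?_ (hnn c)
  by_cases hb : bad c
  · rw [if_pos hb]
    calc _ ≤ ∑ e : Fin m → 𝒳 × 𝒴 × 𝒴, (∏ i, jointLaw W1 W2 (Q (σ c)) (e i)) := by
          refine Finset.sum_le_sum fun e _ => mul_le_of_le_one_right (hnn2 _ e) ?_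
          split_ifs <;> norm_num
      _ ≤ _ := by
          rw [hone2]
          linarith [Real.exp_pos (-(l * a) + m * (l * B) ^ 2)]
  · rw [if_neg hb, zero_add]
    have hmean : ∑ t, jointLaw W1 W2 (Q (σ c)) t *
        (mutInfo (Q (σ c)) W - infoDens (Q (σ c)) W t.1 (sel t.2)) = 0 := by
      simp only [mul_sub, Finset.sum_sub_distrib, ← Finset.sum_mul,
        sum_jointLaw hs1 hs2 (hQ1 (σ c)), sum_jointLaw_infoDens hmarg]
      ring
    have hch := chernoff_iid (ι := Fin m) (jointLaw W1 W2 (Q (σ c)))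
      (fun t => mutInfo (Q (σ c)) W - infoDens (Q (σ c)) W t.1 (sel t.2))
      (jointLaw_nonneg hW1 hW2 fun x => (hQ _ x).le) (sum_jointLaw hs1 hs2 (hQ1 _)) hmean
      (fun t => hB _ _ _) hl hlB a
    rw [Fintype.card_fin] at hch
    refine le_trans (Finset.sum_le_sum fun e _ => ?_) hch
    by_cases he : ∏ i, jointLaw W1 W2 (Q (σ c)) (e i) = 0
    · rw [he, zero_mul, zero_mul]
    refine mul_le_mul_of_nonneg_left ?_ (hnn2 _ e)
    split_ifs with h1 h2
    · exact le_rfl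
    · refine absurd ?_ h2
      rw [prod_likRatio_eq_exp hW hP hsel hc, prod_likRatio_eq_exp hW (hQ _) hsel he,
        ← Real.exp_add, Real.exp_lt_exp] at h1
      simp only [Finset.sum_sub_distrib, Finset.sum_const, Finset.card_univ, Fintype.card_fin,
        nsmul_eq_mul]
      linarith [hgood c hb]
    · norm_num
    · exact le_rfl

open scoped Classical in
/-- Existence of two-phase feedback codes: after `n` channel uses the encoder picks one of finitely
many input laws for the last `m` uses, and decoder `k` fails only if `bad k` occurs in the first
phase or the information density of the second phase deviates from its mean. -/
lemma flfExists_of_two_phase {W1 W2 : 𝒳 → 𝒴 → ℝ} (hW1 : ∀ x y, 0 ≤ W1 x y)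
    (hW2 : ∀ x y, 0 ≤ W2 x y) (hs1 : ∀ x, ∑ y, W1 x y = 1) (hs2 : ∀ x, ∑ y, W2 x y = 1)
    {P : 𝒳 → ℝ} {Q : S → 𝒳 → ℝ} (hP : ∀ x, 0 < P x) (hQ : ∀ s x, 0 < Q s x)
    (hP1 : ∑ x, P x = 1) (hQ1 : ∀ s, ∑ x, Q s x = 1)
    (σ : (Fin n → 𝒳 × 𝒴 × 𝒴) → S) {γ : ℝ} {bad1 bad2 : (Fin n → 𝒳 × 𝒴 × 𝒴) → Prop} {a B l : ℝ}
    (hgood1 : ∀ c, ¬ bad1 c → γ ≤ ∑ i, infoDens P W1 (c i).1 (c i).2.1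
      + m * mutInfo (Q (σ c)) W1 - a)
    (hgood2 : ∀ c, ¬ bad2 c → γ ≤ ∑ i, infoDens P W2 (c i).1 (c i).2.2
      + m * mutInfo (Q (σ c)) W2 - a)
    (hB1 : ∀ s x y, |mutInfo (Q s) W1 - infoDens (Q s) W1 x y| ≤ B)
    (hB2 : ∀ s x y, |mutInfo (Q s) W2 - infoDens (Q s) W2 x y| ≤ B)
    (hl : 0 ≤ l) (hlB : l * B ≤ 1) {M : ℕ} (hM : 0 < M) {ζ ε : ℝ}
    (hζ : 2 * (M * (Fintype.card S * Real.exp (-γ))) + 2 / M ≤ ζ)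
    (hε1 : ∑ c : Fin n → 𝒳 × 𝒴 × 𝒴, (∏ i, jointLaw W1 W2 P (c i)) * (if bad1 c then 1 else 0)
      + Real.exp (-(l * a) + m * (l * B) ^ 2) + (Real.sqrt ζ + ζ) ≤ ε)
    (hε2 : ∑ c : Fin n → 𝒳 × 𝒴 × 𝒴, (∏ i, jointLaw W1 W2 P (c i)) * (if bad2 c then 1 else 0)
      + Real.exp (-(l * a) + m * (l * B) ^ 2) + (Real.sqrt ζ + ζ) ≤ ε) :
    FLFExists W1 W2 (n + m) M ε := by
  have m1 := sum_missProb_le_bad (W := W1) (sel := Prod.fst) hW1 hW2 hW1 hs1 hs2 hP hQ hP1 hQ1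
    (fun x y h => (hW1 x y.1).lt_of_ne' (left_ne_zero_of_mul h)) (sum_fst_marginal hs2) σ γ bad1
    hgood1 hB1 hl hlB
  have m2 := sum_missProb_le_bad (W := W2) (sel := Prod.snd) hW1 hW2 hW2 hs1 hs2 hP hQ hP1 hQ1
    (fun x y h => (hW2 x y.2).lt_of_ne' (right_ne_zero_of_mul h)) (sum_snd_marginal hs1) σ γ bad2
    hgood2 hB2 hl hlB
  obtain ⟨c, g1, g2, h1, h2⟩ := exists_codebook (A := Fin (n + m) → 𝒴) (wordWeight P Q)
    (wordWeight_nonneg (fun x => (hP x).le) fun s x => (hQ s x).le) (sum_wordWeight hP1 hQ1)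
    (modeLaw W1 W2 σ) (modeLaw_nonneg hW1 hW2 σ) (sum_modeLaw hs1 hs2 σ)
    (modeAccept P Q W1 γ) (modeAccept P Q W2 γ) Prod.fst Prod.snd
    (q := Fintype.card S * Real.exp (-γ)) (by positivity)
    (sum_wordWeight_accept_le hW1 (fun x => (hP x).le) (fun s x => (hQ s x).le) hQ1 γ)
    (sum_wordWeight_accept_le hW2 (fun x => (hP x).le) (fun s x => (hQ s x).le) hQ1 γ) hM hζ
  refine ⟨fun j => modeEncoder σ (c j), causal_modeEncoder σ c, g1, g2, ?_, ?_⟩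
  · refine le_trans (le_of_eq ?_) (h1.trans ((add_le_add_left m1 _).trans hε1))
    refine Finset.sum_congr rfl fun j _ => ?_
    rw [Fintype.sum_prod_type]
    rfl
  · refine le_trans (le_of_eq ?_) (h2.trans ((add_le_add_left m2 _).trans hε2))
    refine Finset.sum_congr rfl fun j _ => ?_
    rw [Fintype.sum_prod_type]
    rfl

end TwoPhaseCode

section Converse

variable [Nonempty 𝒴]

lemma sum_causal_prod {Y : Type*} [Fintype Y] [Nonempty Y] {K : 𝒳 → Y → ℝ}
    (hK : ∀ x, ∑ y, K x y = 1) :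
    ∀ {n : ℕ} (φ : (Fin n → Y) → Fin n → 𝒳),
      (∀ y y' i, (∀ t, t < i → y t = y' t) → φ y i = φ y' i) →
      ∑ y : Fin n → Y, ∏ i, K (φ y i) (y i) = 1
  | 0, φ, _ => by simp
  | n + 1, φ, hφ => by
    rw [← (Fin.consEquiv fun _ : Fin (n + 1) => Y).sum_comp, Fintype.sum_prod_type]
    have hinner : ∀ y0 : Y, ∑ y : Fin n → Y, ∏ i, K (φ (Fin.cons y0 y) i.succ) (y i) = 1 := by
      intro y0
      refine sum_causal_prod hK (fun y i => φ (Fin.cons y0 y) i.succ) fun y y' i h => ?_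
      refine hφ _ _ _ fun t => Fin.cases (fun _ => rfl) (fun t ht => ?_) t
      simpa using h t (Fin.succ_lt_succ_iff.1 ht)
    obtain ⟨b⟩ := ‹Nonempty Y›
    have h0 : ∀ (y0 : Y) (y : Fin n → Y), φ (Fin.cons y0 y) 0 = φ (fun _ => b) 0 := fun y0 y =>
      hφ _ _ _ fun t ht => absurd ht (Fin.not_lt_zero t)
    calc _ = ∑ y0, K (φ (fun _ => b) 0) y0 *
          ∑ y : Fin n → Y, ∏ i, K (φ (Fin.cons y0 y) i.succ) (y i) := by
          refine Finset.sum_congr rfl fun y0 _ => ?_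
          rw [Finset.mul_sum]
          refine Finset.sum_congr rfl fun y _ => ?_
          simp only [Fin.consEquiv, Equiv.coe_fn_mk, Fin.prod_univ_succ, Fin.cons_zero,
            Fin.cons_succ, h0]
      _ = 1 := by simp only [hinner, mul_one, hK]

lemma sum_codeLaw {W1 W2 : 𝒳 → 𝒴 → ℝ} (hs1 : ∀ x, ∑ y, W1 x y = 1) (hs2 : ∀ x, ∑ y, W2 x y = 1)
    {n M : ℕ} {f : Fin M → (Fin n → 𝒴) → (Fin n → 𝒴) → Fin n → 𝒳} (hf : Causal n M f)
    (j : Fin M) :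
    ∑ y1 : Fin n → 𝒴, ∑ y2 : Fin n → 𝒴, codeLaw W1 W2 n M f j y1 y2 = 1 / M := by
  have hK : ∀ x, ∑ y : 𝒴 × 𝒴, W1 x y.1 * W2 x y.2 = 1 := fun x => by
    rw [Fintype.sum_prod_type]
    simp only [← Finset.mul_sum, hs2, mul_one, hs1]
  have h := sum_causal_prod hK (n := n)
    (fun y => f j (fun i => (y i).1) fun i => (y i).2)
    fun y y' i h => hf j _ _ _ _ i (fun t ht => by rw [h t ht]) fun t ht => by rw [h t ht]
  rw [← (Equiv.arrowProdEquivProdArrow (Fin n) (fun _ => 𝒴) (fun _ => 𝒴)).symm.sum_comp,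
    Fintype.sum_prod_type] at h
  simp only [codeLaw, ← Finset.mul_sum]
  refine (congrArg _ ?_).trans (mul_one _)
  exact h

lemma le_of_flfExists {W1 W2 : 𝒳 → 𝒴 → ℝ} (hW1 : ∀ x y, 0 ≤ W1 x y) (hW2 : ∀ x y, 0 ≤ W2 x y)
    (hs1 : ∀ x, ∑ y, W1 x y = 1) (hs2 : ∀ x, ∑ y, W2 x y = 1) {n M : ℕ} {ε : ℝ}
    (h : FLFExists W1 W2 n M ε) :
    M * (1 - ε) ≤ (Fintype.card 𝒴 : ℝ) ^ n * (Fintype.card 𝒴 : ℝ) ^ n := by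
  classical
  obtain ⟨f, hf, g1, -, he, -⟩ := h
  rcases Nat.eq_zero_or_pos M with rfl | hM
  · simp only [Nat.cast_zero, zero_mul]; positivity
  have hMr : (0 : ℝ) < M := by exact_mod_cast hM
  have hc0 : ∀ j y1 y2, 0 ≤ codeLaw W1 W2 n M f j y1 y2 := fun j y1 y2 =>
    mul_nonneg (by positivity) (Finset.prod_nonneg fun _ _ => mul_nonneg (hW1 _ _) (hW2 _ _))
  have hc1 : ∀ j y1 y2, codeLaw W1 W2 n M f j y1 y2 ≤ 1 / M := by
    intro j y1 y2
    rw [← sum_codeLaw hs1 hs2 hf j]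
    refine (Finset.single_le_sum (fun y2 _ => hc0 j y1 y2) (mem_univ y2)).trans ?_
    exact Finset.single_le_sum (f := fun y1 => ∑ y2, codeLaw W1 W2 n M f j y1 y2)
      (fun y1 _ => Finset.sum_nonneg fun y2 _ => hc0 j y1 y2) (mem_univ y1)
  have htot : ∑ j, ∑ y1 : Fin n → 𝒴, ∑ y2 : Fin n → 𝒴, codeLaw W1 W2 n M f j y1 y2 = 1 := by
    simp only [sum_codeLaw hs1 hs2 hf]
    simp [hMr.ne']
  have hsplit : 1 - ε ≤ ∑ j, ∑ y1 : Fin n → 𝒴, ∑ y2 : Fin n → 𝒴,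
      (if g1 y1 = j then codeLaw W1 W2 n M f j y1 y2 else 0) := by
    rw [← htot]
    refine (sub_le_sub_left he _).trans (le_of_eq ?_)
    simp only [errProb1, ← Finset.sum_sub_distrib]
    refine Finset.sum_congr rfl fun j _ => Finset.sum_congr rfl fun y1 _ =>
      Finset.sum_congr rfl fun y2 _ => ?_
    split_ifs <;> ring
  have hle : ∑ j, ∑ y1 : Fin n → 𝒴, ∑ y2 : Fin n → 𝒴,
      (if g1 y1 = j then codeLaw W1 W2 n M f j y1 y2 else 0)
      ≤ ∑ y1 : Fin n → 𝒴, ∑ _y2 : Fin n → 𝒴, 1 / (M : ℝ) := by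
    rw [Finset.sum_comm]
    refine Finset.sum_le_sum fun y1 _ => ?_
    rw [Finset.sum_comm]
    refine Finset.sum_le_sum fun y2 _ => ?_
    simpa using hc1 (g1 y1) y1 y2
  have hcard : ∑ y1 : Fin n → 𝒴, ∑ _y2 : Fin n → 𝒴, 1 / (M : ℝ)
      = (Fintype.card 𝒴 : ℝ) ^ n * (Fintype.card 𝒴 : ℝ) ^ n / M := by
    simp [Finset.card_univ]
    ring
  have := (hsplit.trans hle).trans hcard.le
  rw [le_div_iff₀ hMr] at this
  linarith

lemma log_le_log_MstarF {W1 W2 : 𝒳 → 𝒴 → ℝ} (hW1 : ∀ x y, 0 ≤ W1 x y)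
    (hW2 : ∀ x y, 0 ≤ W2 x y) (hs1 : ∀ x, ∑ y, W1 x y = 1) (hs2 : ∀ x, ∑ y, W2 x y = 1)
    {n M : ℕ} (hM : 0 < M) {ε : ℝ} (hε : ε < 1) (h : FLFExists W1 W2 n M ε) :
    Real.log M ≤ Real.log (MstarF W1 W2 n ε) := by
  have hb : BddAbove {M | FLFExists W1 W2 n M ε} := by
    refine ⟨⌈(Fintype.card 𝒴 : ℝ) ^ n * (Fintype.card 𝒴 : ℝ) ^ n / (1 - ε)⌉₊, fun M hM => ?_⟩
    have h1 := le_of_flfExists hW1 hW2 hs1 hs2 hM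
    rw [← le_div_iff₀ (by linarith)] at h1
    exact_mod_cast h1.trans (Nat.le_ceil _)
  refine Real.log_le_log (by exact_mod_cast hM) ?_
  exact_mod_cast le_csSup hb h

end Converse

section SingleLetter

section OneChannel

variable {W : 𝒳 → 𝒴 → ℝ} {P : 𝒳 → ℝ}

lemma sum_outDist (hs : ∀ x, ∑ y, W x y = 1) (hP : ∑ x, P x = 1) : ∑ y, outDist P W y = 1 := by
  simp only [outDist]
  rw [Finset.sum_comm]
  simp only [← Finset.mul_sum, hs, mul_one, hP]

lemma outDist_add_smul (v : 𝒳 → ℝ) (t : ℝ) (y : 𝒴) :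
    outDist (fun x => P x + t * v x) W y = outDist P W y + t * outDist v W y := by
  simp only [outDist, add_mul, Finset.sum_add_distrib, Finset.mul_sum, mul_assoc]

lemma outDist_eq_zero (hW : ∀ x y, 0 ≤ W x y) (hP : ∀ x, 0 < P x) {y : 𝒴}
    (h : outDist P W y = 0) (x : 𝒳) : W x y = 0 := by
  by_contra hne
  exact (outDist_pos hW hP ((hW x y).lt_of_ne' hne)).ne' h

lemma outDist_eq_zero_of_outDist_eq_zero (hW : ∀ x y, 0 ≤ W x y) (hP : ∀ x, 0 < P x) {y : 𝒴}
    (h : outDist P W y = 0) (v : 𝒳 → ℝ) : outDist v W y = 0 := by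
  simp [outDist, outDist_eq_zero hW hP h]

lemma sum_mul_relEnt : ∑ x, P x * relEnt (W x) (outDist P W) = mutInfo P W := by
  refine Finset.sum_congr rfl fun x _ => ?_
  rw [relEnt, Finset.mul_sum]
  exact Finset.sum_congr rfl fun y _ => by ring

lemma mutInfo_eq_sub_relEnt (hW : ∀ x y, 0 ≤ W x y) (hP : ∀ x, 0 < P x) {Q : 𝒳 → ℝ}
    (hQ : ∀ x, 0 ≤ Q x) :
    mutInfo Q W = ∑ x, Q x * relEnt (W x) (outDist P W)
      - relEnt (outDist Q W) (outDist P W) := by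
  have h1 : relEnt (outDist Q W) (outDist P W)
      = ∑ x, ∑ y, Q x * W x y * Real.log (outDist Q W y / outDist P W y) := by
    rw [Finset.sum_comm]
    refine Finset.sum_congr rfl fun y _ => ?_
    rw [← Finset.sum_mul]
    rfl
  rw [h1, mutInfo, ← Finset.sum_sub_distrib]
  refine Finset.sum_congr rfl fun x _ => ?_
  rw [relEnt, Finset.mul_sum, ← Finset.sum_sub_distrib]
  refine Finset.sum_congr rfl fun y _ => ?_
  rcases (hQ x).eq_or_lt with hx | hx
  · rw [← hx]; ring
  rcases (hW x y).eq_or_lt with hy | hy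
  · rw [← hy]; ring
  have hQW : 0 < outDist Q W y := (mul_pos hx hy).trans_le
    (Finset.single_le_sum (f := fun x => Q x * W x y)
      (fun x _ => mul_nonneg (hQ x) (hW x y)) (mem_univ x))
  have hPW := outDist_pos hW hP hy
  rw [Real.log_div hy.ne' hQW.ne', Real.log_div hy.ne' hPW.ne', Real.log_div hQW.ne' hPW.ne']
  ring

lemma mutInfo_add_smul (hW : ∀ x y, 0 ≤ W x y) (hP : ∀ x, 0 < P x) {v : 𝒳 → ℝ} {t : ℝ}
    (hQ : ∀ x, 0 ≤ P x + t * v x) :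
    mutInfo (fun x => P x + t * v x) W = mutInfo P W + t * gradI P W v
      - relEnt (outDist (fun x => P x + t * v x) W) (outDist P W) := by
  rw [mutInfo_eq_sub_relEnt hW hP hQ, ← sum_mul_relEnt, gradI, Finset.mul_sum]
  simp only [add_mul, Finset.sum_add_distrib, mul_assoc]

lemma relEnt_nonneg {p q : 𝒴 → ℝ} (hp : ∀ y, 0 ≤ p y) (hq : ∀ y, 0 ≤ q y)
    (hpq : ∀ y, q y = 0 → p y = 0) (hp1 : ∑ y, p y = 1) (hq1 : ∑ y, q y = 1) :
    0 ≤ relEnt p q := by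
  have h : ∑ y, (p y - q y) ≤ relEnt p q := by
    refine Finset.sum_le_sum fun y _ => ?_
    rcases (hp y).eq_or_lt with h0 | h0
    · rw [← h0]; linarith [hq y]
    have hqy : 0 < q y := (hq y).lt_of_ne' fun h => h0.ne' (hpq y h)
    have h1 := Real.log_le_sub_one_of_pos (div_pos hqy h0)
    rw [← neg_neg (Real.log (p y / q y)), ← Real.log_inv, inv_div]
    have h2 := mul_le_mul_of_nonneg_left h1 h0.le
    have h3 : p y * (q y / p y - 1) = q y - p y := by field_simp
    linarith
  rw [Finset.sum_sub_distrib, hp1, hq1] at h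
  linarith

lemma relEnt_le_chiSq {p q : 𝒴 → ℝ} (hp : ∀ y, 0 ≤ p y) (hq : ∀ y, 0 ≤ q y)
    (hpq : ∀ y, q y = 0 → p y = 0) (hp1 : ∑ y, p y = 1) (hq1 : ∑ y, q y = 1) :
    relEnt p q ≤ ∑ y, (p y - q y) ^ 2 / q y := by
  have h : relEnt p q ≤ ∑ y, ((p y - q y) ^ 2 / q y + (p y - q y)) := by
    refine Finset.sum_le_sum fun y _ => ?_
    rcases (hq y).eq_or_lt with h0 | h0
    · rw [hpq y h0.symm, ← h0]; simp
    have e : (p y - q y) ^ 2 / q y + (p y - q y) = p y * (p y / q y - 1) := by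
      field_simp; ring
    rw [e]
    rcases (hp y).eq_or_lt with hp0 | hp0
    · rw [← hp0]; simp
    exact mul_le_mul_of_nonneg_left (Real.log_le_sub_one_of_pos (div_pos hp0 h0)) hp0.le
  rw [Finset.sum_add_distrib, Finset.sum_sub_distrib, hp1, hq1] at h
  linarith

lemma mutInfo_le_add_gradI (hW : ∀ x y, 0 ≤ W x y) (hs : ∀ x, ∑ y, W x y = 1)
    (hP : ∀ x, 0 < P x) (hP1 : ∑ x, P x = 1) {Q : 𝒳 → ℝ} (hQ : IsDist Q) :
    mutInfo Q W ≤ mutInfo P W + gradI P W fun x => Q x - P x := by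
  have h := mutInfo_add_smul (v := fun x => Q x - P x) (t := 1) hW hP
    (fun x => by linarith [hQ.1 x])
  have e : (fun x => P x + 1 * (Q x - P x)) = Q := by funext x; ring
  rw [e, one_mul] at h
  rw [h]
  linarith [relEnt_nonneg (outDist_nonneg hW hQ.1) (outDist_nonneg hW fun x => (hP x).le)
    (fun y hy => outDist_eq_zero_of_outDist_eq_zero hW hP hy Q) (sum_outDist hs hQ.2)
    (sum_outDist hs hP1)]

/-- Second-order lower bound for the mutual information along a line. -/
lemma le_mutInfo_add_smul (hW : ∀ x y, 0 ≤ W x y) (hs : ∀ x, ∑ y, W x y = 1)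
    (hP : ∀ x, 0 < P x) (hP1 : ∑ x, P x = 1) {v : 𝒳 → ℝ} (hv : ∑ x, v x = 0) {t : ℝ}
    (hQ : ∀ x, 0 ≤ P x + t * v x) :
    mutInfo P W + t * gradI P W v - (∑ y, outDist v W y ^ 2 / outDist P W y) * t ^ 2
      ≤ mutInfo (fun x => P x + t * v x) W := by
  rw [mutInfo_add_smul hW hP hQ]
  have h := relEnt_le_chiSq (outDist_nonneg hW hQ) (outDist_nonneg hW fun x => (hP x).le)
    (fun y hy => outDist_eq_zero_of_outDist_eq_zero hW hP hy _)
    (sum_outDist hs (by rw [Finset.sum_add_distrib, ← Finset.mul_sum, hv, hP1]; ring))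
    (sum_outDist hs hP1)
  have e : ∑ y, (outDist (fun x => P x + t * v x) W y - outDist P W y) ^ 2 / outDist P W y
      = (∑ y, outDist v W y ^ 2 / outDist P W y) * t ^ 2 := by
    rw [Finset.sum_mul]
    refine Finset.sum_congr rfl fun y _ => ?_
    rw [outDist_add_smul]; ring
  rw [e] at h
  linarith

lemma chiSq_nonneg (hW : ∀ x y, 0 ≤ W x y) (hP : ∀ x, 0 < P x) (v : 𝒳 → ℝ) :
    0 ≤ ∑ y, outDist v W y ^ 2 / outDist P W y :=
  Finset.sum_nonneg fun y _ =>
    div_nonneg (sq_nonneg _) (outDist_nonneg hW (fun x => (hP x).le) y)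

lemma abs_mutInfo_le (hW : ∀ x y, 0 ≤ W x y) (hs : ∀ x, ∑ y, W x y = 1) {Q : 𝒳 → ℝ}
    (hQ : IsDist Q) {b : ℝ} (hb : ∀ x y, |infoDens Q W x y| ≤ b) : |mutInfo Q W| ≤ b := by
  calc |mutInfo Q W| ≤ ∑ x, ∑ y, Q x * W x y * b := by
        refine (Finset.abs_sum_le_sum_abs _ _).trans (Finset.sum_le_sum fun x _ => ?_)
        refine (Finset.abs_sum_le_sum_abs _ _).trans (Finset.sum_le_sum fun y _ => ?_)
        have h0 := mul_nonneg (hQ.1 x) (hW x y)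
        rw [abs_mul, abs_of_nonneg h0]
        exact mul_le_mul_of_nonneg_left (hb x y) h0
    _ = b := by
        simp only [← Finset.sum_mul, ← Finset.mul_sum, hs, mul_one, hQ.2, one_mul]

lemma abs_infoDens_le_of_near (hW : ∀ x y, 0 ≤ W x y) (hP : ∀ x, 0 < P x) {Q : 𝒳 → ℝ}
    (h1 : ∀ x, P x / 2 ≤ Q x) (h2 : ∀ x, Q x ≤ 2 * P x) (x : 𝒳) (y : 𝒴) :
    |infoDens Q W x y| ≤ |infoDens P W x y| + 1 := by
  rcases (hW x y).eq_or_lt with hy | hy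
  · simp only [infoDens, ← hy, zero_div, Real.log_zero, abs_zero]; norm_num
  have hPW := outDist_pos hW hP hy
  have hlo : outDist P W y / 2 ≤ outDist Q W y := by
    rw [outDist, outDist, Finset.sum_div]
    refine Finset.sum_le_sum fun x _ => ?_
    have := mul_le_mul_of_nonneg_right (h1 x) (hW x y)
    linarith
  have hhi : outDist Q W y ≤ 2 * outDist P W y := by
    rw [outDist, outDist, Finset.mul_sum]
    refine Finset.sum_le_sum fun x _ => ?_
    have := mul_le_mul_of_nonneg_right (h2 x) (hW x y)
    linarith
  have hQW : 0 < outDist Q W y := by linarith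
  have hl2 : Real.log 2 ≤ 1 := by linarith [Real.log_le_sub_one_of_pos (zero_lt_two' ℝ)]
  have a1 := Real.log_le_log hQW hhi
  have a2 := Real.log_le_log (by positivity) hlo
  rw [Real.log_mul two_ne_zero hPW.ne'] at a1
  rw [Real.log_div hPW.ne' two_ne_zero] at a2
  simp only [infoDens]
  rw [Real.log_div hy.ne' hQW.ne', Real.log_div hy.ne' hPW.ne']
  have e : Real.log (W x y) - Real.log (outDist Q W y)
    = (Real.log (W x y) - Real.log (outDist P W y))
      + (Real.log (outDist P W y) - Real.log (outDist Q W y)) := by ring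
  rw [e]
  refine (abs_add_le _ _).trans (add_le_add_right ?_ _)
  rw [abs_le]
  constructor <;> linarith

lemma exists_abs_infoDens_le (P : 𝒳 → ℝ) (W : 𝒳 → 𝒴 → ℝ) :
    ∃ b, 0 ≤ b ∧ ∀ x y, |infoDens P W x y| ≤ b := by
  refine ⟨∑ x, ∑ y, |infoDens P W x y|,
    Finset.sum_nonneg fun x _ => Finset.sum_nonneg fun y _ => abs_nonneg _, fun x y => ?_⟩
  refine (Finset.single_le_sum (fun y _ => abs_nonneg (infoDens P W x y)) (mem_univ y)).trans ?_
  exact Finset.single_le_sum (f := fun x => ∑ y, |infoDens P W x y|)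
    (fun x _ => Finset.sum_nonneg fun y _ => abs_nonneg _) (mem_univ x)

end OneChannel

/-- If the first channel is the only bottleneck at `P`, then `P` does not maximise the minimum. -/
lemma mutInfo_le_of_isMaxMin {W1 W2 : 𝒳 → 𝒴 → ℝ} (hW1 : ∀ x y, 0 ≤ W1 x y)
    (hs1 : ∀ x, ∑ y, W1 x y = 1) (hW2 : ∀ x y, 0 ≤ W2 x y) (hs2 : ∀ x, ∑ y, W2 x y = 1)
    {P : 𝒳 → ℝ} (hP : ∀ x, 0 < P x) (hP1 : ∑ x, P x = 1) {C : ℝ}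
    (hmax : ∀ Q, IsDist Q → min (mutInfo Q W1) (mutInfo Q W2) ≤ C) (hI1 : mutInfo P W1 = C)
    {R : 𝒳 → ℝ} (hR : IsDist R) (hRC : C < mutInfo R W1) : mutInfo P W2 ≤ C := by
  by_contra! hI2
  set v : 𝒳 → ℝ := fun x => R x - P x with hv
  have hv0 : ∑ x, v x = 0 := by simp [hv, Finset.sum_sub_distrib, hR.2, hP1]
  have hg : 0 < gradI P W1 v := by
    have := mutInfo_le_add_gradI hW1 hs1 hP hP1 hR
    linarith
  set c1 := ∑ y, outDist v W1 y ^ 2 / outDist P W1 y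
  set c2 := ∑ y, outDist v W2 y ^ 2 / outDist P W2 y
  have hf1 : ∀ᶠ t in nhdsWithin (0 : ℝ) (Set.Ioi 0), 0 < gradI P W1 v - c1 * t := by
    have h : Filter.Tendsto (fun t => gradI P W1 v - c1 * t) (nhds 0)
        (nhds (gradI P W1 v - c1 * 0)) := by
      apply Continuous.tendsto; fun_prop
    rw [mul_zero, sub_zero] at h
    exact (h.eventually (lt_mem_nhds hg)).filter_mono nhdsWithin_le_nhds
  have hf2 : ∀ᶠ t in nhdsWithin (0 : ℝ) (Set.Ioi 0),
      C < mutInfo P W2 + t * gradI P W2 v - c2 * t ^ 2 := by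
    have h : Filter.Tendsto (fun t => mutInfo P W2 + t * gradI P W2 v - c2 * t ^ 2) (nhds 0)
        (nhds (mutInfo P W2 + 0 * gradI P W2 v - c2 * 0 ^ 2)) := by
      apply Continuous.tendsto; fun_prop
    have e : mutInfo P W2 + 0 * gradI P W2 v - c2 * 0 ^ 2 = mutInfo P W2 := by ring
    rw [e] at h
    exact (h.eventually (lt_mem_nhds hI2)).filter_mono nhdsWithin_le_nhds
  have hf3 : ∀ᶠ t in nhdsWithin (0 : ℝ) (Set.Ioi 0), t ∈ Set.Ioo (0 : ℝ) 1 :=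
    Ioo_mem_nhdsGT one_pos
  obtain ⟨t, h1, h2, ht0, ht1⟩ := (hf1.and (hf2.and hf3)).exists
  have hQ : ∀ x, 0 ≤ P x + t * v x := fun x => by
    have : P x + t * v x = (1 - t) * P x + t * R x := by simp only [hv]; ring
    rw [this]
    exact add_nonneg (mul_nonneg (by linarith) (hP x).le) (mul_nonneg ht0.le (hR.1 x))
  have hQd : IsDist fun x => P x + t * v x :=
    ⟨hQ, by rw [Finset.sum_add_distrib, ← Finset.mul_sum, hv0, hP1]; ring⟩
  have b1 := le_mutInfo_add_smul hW1 hs1 hP hP1 hv0 hQ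
  have b2 := le_mutInfo_add_smul hW2 hs2 hP hP1 hv0 hQ
  have hm := hmax _ hQd
  rcases min_le_iff.1 hm with h | h
  · have : 0 < t * (gradI P W1 v - c1 * t) := mul_pos ht0 h1
    nlinarith
  · linarith

lemma mutInfo_eq_of_isMaxMin {W1 W2 : 𝒳 → 𝒴 → ℝ} (hW1 : ∀ x y, 0 ≤ W1 x y)
    (hs1 : ∀ x, ∑ y, W1 x y = 1) (hW2 : ∀ x y, 0 ≤ W2 x y) (hs2 : ∀ x, ∑ y, W2 x y = 1)
    {P : 𝒳 → ℝ} (hP : ∀ x, 0 < P x) (hP1 : ∑ x, P x = 1) {C : ℝ}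
    (hach : min (mutInfo P W1) (mutInfo P W2) = C)
    (hmax : ∀ Q, IsDist Q → min (mutInfo Q W1) (mutInfo Q W2) ≤ C)
    {R1 R2 : 𝒳 → ℝ} (hR1 : IsDist R1) (hRC1 : C < mutInfo R1 W1)
    (hR2 : IsDist R2) (hRC2 : C < mutInfo R2 W2) :
    mutInfo P W1 = C ∧ mutInfo P W2 = C := by
  rcases le_total (mutInfo P W1) (mutInfo P W2) with h | h
  · rw [min_eq_left h] at hach
    exact ⟨hach, le_antisymm (mutInfo_le_of_isMaxMin hW1 hs1 hW2 hs2 hP hP1 hmax hach hR1 hRC1)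
      (hach ▸ h)⟩
  · rw [min_eq_right h] at hach
    exact ⟨le_antisymm (mutInfo_le_of_isMaxMin hW2 hs2 hW1 hs1 hP hP1
      (fun Q hQ => by rw [min_comm]; exact hmax Q hQ) hach hR2 hRC2) (hach ▸ h), hach⟩

end SingleLetter

section Direction

lemma gradI_sub {W : 𝒳 → 𝒴 → ℝ} {P : 𝒳 → ℝ} (Q : 𝒳 → ℝ) :
    gradI P W (fun x => Q x - P x) = ∑ x, Q x * relEnt (W x) (outDist P W) - mutInfo P W := by
  rw [← sum_mul_relEnt (P := P), ← Finset.sum_sub_distrib]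
  exact Finset.sum_congr rfl fun x _ => by ring

lemma gradI_const_mul {W : 𝒳 → 𝒴 → ℝ} {P : 𝒳 → ℝ} (a : ℝ) (v : 𝒳 → ℝ) :
    gradI P W (fun x => a * v x) = a * gradI P W v := by
  simp only [gradI, Finset.mul_sum, mul_assoc]

/-- Stationarity: the weighted divergences from the output laws do not depend on the input. -/
lemma weighted_relEnt_eq {W1 W2 : 𝒳 → 𝒴 → ℝ} {P : 𝒳 → ℝ} (hP1 : ∑ x, P x = 1) {C η : ℝ}
    (hI1 : mutInfo P W1 = C) (hI2 : mutInfo P W2 = C)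
    (hη : ∀ v : 𝒳 → ℝ, ∑ x, v x = 0 → η * gradI P W1 v + (1 - η) * gradI P W2 v = 0) (x : 𝒳) :
    η * relEnt (W1 x) (outDist P W1) + (1 - η) * relEnt (W2 x) (outDist P W2) = C := by
  classical
  have h := hη (fun x' => (if x' = x then 1 else 0) - P x')
    (by rw [Finset.sum_sub_distrib, hP1]; simp)
  rw [gradI_sub, gradI_sub, hI1, hI2] at h
  simp only [ite_mul, one_mul, zero_mul, Finset.sum_ite_eq', mem_univ, if_true] at h
  linarith

lemma sum_mul_infoDens {W : 𝒳 → 𝒴 → ℝ} {P : 𝒳 → ℝ} (x : 𝒳) :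
    ∑ y, W x y * infoDens P W x y = relEnt (W x) (outDist P W) := rfl

/-- The weighted information density has conditional mean `C` and explicit variance. -/
lemma sum_jointLaw_weighted_sq {W1 W2 : 𝒳 → 𝒴 → ℝ} (hs1 : ∀ x, ∑ y, W1 x y = 1)
    (hs2 : ∀ x, ∑ y, W2 x y = 1) {P : 𝒳 → ℝ} {C η : ℝ}
    (hkkt : ∀ x, η * relEnt (W1 x) (outDist P W1) + (1 - η) * relEnt (W2 x) (outDist P W2) = C) :
    ∑ t, jointLaw W1 W2 P t *
      (η * infoDens P W1 t.1 t.2.1 + (1 - η) * infoDens P W2 t.1 t.2.2 - C) ^ 2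
      = η ^ 2 * condInfoVar P W1 + (1 - η) ^ 2 * condInfoVar P W2 := by
  rw [sum_jointLaw_mul fun t =>
    (η * infoDens P W1 t.1 t.2.1 + (1 - η) * infoDens P W2 t.1 t.2.2 - C) ^ 2]
  simp only [condInfoVar, Finset.mul_sum (s := (univ : Finset 𝒳)), ← Finset.sum_add_distrib]
  refine Finset.sum_congr rfl fun x _ => ?_
  set a : 𝒴 → ℝ := fun y => infoDens P W1 x y - relEnt (W1 x) (outDist P W1) with ha
  set b : 𝒴 → ℝ := fun y => infoDens P W2 x y - relEnt (W2 x) (outDist P W2) with hb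
  have ha0 : ∑ y, W1 x y * a y = 0 := by
    simp only [ha, mul_sub, Finset.sum_sub_distrib, ← Finset.sum_mul, hs1, sum_mul_infoDens]
    ring
  have va : symbVar P W1 x = ∑ y, W1 x y * a y ^ 2 := rfl
  have vb : symbVar P W2 x = ∑ y, W2 x y * b y ^ 2 := rfl
  have e : ∑ y : 𝒴 × 𝒴, W1 x y.1 * W2 x y.2 *
      (η * infoDens P W1 x y.1 + (1 - η) * infoDens P W2 x y.2 - C) ^ 2
      = η ^ 2 * ∑ y : 𝒴 × 𝒴, W1 x y.1 * W2 x y.2 * a y.1 ^ 2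
        + (1 - η) ^ 2 * ∑ y : 𝒴 × 𝒴, W1 x y.1 * W2 x y.2 * b y.2 ^ 2
        + 2 * η * (1 - η) * ((∑ y, W1 x y * a y) * ∑ y, W2 x y * b y) := by
    rw [Finset.sum_mul_sum, ← Fintype.sum_prod_type']
    simp only [Finset.mul_sum, ← Finset.sum_add_distrib]
    refine Finset.sum_congr rfl fun y _ => ?_
    have : η * infoDens P W1 x y.1 + (1 - η) * infoDens P W2 x y.2 - C
        = η * a y.1 + (1 - η) * b y.2 := by
      simp only [ha, hb]; linarith [hkkt x]
    rw [this]; ring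
  rw [e, ha0, sum_fst_marginal hs2 x fun y => a y ^ 2, sum_snd_marginal hs1 x fun y => b y ^ 2,
    va, vb]
  ring

/-- A direction along which the two channels trade rate, together with uniform estimates for the
input laws close to `P` along this direction. -/
lemma exists_trade_direction {W1 W2 : 𝒳 → 𝒴 → ℝ} (hW1 : ∀ x y, 0 ≤ W1 x y)
    (hs1 : ∀ x, ∑ y, W1 x y = 1) (hW2 : ∀ x y, 0 ≤ W2 x y) (hs2 : ∀ x, ∑ y, W2 x y = 1)
    {P : 𝒳 → ℝ} (hP : ∀ x, 0 < P x) (hP1 : ∑ x, P x = 1) {C η : ℝ}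
    (hη0 : 0 < η) (hη1 : η < 1)
    (hη : ∀ v : 𝒳 → ℝ, ∑ x, v x = 0 → η * gradI P W1 v + (1 - η) * gradI P W2 v = 0)
    (hI1 : mutInfo P W1 = C) (hI2 : mutInfo P W2 = C)
    {R : 𝒳 → ℝ} (hR : IsDist R) (hRC : C < mutInfo R W1) :
    ∃ v : 𝒳 → ℝ, ∃ t₀ c B : ℝ, 0 < t₀ ∧ 0 ≤ c ∧ 0 ≤ B ∧ ∀ θ, |θ| ≤ t₀ →
      (∀ x, 0 < P x + θ * v x) ∧ ∑ x, (P x + θ * v x) = 1 ∧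
      C + (1 - η) * θ - c * θ ^ 2 ≤ mutInfo (fun x => P x + θ * v x) W1 ∧
      C - η * θ - c * θ ^ 2 ≤ mutInfo (fun x => P x + θ * v x) W2 ∧
      (∀ x y, |mutInfo (fun x => P x + θ * v x) W1
        - infoDens (fun x => P x + θ * v x) W1 x y| ≤ B) ∧
      (∀ x y, |mutInfo (fun x => P x + θ * v x) W2
        - infoDens (fun x => P x + θ * v x) W2 x y| ≤ B) := by
  have hg : 0 < gradI P W1 fun x => R x - P x := by
    have := mutInfo_le_add_gradI hW1 hs1 hP hP1 hR
    linarith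
  set g := gradI P W1 fun x => R x - P x with hgdef
  set v : 𝒳 → ℝ := fun x => ((1 - η) / g) * (R x - P x) with hv
  have hv0 : ∑ x, v x = 0 := by
    simp [hv, ← Finset.mul_sum, Finset.sum_sub_distrib, hR.2, hP1]
  have hg1 : gradI P W1 v = 1 - η := by
    rw [hv, gradI_const_mul, ← hgdef]; field_simp
  have hg2 : gradI P W2 v = -η := by
    have h := hη v hv0
    rw [hg1] at h
    have h1 : (1 - η) * (gradI P W2 v + η) = 0 := by linarith
    rcases mul_eq_zero.1 h1 with h | h <;> linarith
  set c1 := ∑ y, outDist v W1 y ^ 2 / outDist P W1 y with hc1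
  set c2 := ∑ y, outDist v W2 y ^ 2 / outDist P W2 y with hc2
  have hc10 : 0 ≤ c1 := chiSq_nonneg hW1 hP v
  have hc20 : 0 ≤ c2 := chiSq_nonneg hW2 hP v
  obtain ⟨b1, hb10, hb1⟩ := exists_abs_infoDens_le P W1
  obtain ⟨b2, hb20, hb2⟩ := exists_abs_infoDens_le P W2
  have hnear : ∃ t₀ > 0, ∀ x, t₀ * |v x| ≤ P x / 2 := by
    have hx : Nonempty 𝒳 := by
      by_contra hne
      rw [not_nonempty_iff] at hne
      simp at hP1
    obtain ⟨x₀, -, hx₀⟩ := Finset.exists_min_image univ P univ_nonempty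
    refine ⟨P x₀ / 2 / (∑ x, |v x| + 1), div_pos (half_pos (hP x₀)) (by positivity), fun x => ?_⟩
    have h1 : |v x| ≤ ∑ x, |v x| + 1 :=
      (Finset.single_le_sum (fun x _ => abs_nonneg (v x)) (mem_univ x)).trans (by linarith)
    have hpos : 0 < ∑ x, |v x| + 1 := by positivity
    rw [div_mul_eq_mul_div, div_le_iff₀ hpos]
    have h2 := hx₀ x (mem_univ x)
    have := hP x₀
    nlinarith [abs_nonneg (v x)]
  obtain ⟨t₀, ht₀, hnear⟩ := hnear
  refine ⟨v, t₀, c1 + c2, 2 * (b1 + b2 + 1), ht₀, by linarith, by linarith, fun θ hθ => ?_⟩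
  have habs : ∀ x, |θ * v x| ≤ P x / 2 := fun x => by
    rw [abs_mul]
    exact (mul_le_mul_of_nonneg_right hθ (abs_nonneg _)).trans (hnear x)
  have hlo : ∀ x, P x / 2 ≤ P x + θ * v x := fun x => by linarith [(abs_le.1 (habs x)).1]
  have hhi : ∀ x, P x + θ * v x ≤ 2 * P x := fun x => by
    linarith [(abs_le.1 (habs x)).2, hP x]
  have hpos : ∀ x, 0 < P x + θ * v x := fun x => by linarith [hlo x, hP x]
  have hone : ∑ x, (P x + θ * v x) = 1 := by
    rw [Finset.sum_add_distrib, ← Finset.mul_sum, hv0, hP1]; ring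
  have hbound : ∀ (W : 𝒳 → 𝒴 → ℝ) (b : ℝ), (∀ x y, 0 ≤ W x y) → (∀ x, ∑ y, W x y = 1) →
      (∀ x y, |infoDens P W x y| ≤ b) → ∀ x y, |mutInfo (fun x => P x + θ * v x) W
        - infoDens (fun x => P x + θ * v x) W x y| ≤ 2 * (b + 1) := by
    intro W b hW hs hb x y
    have h1 : ∀ x y, |infoDens (fun x => P x + θ * v x) W x y| ≤ b + 1 := fun x y =>
      (abs_infoDens_le_of_near hW hP hlo hhi x y).trans (by linarith [hb x y])
    have h2 := abs_mutInfo_le hW hs ⟨fun x => (hpos x).le, hone⟩ h1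
    have := abs_sub (mutInfo (fun x => P x + θ * v x) W)
      (infoDens (fun x => P x + θ * v x) W x y)
    linarith [h1 x y]
  refine ⟨hpos, hone, ?_, ?_, fun x y => (hbound W1 b1 hW1 hs1 hb1 x y).trans (by linarith),
    fun x y => (hbound W2 b2 hW2 hs2 hb2 x y).trans (by linarith)⟩
  · have h := le_mutInfo_add_smul hW1 hs1 hP hP1 hv0 fun x => (hpos x).le
    rw [hI1, hg1, ← hc1] at h
    nlinarith [mul_nonneg hc20 (sq_nonneg θ)]
  · have h := le_mutInfo_add_smul hW2 hs2 hP hP1 hv0 fun x => (hpos x).le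
    rw [hI2, hg2, ← hc2] at h
    nlinarith [mul_nonneg hc10 (sq_nonneg θ)]

end Direction

section Selection

/-- The choice of the second-phase mode: `S` is the common and `D` the differential deviation of
the first phase. Balance the decoders if `S` is large, otherwise sacrifice one of them. -/
lemma exists_mode {η b u q₁ q₂ : ℝ} (hη0 : 0 < η) (hη1 : η < 1) (hu : 0 < u) (hbu : b ≤ u)
    {N : ℕ} (huN : u ≤ N) (h1 : q₂ ≤ -b + (1 - η) * (u - b)) (h2 : q₂ ≤ -b + η * (u - b))
    (S D : ℝ) :
    ∃ s : Fin (2 * N + 1), |D| ≤ b → |S| ≤ b →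
      (¬ (q₁ ≤ S ∧ S < q₂) → q₂ - 1 ≤ S + (1 - η) * (D + u * (((s : ℕ) - N : ℝ) / N))) ∧
      (¬ S < q₁ → q₂ - 1 ≤ S - η * (D + u * (((s : ℕ) - N : ℝ) / N))) := by
  have hN : (0 : ℝ) < N := hu.trans_le huN
  have hη1' : 0 < 1 - η := by linarith
  by_cases hS : q₂ ≤ S
  · by_cases hD : |D| ≤ b
    swap
    · exact ⟨0, fun h => absurd h hD⟩
    have hDu := abs_le.1 (hD.trans hbu)
    set x : ℝ := (1 - D / u) * N with hx
    have hDle : D / u ≤ 1 := by rw [div_le_one hu]; exact hDu.2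
    have hDge : -1 ≤ D / u := by rw [le_div_iff₀ hu]; linarith
    have hx0 : 0 ≤ x := mul_nonneg (by linarith) hN.le
    have hx2 : x ≤ 2 * N := mul_le_mul_of_nonneg_right (by linarith) hN.le
    have hk : ⌊x⌋₊ < 2 * N + 1 := by
      have : (⌊x⌋₊ : ℝ) < (2 * N + 1 : ℕ) := by
        push_cast; linarith [Nat.floor_le hx0]
      exact_mod_cast this
    refine ⟨⟨⌊x⌋₊, hk⟩, fun _ _ => ?_⟩
    have hf1 := Nat.floor_le hx0
    have hf2 := Nat.lt_floor_add_one x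
    simp only
    have e : D + u * (((⌊x⌋₊ : ℕ) - N : ℝ) / N) = (u / N) * (⌊x⌋₊ - x) := by
      simp only [hx]
      field_simp
      ring
    have huN' : u / N ≤ 1 := (div_le_one hN).2 huN
    have hu0 : 0 < u / N := div_pos hu hN
    have hlo : -1 ≤ D + u * (((⌊x⌋₊ : ℕ) - N : ℝ) / N) := by rw [e]; nlinarith
    have hhi : D + u * (((⌊x⌋₊ : ℕ) - N : ℝ) / N) ≤ 0 := by rw [e]; nlinarith
    exact ⟨fun _ => by nlinarith, fun _ => by nlinarith⟩
  · push Not at hS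
    by_cases hq : S < q₁
    · refine ⟨⟨2 * N, by omega⟩, fun hD hSb => ⟨fun _ => ?_, fun h => absurd hq h⟩⟩
      have e : ((((2 * N : ℕ) : ℝ) - N) / N) = 1 := by push_cast; field_simp; ring
      simp only [e]
      nlinarith [(abs_le.1 hD).1, (abs_le.1 hSb).1]
    · refine ⟨⟨0, by omega⟩, fun hD hSb => ⟨fun h => absurd ⟨not_lt.1 hq, hS⟩ h, fun _ => ?_⟩⟩
      have e : ((((0 : ℕ) : ℝ) - N) / N) = -1 := by push_cast; field_simp; ring
      simp only [e]
      nlinarith [(abs_le.1 hD).2, (abs_le.1 hSb).1]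

variable {α : Type*} [Fintype α]

/-- Two-sided moderate deviations of a sum of bounded centred variables. -/
lemma sum_iid_abs_dev_le (p ξ : α → ℝ) (hp : ∀ a, 0 ≤ p a) (hp1 : ∑ a, p a = 1)
    (hmean : ∑ a, p a * ξ a = 0) {B : ℝ} (hB : ∀ a, |ξ a| ≤ B) {n : ℕ} {h r : ℝ}
    (hh : 0 < h) (hr : 0 ≤ r) (hn : (n : ℝ) ≤ h ^ 6) (hrB : r * B ≤ h ^ 3) :
    ∑ c : Fin n → α, (∏ i, p (c i)) *
        (if (B ^ 2 + 1) * (h ^ 3 * r) < |∑ i, ξ (c i)| then 1 else 0)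
      ≤ 2 * Real.exp (-r ^ 2) := by
  have hh3 : 0 < h ^ 3 := by positivity
  have hlB : r / h ^ 3 * B ≤ 1 := by
    rw [div_mul_eq_mul_div]; exact (div_le_one hh3).2 hrB
  have hexp : Real.exp (-(r / h ^ 3 * ((B ^ 2 + 1) * (h ^ 3 * r)))
      + Fintype.card (Fin n) * (r / h ^ 3 * B) ^ 2) ≤ Real.exp (-r ^ 2) := by
    rw [Real.exp_le_exp, Fintype.card_fin]
    have e1 : r / h ^ 3 * ((B ^ 2 + 1) * (h ^ 3 * r)) = (B ^ 2 + 1) * r ^ 2 := by field_simp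
    have e2 : (n : ℝ) * (r / h ^ 3 * B) ^ 2 ≤ B ^ 2 * r ^ 2 := by
      have : h ^ 6 * (r / h ^ 3 * B) ^ 2 = B ^ 2 * r ^ 2 := by field_simp
      rw [← this]
      exact mul_le_mul_of_nonneg_right hn (sq_nonneg _)
    rw [e1]; linarith
  have c1 := (chernoff_iid (ι := Fin n) p ξ hp hp1 hmean hB (div_nonneg hr hh3.le) hlB
    ((B ^ 2 + 1) * (h ^ 3 * r))).trans hexp
  have c2 := (chernoff_iid (ι := Fin n) p (fun a => -ξ a) hp hp1 (by simp [hmean])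
    (fun a => by rw [abs_neg]; exact hB a) (div_nonneg hr hh3.le) hlB
    ((B ^ 2 + 1) * (h ^ 3 * r))).trans hexp
  calc _ ≤ ∑ c : Fin n → α, ((∏ i, p (c i)) *
          (if (B ^ 2 + 1) * (h ^ 3 * r) ≤ ∑ i, ξ (c i) then 1 else 0)
        + (∏ i, p (c i)) *
          (if (B ^ 2 + 1) * (h ^ 3 * r) ≤ ∑ i, -ξ (c i) then 1 else 0)) := by
        refine Finset.sum_le_sum fun c _ => ?_
        have h0 : 0 ≤ ∏ i, p (c i) := Finset.prod_nonneg fun _ _ => hp _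
        rw [← mul_add]
        refine mul_le_mul_of_nonneg_left ?_ h0
        rw [Finset.sum_neg_distrib]
        by_cases hc : (B ^ 2 + 1) * (h ^ 3 * r) < |∑ i, ξ (c i)|
        · rw [if_pos hc]
          rcases lt_abs.1 hc with h | h
          · rw [if_pos h.le]; split_ifs <;> norm_num
          · rw [if_pos h.le]; split_ifs <;> norm_num
        · rw [if_neg hc]; split_ifs <;> norm_num
    _ ≤ _ := by rw [Finset.sum_add_distrib]; linarith

/-- The smoothed standard deviation `√(h² + nV)` is close to `√(h⁶V)` when `n` is close to `h⁶`. -/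
lemma sqrt_add_mul_bounds {V h n : ℝ} (hVpos : 0 < V) (hh : 1 ≤ h) (hn1 : h ^ 6 / 2 ≤ n)
    (hn2 : n ≤ h ^ 6) (hn3 : h ^ 6 - n ≤ 2 * h ^ 4) :
    Real.sqrt (V / 2) * h ^ 3 ≤ Real.sqrt (h ^ 2 + n * V) ∧
      Real.sqrt (h ^ 2 + n * V) ≤ Real.sqrt (1 + V) * h ^ 3 ∧
      |Real.sqrt (h ^ 2 + n * V) - h ^ 3 * Real.sqrt V| ≤ (1 + 2 * V) / Real.sqrt V * h := by
  have hhpos : 0 < h := by linarith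
  have hsV : 0 < Real.sqrt V := Real.sqrt_pos.2 hVpos
  have hn0 : 0 ≤ n := le_trans (by positivity) hn1
  have hh16 : h ^ 2 ≤ h ^ 6 := pow_le_pow_right₀ hh (by norm_num)
  have hh24 : h ^ 2 ≤ h ^ 4 := pow_le_pow_right₀ hh (by norm_num)
  have hm1 : h ^ 6 / 2 * V ≤ n * V := mul_le_mul_of_nonneg_right hn1 hVpos.le
  have hm2 : n * V ≤ h ^ 6 * V := mul_le_mul_of_nonneg_right hn2 hVpos.le
  have hm3 : (h ^ 6 - n) * V ≤ 2 * h ^ 4 * V := mul_le_mul_of_nonneg_right hn3 hVpos.le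
  have hslo : Real.sqrt (V / 2) * h ^ 3 ≤ Real.sqrt (h ^ 2 + n * V) := by
    refine Real.le_sqrt_of_sq_le ?_
    rw [mul_pow, Real.sq_sqrt (by linarith)]
    have : V / 2 * (h ^ 3) ^ 2 = h ^ 6 / 2 * V := by ring
    linarith [sq_nonneg h]
  refine ⟨hslo, ?_, ?_⟩
  · refine Real.sqrt_le_iff.2 ⟨by positivity, ?_⟩
    rw [mul_pow, Real.sq_sqrt (by linarith)]
    have : (1 + V) * (h ^ 3) ^ 2 = h ^ 6 + h ^ 6 * V := by ring
    linarith
  · have hs2 : Real.sqrt (h ^ 2 + n * V) ^ 2 = h ^ 2 + n * V := Real.sq_sqrt (by positivity)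
    have hs0 : 0 ≤ Real.sqrt (h ^ 2 + n * V) := Real.sqrt_nonneg _
    generalize Real.sqrt (h ^ 2 + n * V) = s at hs2 hs0
    obtain ⟨t, ht⟩ : ∃ t, t = h ^ 3 * Real.sqrt V := ⟨_, rfl⟩
    rw [← ht]
    have htpos : 0 < t := by rw [ht]; positivity
    have ht2 : t ^ 2 = h ^ 6 * V := by rw [ht, mul_pow, Real.sq_sqrt hVpos.le]; ring
    have h1 : |s - t| * t ≤ (1 + 2 * V) * h ^ 4 := by
      calc |s - t| * t ≤ |s - t| * (s + t) :=
            mul_le_mul_of_nonneg_left (by linarith) (abs_nonneg _)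
        _ = |s ^ 2 - t ^ 2| := by
            rw [show s ^ 2 - t ^ 2 = (s - t) * (s + t) by ring, abs_mul,
              abs_of_pos (by linarith : 0 < s + t)]
        _ ≤ _ := by
            have e : (1 + 2 * V) * h ^ 4 = h ^ 4 + 2 * h ^ 4 * V := by ring
            have e2 : (h ^ 6 - n) * V = h ^ 6 * V - n * V := by ring
            have e3 : 0 ≤ h ^ 4 * V := by positivity
            rw [hs2, ht2, abs_le, e]
            constructor <;> linarith [sq_nonneg h]
    have h2 : (1 + 2 * V) * h ^ 4 = (1 + 2 * V) / Real.sqrt V * h * t := by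
      rw [ht]; field_simp
    rw [h2] at h1
    exact le_of_mul_le_mul_right h1 htpos

/-- The probability of an interval as a difference of lower tails. -/
lemma sum_mul_ite_Ico {κ : Type*} [Fintype κ] (w S : κ → ℝ) {q₁ q₂ : ℝ} (hqq : q₁ ≤ q₂) :
    ∑ c, w c * (if q₁ ≤ S c ∧ S c < q₂ then 1 else 0)
      = ∑ c, w c * (if S c < q₂ then 1 else 0) - ∑ c, w c * (if S c < q₁ then 1 else 0) := by
  rw [← Finset.sum_sub_distrib]
  refine Finset.sum_congr rfl fun c _ => ?_
  rw [← mul_sub]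
  congr 1
  by_cases ha : S c < q₁
  · rw [if_neg (fun hh => absurd ha (not_lt.2 hh.1)), if_pos (ha.trans_le hqq), if_pos ha]
    norm_num
  · rw [if_neg ha, sub_zero]
    simp only [not_lt.1 ha, true_and]

/-- Thresholds for a distribution function that is approximated by a Gaussian one. -/
lemma quantiles_of_gaussian_approx {F : ℝ → ℝ} {z Δ z₁ s w κ κ' ε : ℝ} (hs : 0 < s) (hw : 0 ≤ w)
    (hupper : ∀ q, F q ≤ Qfun (-(q + w) / s) + κ) (hlower : ∀ q, Qfun (-(q - w) / s) - κ ≤ F q)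
    (hz₁ : Qfun z₁ = ε - κ' - κ)
    (hz : Qfun (z + Δ) ≤ 2 * ε - 2 * κ' - 3 * κ - 2 * w / s) :
    F (-(s * z₁) - w) ≤ ε - κ' ∧
      F (-(s * (z + Δ)) - w) - F (-(s * z₁) - w) ≤ ε - κ' := by
  have hF1 := hupper (-(s * z₁) - w)
  have hF1' := hlower (-(s * z₁) - w)
  have hF2 := hupper (-(s * (z + Δ)) - w)
  have e1 : -(-(s * z₁) - w + w) / s = z₁ := by field_simp; ring
  have e1' : -(-(s * z₁) - w - w) / s = z₁ + 2 * w / s := by field_simp; ring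
  have e2 : -(-(s * (z + Δ)) - w + w) / s = z + Δ := by field_simp; ring
  rw [e1, hz₁] at hF1
  rw [e1'] at hF1'
  rw [e2] at hF2
  have h1 := abs_Qfun_sub_le z₁ (z₁ + 2 * w / s)
  rw [hz₁, add_sub_cancel_left, abs_of_nonneg (by positivity : 0 ≤ 2 * w / s)] at h1
  have h2 := (abs_le.1 h1).1
  exact ⟨by linarith, by linarith⟩

/-- Size of the upper threshold in `quantiles_of_gaussian_approx`. -/
lemma threshold_bounds {V h L s z k σ : ℝ} (hV : 0 < V) (hh : 1 ≤ h) (hL : 1 ≤ L) (hk : 0 ≤ k)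
    (hs0 : 0 ≤ s) (hs : s ≤ σ * h ^ 3)
    (hst : |s - h ^ 3 * Real.sqrt V| ≤ (1 + 2 * V) / Real.sqrt V * h) :
    -(s * (z + k * (L / h))) - h * L ≤ σ * |z| * h ^ 3 ∧
      -(Real.sqrt (h ^ 6 * V) * z)
          - ((1 + 2 * V) / Real.sqrt V * |z| + σ * k + 1) * (h ^ 2 * L)
        ≤ -(s * (z + k * (L / h))) - h * L := by
  have hhpos : 0 < h := by linarith
  have hΔ0 : 0 ≤ k * (L / h) := by positivity
  have hexp : s * (z + k * (L / h)) = s * z + s * (k * (L / h)) := mul_add _ _ _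
  rw [hexp]
  constructor
  · have h1 : s * -|z| ≤ s * z := mul_le_mul_of_nonneg_left (neg_abs_le z) hs0
    have h2 : s * |z| ≤ σ * h ^ 3 * |z| := mul_le_mul_of_nonneg_right hs (abs_nonneg _)
    have h3 : 0 ≤ s * (k * (L / h)) := mul_nonneg hs0 hΔ0
    have h4 : 0 ≤ h * L := by positivity
    linarith
  · have ht : Real.sqrt (h ^ 6 * V) = h ^ 3 * Real.sqrt V := by
      rw [Real.sqrt_mul (by positivity), show h ^ 6 = (h ^ 3) ^ 2 by ring,
        Real.sqrt_sq (by positivity)]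
    rw [ht]
    have hpos : 0 ≤ (1 + 2 * V) / Real.sqrt V := by positivity
    generalize (1 + 2 * V) / Real.sqrt V = A at hst hpos
    generalize h ^ 3 * Real.sqrt V = t at hst
    have hh1 : h ≤ h ^ 2 := le_self_pow₀ hh (by norm_num)
    have hhL : h * L ≤ h ^ 2 * L := mul_le_mul_of_nonneg_right hh1 (by linarith)
    have hh2 : h ≤ h ^ 2 * L := by
      have := mul_le_mul_of_nonneg_left hL hhpos.le
      linarith
    have h1 : (s - t) * z ≤ |s - t| * |z| := by rw [← abs_mul]; exact le_abs_self _
    have h2 : |s - t| * |z| ≤ A * h * |z| := mul_le_mul_of_nonneg_right hst (abs_nonneg _)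
    have h3 : A * |z| * h ≤ A * |z| * (h ^ 2 * L) :=
      mul_le_mul_of_nonneg_left hh2 (by positivity)
    have hsΔ : s * (k * (L / h)) ≤ σ * k * (h ^ 2 * L) := by
      calc s * (k * (L / h)) ≤ σ * h ^ 3 * (k * (L / h)) := mul_le_mul_of_nonneg_right hs hΔ0
        _ = _ := by field_simp
    linarith

/-- Thresholds `q₁, q₂` splitting the event that the sum is small into two parts of probability
slightly less than `ε`. -/
lemma exists_quantiles (p ξ : α → ℝ) (hp : ∀ a, 0 ≤ p a) (hp1 : ∑ a, p a = 1)
    (hmean : ∑ a, p a * ξ a = 0) {B : ℝ} (hB0 : 0 ≤ B) (hB : ∀ a, |ξ a| ≤ B) {V : ℝ}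
    (hV : ∑ a, p a * ξ a ^ 2 = V) (hVpos : 0 < V) {ε : ℝ} (hε0 : 0 < ε) (hε1 : ε < 1 / 2) :
    ∃ Kq K δ : ℝ, 0 ≤ Kq ∧ 0 ≤ K ∧ 0 < δ ∧ ∀ (n : ℕ) (h L κ' : ℝ), 1 ≤ h → 1 ≤ L → L ≤ δ * h →
      Real.exp (-L) ≤ 1 / h → h ^ 6 / 2 ≤ n → (n : ℝ) ≤ h ^ 6 → h ^ 6 - n ≤ 2 * h ^ 4 →
      0 ≤ κ' → κ' ≤ 11 / h →
      ∃ q₁ q₂ : ℝ,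
        ∑ c : Fin n → α, (∏ i, p (c i)) * (if ∑ i, ξ (c i) < q₁ then 1 else 0) ≤ ε - κ' ∧
        ∑ c : Fin n → α, (∏ i, p (c i)) *
          (if q₁ ≤ ∑ i, ξ (c i) ∧ ∑ i, ξ (c i) < q₂ then 1 else 0) ≤ ε - κ' ∧
        q₂ ≤ Kq * h ^ 3 ∧ -(Real.sqrt (h ^ 6 * V) * Qinv (2 * ε)) - K * (h ^ 2 * L) ≤ q₂ := by
  set z := Qinv (2 * ε) with hz
  have hQz : Qfun z = 2 * ε := Qfun_Qinv (by linarith) (by linarith)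
  obtain ⟨c, hc, hcQ⟩ := exists_Qfun_add_le z
  set KB := (B + B ^ 2) * ((1 + B) * (2 + B)) with hKB
  have hKB0 : 0 ≤ KB := by positivity
  set σ₀ := Real.sqrt (V / 2) with hσ₀
  have hσ₀pos : 0 < σ₀ := Real.sqrt_pos.2 (by linarith)
  have hsV : 0 < Real.sqrt V := Real.sqrt_pos.2 hVpos
  set KΔ := (3 * (KB + 1) + 22 + 2 / σ₀) / c with hKΔ
  have hKΔ0 : 0 < KΔ := by positivity
  have hKΔc : c * KΔ = 3 * (KB + 1) + 22 + 2 / σ₀ := by rw [hKΔ]; field_simp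
  refine ⟨Real.sqrt (1 + V) * |z|, (1 + 2 * V) / Real.sqrt V * |z| + Real.sqrt (1 + V) * KΔ + 1,
    min (1 / KΔ) (ε / (2 * (KB + 12))), by positivity, by positivity,
    lt_min (by positivity) (by positivity), ?_⟩
  intro n h L κ' hh hL hLδ hexp hn1 hn2 hn3 hκ0 hκ1
  have hhpos : 0 < h := by linarith
  have hLh1 : KΔ * (L / h) ≤ 1 := by
    have h1 : L ≤ 1 / KΔ * h := hLδ.trans (mul_le_mul_of_nonneg_right (min_le_left _ _) hhpos.le)
    have h2 : L / h ≤ 1 / KΔ := (div_le_iff₀ hhpos).2 h1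
    calc KΔ * (L / h) ≤ KΔ * (1 / KΔ) := mul_le_mul_of_nonneg_left h2 hKΔ0.le
      _ = 1 := by field_simp
  have hLh2 : (KB + 12) * (L / h) ≤ ε / 2 := by
    have h1 : L ≤ ε / (2 * (KB + 12)) * h :=
      hLδ.trans (mul_le_mul_of_nonneg_right (min_le_right _ _) hhpos.le)
    have h2 : L / h ≤ ε / (2 * (KB + 12)) := (div_le_iff₀ hhpos).2 h1
    calc (KB + 12) * (L / h) ≤ (KB + 12) * (ε / (2 * (KB + 12))) :=
          mul_le_mul_of_nonneg_left h2 (by linarith)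
      _ = ε / 2 := by field_simp
  have hinv : 1 / h ≤ L / h := div_le_div_of_nonneg_right hL hhpos.le
  have hLh0 : 0 < L / h := by positivity
  set κ := KB / h + Real.exp (-L) with hκ
  have hκpos : 0 < κ := add_pos_of_nonneg_of_pos (by positivity) (Real.exp_pos _)
  have hκle : κ ≤ (KB + 1) * (1 / h) := by
    have : KB / h = KB * (1 / h) := by ring
    rw [hκ, this]; linarith
  have hκ'le : κ' ≤ 11 * (1 / h) := by
    have : 11 / h = 11 * (1 / h) := by ring
    linarith
  have hκle' : κ ≤ (KB + 1) * (L / h) :=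
    hκle.trans (mul_le_mul_of_nonneg_left hinv (by linarith))
  have hκ'le' : κ' ≤ 11 * (L / h) := by linarith
  have hsum : κ' + κ ≤ ε / 2 := by linarith
  obtain ⟨z₁, hz₁⟩ := exists_Qfun_eq (p := ε - κ' - κ) (by linarith) (by linarith)
  set s := Real.sqrt (h ^ 2 + n * V) with hs
  obtain ⟨hslo, hshi, hst⟩ := sqrt_add_mul_bounds hVpos hh hn1 hn2 hn3
  rw [← hs] at hslo hshi hst
  rw [← hσ₀] at hslo
  have hspos : 0 < s := lt_of_lt_of_le (by positivity) hslo
  have hdw : 2 * (h * L) / s ≤ 2 / σ₀ * (L / h) := by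
    rw [div_le_iff₀ hspos]
    have h1 : 2 / σ₀ * (L / h) * (σ₀ * h ^ 3) = 2 * (h ^ 2 * L) := by field_simp
    have h2 := mul_le_mul_of_nonneg_left hslo (by positivity : 0 ≤ 2 / σ₀ * (L / h))
    have h3 : h * L ≤ h ^ 2 * L :=
      mul_le_mul_of_nonneg_right (le_self_pow₀ hh (by norm_num)) (by linarith)
    linarith
  have hz2 : Qfun (z + KΔ * (L / h)) ≤ 2 * ε - 2 * κ' - 3 * κ - 2 * (h * L) / s := by
    have h1 := hcQ (KΔ * (L / h)) (by positivity) hLh1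
    rw [hQz, ← mul_assoc, hKΔc] at h1
    linarith
  have clt := clt_iid p ξ hp hp1 hmean hB0 hB hV hh n
  have hq := quantiles_of_gaussian_approx
    (F := fun q => ∑ c : Fin n → α, (∏ i, p (c i)) * (if ∑ i, ξ (c i) < q then 1 else 0))
    (s := s) (w := h * L) (κ := κ) (κ' := κ') hspos (by positivity)
    (fun q => (clt q L).1) (fun q => (clt q L).2) hz₁ hz2
  obtain ⟨hb1, hb2⟩ := threshold_bounds (z := z) hVpos hh hL hKΔ0.le
    hspos.le hshi hst
  refine ⟨_, _, hq.1, ?_, hb1, by linarith⟩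
  by_cases hqq : -(s * z₁) - h * L ≤ -(s * (z + KΔ * (L / h))) - h * L
  · rw [sum_mul_ite_Ico _ _ hqq]
    exact hq.2
  · rw [Finset.sum_eq_zero fun c _ => by
      rw [if_neg (fun hh => hqq (hh.1.trans hh.2.le)), mul_zero]]
    linarith

end Selection

section Assembly

lemma sum_mul_ite_or_le {κ : Type*} [Fintype κ] {w : κ → ℝ} (hw : ∀ c, 0 ≤ w c)
    {A B E : κ → Prop} {_ : ∀ c, Decidable (A c)} {_ : ∀ c, Decidable (B c)}
    {_ : ∀ c, Decidable (E c)} {_ : ∀ c, Decidable (A c ∨ B c ∨ E c)} {x y z : ℝ}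
    (hA : ∑ c, w c * (if A c then 1 else 0) ≤ x) (hB : ∑ c, w c * (if B c then 1 else 0) ≤ y)
    (hE : ∑ c, w c * (if E c then 1 else 0) ≤ z) :
    ∑ c, w c * (if A c ∨ B c ∨ E c then 1 else 0) ≤ x + y + z := by
  refine le_trans ?_ (add_le_add (add_le_add hA hB) hE)
  rw [← Finset.sum_add_distrib, ← Finset.sum_add_distrib]
  refine Finset.sum_le_sum fun c _ => ?_
  rw [← mul_add, ← mul_add]
  refine mul_le_mul_of_nonneg_left ?_ (hw c)
  by_cases hA : A c
  · rw [if_pos (Or.inl hA), if_pos hA]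
    split_ifs <;> norm_num
  by_cases hB : B c
  · rw [if_pos (Or.inr (Or.inl hB)), if_pos hB]
    split_ifs <;> norm_num
  by_cases hE : E c
  · rw [if_pos (Or.inr (Or.inr hE)), if_pos hE]
    split_ifs
    norm_num
  · rw [if_neg (by tauto)]
    split_ifs
    norm_num

/-- The parameters of the second phase, for time scale `h⁴` and deviations of order `h³r`. -/
lemma second_phase_parameters {h r L m T B c t₀ δ : ℝ} (hh : 1 ≤ h) (hr : 1 ≤ r) (hrL : r ^ 2 = L)
    (hLδ : L ≤ δ * h) (hT : 0 < T) (hB : 0 ≤ B) (hc : 0 ≤ c) (hδT : δ * (2 * T) ≤ 1)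
    (hδt : δ * T ≤ t₀) (hδB : δ * B ≤ 1) (hm1 : h ^ 4 ≤ m) (hm2 : m ≤ 2 * h ^ 4) :
    T * r / h ≤ t₀ ∧ T * (h ^ 3 * r) ≤ m * (T * r / h) ∧ m * (T * r / h) ≤ h ^ 6 ∧
      r / h ^ 2 * B ≤ 1 ∧
      -(r / h ^ 2 * ((2 * B ^ 2 + 1) * (h ^ 2 * r))) + m * (r / h ^ 2 * B) ^ 2 ≤ -L ∧
      m * (c * (T * r / h) ^ 2) + (2 * B ^ 2 + 1) * (h ^ 2 * r)
        ≤ (2 * c * T ^ 2 + 2 * B ^ 2 + 1) * (h ^ 2 * L) := by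
  have hh0 : 0 < h := by linarith
  have hr0 : 0 < r := by linarith
  have hrL' : r ≤ L := by rw [← hrL]; exact le_self_pow₀ hr (by norm_num)
  have hrδ : r ≤ δ * h := hrL'.trans hLδ
  have hTr : T * r / h ≤ δ * T := by
    rw [div_le_iff₀ hh0]
    linarith [mul_le_mul_of_nonneg_left hrδ hT.le]
  have hTr0 : 0 ≤ T * r / h := by positivity
  refine ⟨hTr.trans hδt, ?_, ?_, ?_, ?_, ?_⟩
  · have e : T * (h ^ 3 * r) = h ^ 4 * (T * r / h) := by field_simp
    rw [e]
    exact mul_le_mul_of_nonneg_right hm1 hTr0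
  · have h1 : m * (T * r / h) ≤ 2 * h ^ 4 * (δ * T) :=
      mul_le_mul hm2 hTr hTr0 (by positivity)
    have h2 : h ^ 4 * (δ * (2 * T)) ≤ h ^ 4 * 1 := mul_le_mul_of_nonneg_left hδT (by positivity)
    have h3 : h ^ 4 ≤ h ^ 6 := pow_le_pow_right₀ hh (by norm_num)
    linarith
  · have h1 : r * B ≤ h := by
      have h1 := mul_le_mul_of_nonneg_right hrδ hB
      have h2 := mul_le_mul_of_nonneg_right hδB hh0.le
      linarith
    have h2 : h ≤ h ^ 2 := le_self_pow₀ hh (by norm_num)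
    rw [div_mul_eq_mul_div, div_le_one (by positivity)]
    linarith
  · have h1 : m * (r / h ^ 2 * B) ^ 2 ≤ 2 * h ^ 4 * (r / h ^ 2 * B) ^ 2 :=
      mul_le_mul_of_nonneg_right hm2 (sq_nonneg _)
    have h2 : 2 * h ^ 4 * (r / h ^ 2 * B) ^ 2 = 2 * B ^ 2 * r ^ 2 := by field_simp
    have h3 : r / h ^ 2 * ((2 * B ^ 2 + 1) * (h ^ 2 * r)) = (2 * B ^ 2 + 1) * r ^ 2 := by
      field_simp
    rw [h3, ← hrL]
    linarith
  · have h1 : m * (c * (T * r / h) ^ 2) ≤ 2 * h ^ 4 * (c * (T * r / h) ^ 2) :=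
      mul_le_mul_of_nonneg_right hm2 (by positivity)
    have h2 : 2 * h ^ 4 * (c * (T * r / h) ^ 2) = 2 * c * T ^ 2 * (h ^ 2 * r ^ 2) := by field_simp
    have h3 : (2 * B ^ 2 + 1) * (h ^ 2 * r) ≤ (2 * B ^ 2 + 1) * (h ^ 2 * L) := by gcongr
    rw [h2, hrL] at h1
    linarith

/-- Under the weighted law, the sum and the difference of the two information densities are
centred and bounded. -/
lemma jointLaw_deviations {W1 W2 : 𝒳 → 𝒴 → ℝ} (hs1 : ∀ x, ∑ y, W1 x y = 1)
    (hs2 : ∀ x, ∑ y, W2 x y = 1) {P : 𝒳 → ℝ} (hP1 : ∑ x, P x = 1) {C η : ℝ} (hη0 : 0 < η)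
    (hη1 : η < 1) (hI1 : mutInfo P W1 = C) (hI2 : mutInfo P W2 = C) :
    ∑ t, jointLaw W1 W2 P t * (η * infoDens P W1 t.1 t.2.1 + (1 - η) * infoDens P W2 t.1 t.2.2 - C)
        = 0 ∧
      ∑ t, jointLaw W1 W2 P t * (infoDens P W1 t.1 t.2.1 - infoDens P W2 t.1 t.2.2) = 0 ∧
      ∃ B : ℝ, 0 ≤ B ∧
        (∀ t : 𝒳 × 𝒴 × 𝒴,
          |η * infoDens P W1 t.1 t.2.1 + (1 - η) * infoDens P W2 t.1 t.2.2 - C| ≤ B) ∧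
        ∀ t : 𝒳 × 𝒴 × 𝒴, |infoDens P W1 t.1 t.2.1 - infoDens P W2 t.1 t.2.2| ≤ B := by
  have h1 := sum_jointLaw_infoDens (W1 := W1) (W2 := W2) (W := W1) (sel := Prod.fst)
    (sum_fst_marginal hs2) P
  have h2 := sum_jointLaw_infoDens (W1 := W1) (W2 := W2) (W := W2) (sel := Prod.snd)
    (sum_snd_marginal hs1) P
  rw [hI1] at h1
  rw [hI2] at h2
  have h0 := sum_jointLaw hs1 hs2 hP1
  refine ⟨?_, ?_, ?_⟩
  · calc _ = η * ∑ t, jointLaw W1 W2 P t * infoDens P W1 t.1 t.2.1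
          + (1 - η) * ∑ t, jointLaw W1 W2 P t * infoDens P W2 t.1 t.2.2
          - (∑ t, jointLaw W1 W2 P t) * C := by
          rw [Finset.mul_sum, Finset.mul_sum, Finset.sum_mul, ← Finset.sum_add_distrib,
            ← Finset.sum_sub_distrib]
          exact Finset.sum_congr rfl fun t _ => by ring
      _ = 0 := by rw [h1, h2, h0]; ring
  · simp only [mul_sub, Finset.sum_sub_distrib]
    rw [h1, h2, sub_self]
  · obtain ⟨b₁, hb₁, hB₁⟩ := exists_abs_infoDens_le P W1
    obtain ⟨b₂, hb₂, hB₂⟩ := exists_abs_infoDens_le P W2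
    refine ⟨b₁ + b₂ + |C|, by positivity, fun t => ?_, fun t => ?_⟩
    · have e1 : |η * infoDens P W1 t.1 t.2.1| ≤ b₁ := by
        rw [abs_mul, abs_of_pos hη0]
        exact (mul_le_of_le_one_left (abs_nonneg _) hη1.le).trans (hB₁ _ _)
      have e2 : |(1 - η) * infoDens P W2 t.1 t.2.2| ≤ b₂ := by
        rw [abs_mul, abs_of_pos (by linarith)]
        exact (mul_le_of_le_one_left (abs_nonneg _) (by linarith)).trans (hB₂ _ _)
      exact (abs_sub _ _).trans (add_le_add ((abs_add_le _ _).trans (add_le_add e1 e2)) le_rfl)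
    · have := (abs_sub (infoDens P W1 t.1 t.2.1) (infoDens P W2 t.1 t.2.2)).trans
        (add_le_add (hB₁ _ _) (hB₂ _ _))
      linarith [abs_nonneg C]

end Assembly

section Core

/-- Split a block length `n = h⁶` into a long first and a short second phase. -/
lemma exists_phase_lengths {n : ℕ} {h : ℝ} (hn : h ^ 6 = n) (hh : 2 ≤ h) :
    ∃ k m : ℕ, n = k + m ∧ h ^ 4 ≤ (m : ℝ) ∧ (m : ℝ) ≤ 2 * h ^ 4 ∧ h ^ 6 / 2 ≤ (k : ℝ) ∧
      (k : ℝ) ≤ h ^ 6 ∧ h ^ 6 - k ≤ 2 * h ^ 4 := by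
  have h4 : 1 ≤ h ^ 4 := one_le_pow₀ (by linarith)
  have hm1 : h ^ 4 ≤ (⌈h ^ 4⌉₊ : ℝ) := Nat.le_ceil _
  have hm2 : (⌈h ^ 4⌉₊ : ℝ) < h ^ 4 + 1 := Nat.ceil_lt_add_one (by positivity)
  have h46 : 4 * h ^ 4 ≤ h ^ 6 := by
    have h2 : (2 : ℝ) ^ 2 ≤ h ^ 2 := pow_le_pow_left₀ (by norm_num) hh 2
    have := mul_le_mul_of_nonneg_right h2 (by positivity : 0 ≤ h ^ 4)
    linarith [(by ring : h ^ 6 = h ^ 2 * h ^ 4)]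
  have hmn : ⌈h ^ 4⌉₊ ≤ n := by
    have : (⌈h ^ 4⌉₊ : ℝ) ≤ n := by linarith
    exact_mod_cast this
  obtain ⟨k, hk⟩ := Nat.exists_eq_add_of_le' hmn
  have hk' : (n : ℝ) = k + ⌈h ^ 4⌉₊ := by exact_mod_cast hk
  exact ⟨k, ⌈h ^ 4⌉₊, hk, hm1, by linarith, by linarith, by linarith, by linarith⟩

lemma rounding_error_le {h : ℝ} (hh : 1 ≤ h) :
    5 / h ^ 6 + (Real.sqrt (4 / h ^ 6) + 4 / h ^ 6) ≤ 11 / h := by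
  have hh0 : 0 < h := by linarith
  have e : Real.sqrt (4 / h ^ 6) = 2 / h ^ 3 := by
    rw [show 4 / h ^ 6 = (2 / h ^ 3) ^ 2 by ring, Real.sqrt_sq (by positivity)]
  have h1 : 1 / h ^ 6 ≤ 1 / h :=
    one_div_le_one_div_of_le hh0 (le_self_pow₀ hh (by norm_num))
  have h2 : 1 / h ^ 3 ≤ 1 / h :=
    one_div_le_one_div_of_le hh0 (le_self_pow₀ hh (by norm_num))
  rw [e, div_eq_mul_one_div 5, div_eq_mul_one_div 4, div_eq_mul_one_div 2, div_eq_mul_one_div 11]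
  linarith

/-- The information accumulated over both phases. -/
lemma accumulated_info_bound {k m C S D e x θ c a b q I J : ℝ} (hm : 0 ≤ m) (hc : 0 ≤ c)
    (hx : |x| ≤ 1) (hI : C + e * (θ * x) - c * (θ * x) ^ 2 ≤ I)
    (hJ : J = k * C + S + e * D) (hq : q - 1 ≤ S + e * (D + m * θ * x))
    (hloss : m * (c * θ ^ 2) + a ≤ b) : (k + m) * C + q - 1 - b ≤ J + m * I - a := by
  have hx2 : x ^ 2 ≤ 1 := (sq_le_one_iff_abs_le_one x).2 hx
  have h1 : m * (C + e * (θ * x) - c * (θ * x) ^ 2) ≤ m * I := mul_le_mul_of_nonneg_left hI hm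
  have h2 : m * (c * θ ^ 2) * x ^ 2 ≤ m * (c * θ ^ 2) * 1 :=
    mul_le_mul_of_nonneg_left hx2 (by positivity)
  rw [hJ]
  linarith

open scoped Classical in
/-- Two-phase codes for a block length `n = h⁶`, with `L = log n`. -/
lemma exists_flf_code {W1 W2 : 𝒳 → 𝒴 → ℝ} (hW1 : ∀ x y, 0 ≤ W1 x y)
    (hs1 : ∀ x, ∑ y, W1 x y = 1) (hW2 : ∀ x y, 0 ≤ W2 x y) (hs2 : ∀ x, ∑ y, W2 x y = 1)
    {P : 𝒳 → ℝ} (hP : ∀ x, 0 < P x) (hP1 : ∑ x, P x = 1) {C η : ℝ} (hη0 : 0 < η) (hη1 : η < 1)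
    (hη : ∀ v : 𝒳 → ℝ, ∑ x, v x = 0 → η * gradI P W1 v + (1 - η) * gradI P W2 v = 0)
    (hI1 : mutInfo P W1 = C) (hI2 : mutInfo P W2 = C) {R : 𝒳 → ℝ} (hR : IsDist R)
    (hRC : C < mutInfo R W1) {V : ℝ}
    (hV : V = η ^ 2 * condInfoVar P W1 + (1 - η) ^ 2 * condInfoVar P W2) (hVpos : 0 < V)
    {ε : ℝ} (hε0 : 0 < ε) (hε1 : ε < 1 / 2) :
    ∃ K δ : ℝ, 0 ≤ K ∧ 0 < δ ∧ ∀ (n : ℕ) (h L : ℝ), h ^ 6 = n → Real.exp L = n → 2 ≤ h →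
      1 ≤ L → L ≤ δ * h →
      ∃ γ : ℝ, n * C - Real.sqrt (n * V) * Qinv (2 * ε) - K * (h ^ 2 * L) ≤ γ ∧
        ∀ M : ℕ, 0 < M → 2 * (M * ((2 * n + 1) * Real.exp (-γ))) + 2 / (M : ℝ) ≤ 4 / (n : ℝ) →
          FLFExists W1 W2 n M ε := by
  have hη1' : 0 < 1 - η := by linarith
  have hp := jointLaw_nonneg hW1 hW2 fun x => (hP x).le
  have hp1 := sum_jointLaw hs1 hs2 hP1
  obtain ⟨hmS, hmD, B₁, hB₁, hbS, hbD⟩ := jointLaw_deviations hs1 hs2 hP1 hη0 hη1 hI1 hI2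
  have hvar := sum_jointLaw_weighted_sq hs1 hs2 (weighted_relEnt_eq hP1 hI1 hI2 hη)
  rw [← hV] at hvar
  obtain ⟨ξS, hξS⟩ : ∃ ξ : 𝒳 × 𝒴 × 𝒴 → ℝ, ∀ t, ξ t =
    η * infoDens P W1 t.1 t.2.1 + (1 - η) * infoDens P W2 t.1 t.2.2 - C := ⟨_, fun _ => rfl⟩
  obtain ⟨ξD, hξD⟩ : ∃ ξ : 𝒳 × 𝒴 × 𝒴 → ℝ, ∀ t, ξ t =
    infoDens P W1 t.1 t.2.1 - infoDens P W2 t.1 t.2.2 := ⟨_, fun _ => rfl⟩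
  simp only [← hξS] at hmS hbS hvar
  simp only [← hξD] at hmD hbD
  obtain ⟨v, t₀, c, B, ht₀, hc, hB, htrade⟩ :=
    exists_trade_direction hW1 hs1 hW2 hs2 hP hP1 hη0 hη1 hη hI1 hI2 hR hRC
  obtain ⟨Kq, K, δq, hKq, hK, hδq, hquant⟩ :=
    exists_quantiles (jointLaw W1 W2 P) ξS hp hp1 hmS hB₁ hbS hvar hVpos hε0 hε1
  obtain ⟨T, hTdef⟩ : ∃ T, T = (B₁ ^ 2 + 1) + (B₁ ^ 2 + 1 + Kq) / η
      + (B₁ ^ 2 + 1 + Kq) / (1 - η) := ⟨_, rfl⟩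
  have hq1 : 0 ≤ (B₁ ^ 2 + 1 + Kq) / η := by positivity
  have hq2 : 0 ≤ (B₁ ^ 2 + 1 + Kq) / (1 - η) := by positivity
  have hT : 0 < T := by rw [hTdef]; positivity
  have hTb : B₁ ^ 2 + 1 ≤ T := by linarith
  have hT1 : Kq ≤ -(B₁ ^ 2 + 1) + η * (T - (B₁ ^ 2 + 1)) := by
    have h1 : η * ((B₁ ^ 2 + 1 + Kq) / η) = B₁ ^ 2 + 1 + Kq := by field_simp
    have h2 := mul_nonneg hη0.le hq2
    rw [hTdef]; linarith
  have hT2 : Kq ≤ -(B₁ ^ 2 + 1) + (1 - η) * (T - (B₁ ^ 2 + 1)) := by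
    have h1 : (1 - η) * ((B₁ ^ 2 + 1 + Kq) / (1 - η)) = B₁ ^ 2 + 1 + Kq := by field_simp
    have h2 := mul_nonneg hη1'.le hq1
    rw [hTdef]; linarith
  clear hTdef hq1 hq2
  obtain ⟨δ, hδ, hδ1, hδ2, hδ3, hδ4, hδ5⟩ : ∃ δ : ℝ, 0 < δ ∧ δ ≤ δq ∧ δ * (2 * T) ≤ 1 ∧
      δ * T ≤ t₀ ∧ δ * B ≤ 1 ∧ δ * B₁ ≤ 1 := by
    refine ⟨min δq (min (1 / (2 * T)) (min (t₀ / T) (min (1 / (B + 1)) (1 / (B₁ + 1))))),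
      by positivity, min_le_left _ _, ?_, ?_, ?_, ?_⟩
    · rw [← le_div_iff₀ (by positivity)]
      exact (min_le_right _ _).trans (min_le_left _ _)
    · rw [← le_div_iff₀ (by positivity)]
      exact ((min_le_right _ _).trans (min_le_right _ _)).trans (min_le_left _ _)
    · refine (mul_le_mul_of_nonneg_left (by linarith : B ≤ B + 1) (by positivity)).trans ?_
      rw [← le_div_iff₀ (by positivity)]
      exact (((min_le_right _ _).trans (min_le_right _ _)).trans (min_le_right _ _)).trans
        (min_le_left _ _)
    · refine (mul_le_mul_of_nonneg_left (by linarith : B₁ ≤ B₁ + 1) (by positivity)).trans ?_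
      rw [← le_div_iff₀ (by positivity)]
      exact (((min_le_right _ _).trans (min_le_right _ _)).trans (min_le_right _ _)).trans
        (min_le_right _ _)
  refine ⟨K + 1 + (2 * c * T ^ 2 + 2 * B ^ 2 + 1), δ, by positivity, hδ, ?_⟩
  intro n h L hn hL hh hL1 hLδ
  have hh1 : 1 ≤ h := by linarith
  have hh0 : 0 < h := by linarith
  obtain ⟨k, m, hkm, hm1, hm2, hk1, hk2, hk3⟩ := exists_phase_lengths hn hh
  obtain ⟨r, hr, hrL⟩ : ∃ r : ℝ, 1 ≤ r ∧ r ^ 2 = L :=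
    ⟨Real.sqrt L, Real.one_le_sqrt.2 hL1, Real.sq_sqrt (by linarith)⟩
  have hr0 : 0 ≤ r := by linarith
  have hnL : Real.exp (-L) = 1 / (n : ℝ) := by rw [Real.exp_neg, hL, one_div]
  have hn0 : 0 < (n : ℝ) := by rw [← hn]; positivity
  have hexp : Real.exp (-L) ≤ 1 / h := by
    rw [hnL, ← hn]
    exact one_div_le_one_div_of_le hh0 (le_self_pow₀ hh1 (by norm_num))
  obtain ⟨hθt, hub, hun, hlB, hchern, hloss⟩ := second_phase_parameters hh1 hr hrL hLδ hT hB hc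
    hδ2 hδ3 hδ4 hm1 hm2
  obtain ⟨κ', hκ'⟩ : ∃ κ', κ' = 5 / (n : ℝ) + (Real.sqrt (4 / (n : ℝ)) + 4 / (n : ℝ)) := ⟨_, rfl⟩
  have hκ0 : 0 ≤ κ' := by rw [hκ']; positivity
  have hκ1 : κ' ≤ 11 / h := by rw [hκ', ← hn]; exact rounding_error_le hh1
  obtain ⟨q₁, q₂, hq₁, hq₂, hq₂hi, hq₂lo⟩ := hquant k h L κ' hh1 hL1
    (hLδ.trans (mul_le_mul_of_nonneg_right hδ1 hh0.le)) hexp hk1 hk2 hk3 hκ0 hκ1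
  obtain ⟨θ, hθ⟩ : ∃ θ, θ = T * r / h := ⟨_, rfl⟩
  rw [← hθ] at hθt hub hun hloss
  have hθ0 : 0 < θ := by rw [hθ]; positivity
  obtain ⟨A, hA⟩ : ∃ A, A = B₁ ^ 2 + 1 := ⟨_, rfl⟩
  have hA0 : 0 ≤ A := by rw [hA]; positivity
  obtain ⟨b, hb⟩ : ∃ b, b = A * (h ^ 3 * r) := ⟨_, rfl⟩
  have hrB : r * B₁ ≤ h ^ 3 := by
    have h1 : r ≤ δ * h := le_trans (by rw [← hrL]; exact le_self_pow₀ hr (by norm_num)) hLδ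
    have h2 := mul_le_mul_of_nonneg_right h1 hB₁
    have h3 := mul_le_mul_of_nonneg_right hδ5 hh0.le
    have h4 : h ≤ h ^ 3 := le_self_pow₀ hh1 (by norm_num)
    linarith
  have hdevS := sum_iid_abs_dev_le (jointLaw W1 W2 P) ξS hp hp1 hmS hbS hh0 hr0 hk2 hrB
  have hdevD := sum_iid_abs_dev_le (jointLaw W1 W2 P) ξD hp hp1 hmD hbD hh0 hr0 hk2 hrB
  rw [hrL, hnL, ← hA, ← hb] at hdevS hdevD
  rw [← hA] at hTb hT1 hT2
  have hhr : 0 ≤ h ^ 3 * r := by positivity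
  have hKqr : q₂ ≤ Kq * (h ^ 3 * r) := by
    refine hq₂hi.trans (mul_le_mul_of_nonneg_left ?_ hKq)
    exact le_mul_of_one_le_right (by positivity) hr
  have hbu : b ≤ m * θ := by
    rw [hb]; exact (mul_le_mul_of_nonneg_right hTb hhr).trans hub
  have hmode : ∀ e : ℝ, 0 < e → Kq ≤ -A + e * (T - A) → q₂ ≤ -b + e * (m * θ - b) := by
    intro e he hKe
    have h1 := mul_le_mul_of_nonneg_right hKe hhr
    have h2 := mul_le_mul_of_nonneg_left hub he.le
    rw [hb]; linarith
  have hmpos : 0 < (m : ℝ) := lt_of_lt_of_le (by positivity) hm1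
  choose σ hσ using exists_mode (q₁ := q₁) hη0 hη1 (mul_pos hmpos hθ0) hbu (hun.trans_eq hn)
    (hmode _ hη1' hT2) (hmode _ hη0 hT1)
  have hx : ∀ s : Fin (2 * n + 1), |(((s : ℕ) - n : ℝ) / n)| ≤ 1 := by
    intro s
    have h1 : ((s : ℕ) : ℝ) ≤ 2 * n := by exact_mod_cast Nat.lt_succ_iff.1 s.2
    have h2 : (0 : ℝ) ≤ (s : ℕ) := Nat.cast_nonneg _
    rw [abs_div, abs_of_pos hn0, div_le_one hn0, abs_le]
    constructor <;> linarith
  have hmix := fun s : Fin (2 * n + 1) => htrade (θ * (((s : ℕ) - n : ℝ) / n)) (by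
    rw [abs_mul, abs_of_pos hθ0]
    exact (mul_le_of_le_one_right hθ0.le (hx s)).trans hθt)
  have hsum1 : ∀ z : Fin k → 𝒳 × 𝒴 × 𝒴, ∑ i, infoDens P W1 (z i).1 (z i).2.1
      = k * C + ∑ i, ξS (z i) + (1 - η) * ∑ i, ξD (z i) := by
    intro z
    rw [Finset.mul_sum, add_assoc, ← Finset.sum_add_distrib]
    have : (k : ℝ) * C = ∑ _i : Fin k, C := by simp
    rw [this, ← Finset.sum_add_distrib]
    exact Finset.sum_congr rfl fun i _ => by rw [hξS, hξD]; ring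
  have hsum2 : ∀ z : Fin k → 𝒳 × 𝒴 × 𝒴, ∑ i, infoDens P W2 (z i).1 (z i).2.2
      = k * C + ∑ i, ξS (z i) + (-η) * ∑ i, ξD (z i) := by
    intro z
    rw [Finset.mul_sum, add_assoc, ← Finset.sum_add_distrib]
    have : (k : ℝ) * C = ∑ _i : Fin k, C := by simp
    rw [this, ← Finset.sum_add_distrib]
    exact Finset.sum_congr rfl fun i _ => by rw [hξS, hξD]; ring
  have hnkm : (n : ℝ) = k + m := by exact_mod_cast hkm
  have hw : ∀ z : Fin k → 𝒳 × 𝒴 × 𝒴, 0 ≤ ∏ i, jointLaw W1 W2 P (z i) :=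
    fun z => Finset.prod_nonneg fun _ _ => hp _
  refine ⟨n * C + q₂ - 1 - (2 * c * T ^ 2 + 2 * B ^ 2 + 1) * (h ^ 2 * L), ?_, fun M hM hζ => ?_⟩
  · rw [hn] at hq₂lo
    have : 1 ≤ h ^ 2 * L := one_le_mul_of_one_le_of_one_le (one_le_pow₀ hh1) hL1
    linarith
  have hchern' := Real.exp_le_exp.2 hchern
  rw [hnL] at hchern'
  have h5 : 5 / (n : ℝ) = 5 * (1 / (n : ℝ)) := by ring
  rw [hkm]
  refine flfExists_of_two_phase hW1 hW2 hs1 hs2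
    (Q := fun (s : Fin (2 * n + 1)) x => P x + θ * (((s : ℕ) - n : ℝ) / n) * v x)
    hP (fun s => (hmix s).1) hP1 (fun s => (hmix s).2.1)
    (fun z => σ (∑ i, ξS (z i)) (∑ i, ξD (z i)))
    (bad1 := fun z => b < |∑ i, ξS (z i)| ∨ b < |∑ i, ξD (z i)| ∨
      (q₁ ≤ ∑ i, ξS (z i) ∧ ∑ i, ξS (z i) < q₂))
    (bad2 := fun z => b < |∑ i, ξS (z i)| ∨ b < |∑ i, ξD (z i)| ∨ ∑ i, ξS (z i) < q₁)
    (a := (2 * B ^ 2 + 1) * (h ^ 2 * r)) (l := r / h ^ 2) ?_ ?_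
    (fun s => (hmix s).2.2.2.2.1) (fun s => (hmix s).2.2.2.2.2) (by positivity) hlB hM
    (ζ := 4 / (n : ℝ)) (by rw [Fintype.card_fin]; push_cast; exact hζ) ?_ ?_
  · intro z hz
    rw [not_or, not_or, not_lt, not_lt] at hz
    have hq := (hσ _ _ hz.2.1 hz.1).1 hz.2.2
    generalize σ (∑ i, ξS (z i)) (∑ i, ξD (z i)) = s at hq ⊢
    have := accumulated_info_bound hmpos.le hc (hx s) (hmix s).2.2.1 (hsum1 z) hq hloss
    rwa [← hnkm] at this
  · intro z hz
    rw [not_or, not_or, not_lt, not_lt] at hz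
    have hq := (hσ _ _ hz.2.1 hz.1).2 hz.2.2
    generalize σ (∑ i, ξS (z i)) (∑ i, ξD (z i)) = s at hq ⊢
    have hI := (hmix s).2.2.2.1
    rw [sub_eq_add_neg C, ← neg_mul] at hI
    rw [sub_eq_add_neg (∑ i, ξS (z i)), ← neg_mul] at hq
    have := accumulated_info_bound hmpos.le hc (hx s) hI (hsum2 z) hq hloss
    rwa [← hnkm] at this
  · refine (add_le_add_left (add_le_add (sum_mul_ite_or_le hw hdevS hdevD hq₂) hchern') _).trans ?_
    linarith
  · refine (add_le_add_left (add_le_add (sum_mul_ite_or_le hw hdevS hdevD hq₁) hchern') _).trans ?_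
    linarith

end Core

section Asymptotics

/-- A code size whose logarithm exceeds a prescribed rate, with vanishing union bound. -/
lemma exists_codeSize {n : ℕ} {L γ : ℝ} (hL : Real.exp L = n) (hL1 : 1 ≤ L)
    (hγ : 5 * L ≤ γ) :
    ∃ M : ℕ, 0 < M ∧ γ - 4 * L ≤ Real.log M ∧
      2 * (M * ((2 * n + 1) * Real.exp (-γ))) + 2 / (M : ℝ) ≤ 4 / (n : ℝ) := by
  have hn : (5 / 2 : ℝ) ≤ n := by
    rw [← hL]
    linarith [Real.exp_one_gt_d9, Real.exp_le_exp.2 hL1]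
  have hn0 : (0 : ℝ) < n := by linarith
  have hM := Nat.le_ceil (Real.exp (γ - 4 * L))
  have hM2 := (Nat.ceil_lt_add_one (Real.exp_nonneg (γ - 4 * L))).le
  have hnM : (n : ℝ) ≤ Real.exp (γ - 4 * L) := by
    rw [← hL]
    exact Real.exp_le_exp.2 (by linarith)
  generalize ⌈Real.exp (γ - 4 * L)⌉₊ = M at hM hM2
  have hMpos : (0 : ℝ) < M := (Real.exp_pos _).trans_le hM
  refine ⟨M, by exact_mod_cast hMpos, (Real.le_log_iff_exp_le hMpos).2 hM, ?_⟩
  have h1 : 2 / (M : ℝ) ≤ 2 / n := div_le_div_of_nonneg_left (by norm_num) hn0 (hnM.trans hM)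
  have h2 : Real.exp (γ - 4 * L) * Real.exp (-γ) = 1 / (n : ℝ) ^ 4 := by
    rw [← Real.exp_add, ← hL, ← Real.exp_nat_mul, one_div, ← Real.exp_neg]
    congr 1
    push_cast
    ring
  have h3 : (M : ℝ) * Real.exp (-γ) ≤ 2 * (1 / (n : ℝ) ^ 4) := by
    rw [← h2, ← mul_assoc]
    exact mul_le_mul_of_nonneg_right (by linarith) (Real.exp_nonneg _)
  have h4 : (2 * (n : ℝ) + 1) * (2 * (1 / (n : ℝ) ^ 4)) ≤ 1 / n := by
    rw [← mul_assoc, mul_one_div, div_le_div_iff₀ (by positivity) hn0]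
    have h2n := mul_le_mul hn hn (by norm_num) hn0.le
    nlinarith [mul_le_mul_of_nonneg_right h2n (mul_nonneg hn0.le hn0.le)]
  have h5 : (M : ℝ) * ((2 * n + 1) * Real.exp (-γ)) ≤ 1 / n :=
    calc (M : ℝ) * ((2 * n + 1) * Real.exp (-γ)) = (2 * n + 1) * (M * Real.exp (-γ)) := by ring
      _ ≤ (2 * n + 1) * (2 * (1 / (n : ℝ) ^ 4)) := mul_le_mul_of_nonneg_left h3 (by positivity)
      _ ≤ 1 / n := h4
  calc _ ≤ 2 * (1 / (n : ℝ)) + 2 / n := add_le_add (by linarith) h1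
    _ = 4 / n := by ring

open Filter in
lemma eventually_log_le_rpow {δ : ℝ} (hδ : 0 < δ) :
    ∀ᶠ n : ℕ in atTop, 1 ≤ Real.log n ∧ 2 ≤ (n : ℝ) ^ ((1 : ℝ) / 6) ∧
      Real.log n ≤ δ * (n : ℝ) ^ ((1 : ℝ) / 6) := by
  refine tendsto_natCast_atTop_atTop.eventually
    (p := fun x : ℝ => 1 ≤ Real.log x ∧ 2 ≤ x ^ ((1 : ℝ) / 6) ∧
      Real.log x ≤ δ * x ^ ((1 : ℝ) / 6)) ?_
  have h6 : (0 : ℝ) < 1 / 6 := by norm_num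
  filter_upwards [Real.tendsto_log_atTop.eventually_ge_atTop 1,
    (tendsto_rpow_atTop h6).eventually_ge_atTop 2,
    (isLittleO_log_rpow_atTop h6).bound hδ, eventually_ge_atTop 0] with x h1 h2 h3 h0
  refine ⟨h1, h2, (le_abs_self _).trans ?_⟩
  rwa [Real.norm_eq_abs, Real.norm_of_nonneg (Real.rpow_nonneg h0 _)] at h3

end Asymptotics

/-- **Theorem 4** (achievability part): for every `ε ∈ (0, 1/2)`,
`log M*_f(n, ε) ≥ nC − √(nV) Q⁻¹(2ε) + O(n^{1/3} log n)`, where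
`V = η² V₁ + (1-η)² V₂`. -/
theorem flf_second_order_achievability
    (W1 W2 : 𝒳 → 𝒴 → ℝ)
    (hW1 : ∀ x y, 0 ≤ W1 x y) (hW1sum : ∀ x, ∑ y, W1 x y = 1)
    (hW2 : ∀ x y, 0 ≤ W2 x y) (hW2sum : ∀ x, ∑ y, W2 x y = 1)
    (Pstar : 𝒳 → ℝ) (C C1 C2 : ℝ)
    (hPstar : IsDist Pstar) (hPpos : ∀ x, 0 < Pstar x)
    (hCach : min (mutInfo Pstar W1) (mutInfo Pstar W2) = C)
    (hCmax : ∀ P, IsDist P → min (mutInfo P W1) (mutInfo P W2) ≤ C)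
    (hUniq : ∀ P, IsDist P → min (mutInfo P W1) (mutInfo P W2) = C → P = Pstar)
    (hC1 : IsLUB {r | ∃ P, IsDist P ∧ r = mutInfo P W1} C1)
    (hC2 : IsLUB {r | ∃ P, IsDist P ∧ r = mutInfo P W2} C2)
    (hC1gt : C < C1) (hC2gt : C < C2)
    (η : ℝ) (hη : η ∈ Set.Ioo (0 : ℝ) 1)
    (hηeq : ∀ v : 𝒳 → ℝ, ∑ x, v x = 0 →
      η * gradI Pstar W1 v + (1 - η) * gradI Pstar W2 v = 0)
    (hV1pos : 0 < condInfoVar Pstar W1) (hV2pos : 0 < condInfoVar Pstar W2)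
    (V : ℝ)
    (hV : V = η ^ 2 * condInfoVar Pstar W1 + (1 - η) ^ 2 * condInfoVar Pstar W2)
    (ε : ℝ) (hε : ε ∈ Set.Ioo (0 : ℝ) (1 / 2)) :
    ∃ K > (0 : ℝ), ∃ n₀ : ℕ, ∀ n ≥ n₀,
      Real.log (MstarF W1 W2 n ε)
        ≥ (n : ℝ) * C - Real.sqrt ((n : ℝ) * V) * Qinv (2 * ε)
            - K * (n : ℝ) ^ ((1 : ℝ) / 3) * Real.log n := by
  obtain ⟨_, ⟨R1, hR1, rfl⟩, hRC1⟩ := (lt_isLUB_iff hC1).1 hC1gt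
  obtain ⟨_, ⟨R2, hR2, rfl⟩, hRC2⟩ := (lt_isLUB_iff hC2).1 hC2gt
  obtain ⟨hI1, hI2⟩ := mutInfo_eq_of_isMaxMin hW1 hW1sum hW2 hW2sum hPpos hPstar.2 hCach hCmax
    hR1 hRC1 hR2 hRC2
  have : Nonempty 𝒳 := by
    by_contra h
    rw [not_nonempty_iff] at h
    simpa using hPstar.2
  have : Nonempty 𝒴 := by
    by_contra h
    rw [not_nonempty_iff] at h
    simpa using hW1sum (Classical.arbitrary 𝒳)
  have hVpos : 0 < V := by
    have := hη.1
    have := sub_pos.2 hη.2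
    rw [hV]
    positivity
  obtain ⟨K, δ, hK, hδ, hcode⟩ := exists_flf_code hW1 hW1sum hW2 hW2sum hPpos hPstar.2 hη.1 hη.2
    hηeq hI1 hI2 hR1 hRC1 hV hVpos hε.1 hε.2
  obtain ⟨n₀, hn₀⟩ := Filter.eventually_atTop.1 (eventually_log_le_rpow hδ)
  refine ⟨K + 5, by linarith, n₀, fun n hn => ?_⟩
  obtain ⟨hL1, hh2, hLh⟩ := hn₀ n hn
  have hnpos : (0 : ℝ) < n := by
    by_contra! h0
    rw [h0.antisymm n.cast_nonneg, Real.log_zero] at hL1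
    linarith
  have hh6 : ((n : ℝ) ^ ((1 : ℝ) / 6)) ^ 6 = n := by
    rw [← Real.rpow_natCast, ← Real.rpow_mul hnpos.le]
    norm_num
  have hh3 : (n : ℝ) ^ ((1 : ℝ) / 3) = ((n : ℝ) ^ ((1 : ℝ) / 6)) ^ 2 := by
    rw [← Real.rpow_natCast, ← Real.rpow_mul hnpos.le]
    norm_num
  have hexp := Real.exp_log hnpos
  rw [hh3]
  generalize (n : ℝ) ^ ((1 : ℝ) / 6) = h at hh2 hLh hh6
  generalize Real.log (n : ℝ) = L at hL1 hLh hexp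
  obtain ⟨γ, hγ, hex⟩ := hcode n h L hh6 hexp hh2 hL1 hLh
  have hhL : L ≤ h ^ 2 * L :=
    le_mul_of_one_le_left (by linarith) (one_le_pow₀ (by linarith))
  have hγ' : (n : ℝ) * C - Real.sqrt (n * V) * Qinv (2 * ε) - (K + 5) * h ^ 2 * L ≤ γ - 5 * L := by
    linarith
  rcases le_total (5 * L) γ with hγL | hγL
  · obtain ⟨M, hM, hMγ, herr⟩ := exists_codeSize hexp hL1 hγL
    have := log_le_log_MstarF hW1 hW2 hW1sum hW2sum hM (by linarith [hε.2]) (hex M hM herr)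
    linarith
  · linarith [Real.log_natCast_nonneg (MstarF W1 W2 n ε)]
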